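/- arXiv:1911.06885 — 8 statements merged into one kernel-verified Lean document; each statement's English description precedes it below -/
import Mathlib

section
/- Let c, k be real constants with c > 2k > 0. Then there exists a function φ: ℝ → ℝ of class C² such that: (i) (c − φ(ξ))·φ''(ξ) = (c − 2k)·φ(ξ) − 2·φ(ξ)² + (φ'(ξ))² for all ξ ∈ ℝ; (ii) φ is even; (iii) 0 < φ(ξ) < c for all ξ; (iv) φ is strictly increasing on (−∞, 0]; (v) φ(ξ) → 0 as ξ → ±∞; and (vi) the maximum value of φ is φ(0) = c − (2/3)k − √((2/9)·k·(3c + 2k)). -/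
open Filter

/-- A continuous function bounded below by a positive constant and even is the reciprocal speed
of a global odd increasing change of variables. -/
theorem exists_odd_strictMono_hasDerivAt_inv {h : ℝ → ℝ} (hc : Continuous h) {δ : ℝ}
    (hδ : 0 < δ) (hle : ∀ y, δ ≤ h y) (heven : ∀ y, h (-y) = h y) :
    ∃ Y : ℝ → ℝ, (∀ x, HasDerivAt Y (h (Y x))⁻¹ x) ∧ (∀ x, Y (-x) = -Y x) ∧ StrictMono Y ∧
      Tendsto Y atTop atTop ∧ Tendsto Y atBot atBot := by
  set X : ℝ → ℝ := fun y => ∫ t in (0 : ℝ)..y, h t with hX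
  have hd : ∀ y, HasDerivAt X (h y) y := fun y =>
    intervalIntegral.integral_hasDerivAt_right (hc.intervalIntegrable _ _)
      (hc.stronglyMeasurableAtFilter _ _) hc.continuousAt
  have hXcont : Continuous X := continuous_iff_continuousAt.2 fun y => (hd y).continuousAt
  have hmono : StrictMono X :=
    strictMono_of_hasDerivAt_pos hd fun y => hδ.trans_le (hle y)
  have hodd : ∀ y, X (-y) = -X y := fun y => by
    have := intervalIntegral.integral_comp_neg (a := 0) (b := y) h
    simp only [heven, neg_zero] at this
    simp only [hX]
    rw [intervalIntegral.integral_symm, this]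
  have hgrow : ∀ y, 0 ≤ y → δ * y ≤ X y := fun y hy => by
    have := intervalIntegral.integral_mono_on (μ := MeasureTheory.volume) hy (continuous_const.intervalIntegrable 0 y)
      (hc.intervalIntegrable 0 y) fun t _ => hle t
    simp at this
    linarith
  have htop : Tendsto X atTop atTop :=
    tendsto_atTop_mono' _ ((eventually_ge_atTop 0).mono hgrow)
      (tendsto_id.const_mul_atTop hδ)
  have hbot : Tendsto X atBot atBot := by
    have : X = fun y => -X (-y) := funext fun y => by rw [hodd, neg_neg]
    rw [this]
    exact tendsto_neg_atTop_atBot.comp (htop.comp tendsto_neg_atBot_atTop)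
  let e : ℝ ≃o ℝ := hmono.orderIsoOfSurjective X (hXcont.surjective htop hbot)
  have he : ∀ x, X (e.symm x) = x := e.apply_symm_apply
  refine ⟨e.symm, fun x => ?_, fun x => ?_, e.symm.strictMono, e.symm.tendsto_atTop,
    e.symm.tendsto_atBot⟩
  · exact (hd _).of_local_left_inverse e.symm.continuous.continuousAt
      (hδ.trans_le (hle _)).ne' (Eventually.of_forall he)
  · apply hmono.injective
    rw [hodd, he, he]

theorem contDiff_two_of_hasDerivAt {f f' f'' : ℝ → ℝ} (h : ∀ x, HasDerivAt f (f' x) x)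
    (h' : ∀ x, HasDerivAt f' (f'' x) x) (hc : Continuous f'') : ContDiff ℝ 2 f := by
  have e : deriv f = f' := funext fun x => (h x).deriv
  have e' : deriv f' = f'' := funext fun x => (h' x).deriv
  have h1 : ContDiff ℝ 1 f' :=
    contDiff_one_iff_deriv.2 ⟨fun x => (h' x).differentiableAt, e' ▸ hc⟩
  rw [show (2 : WithTop ℕ∞) = 1 + 1 by norm_num, contDiff_succ_iff_deriv]
  exact ⟨fun x => (h x).differentiableAt, by simp, e ▸ h1⟩

theorem DP_solitary_wave_existence (c k : ℝ) (hk : 0 < k) (hck : 2 * k < c) :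
    ∃ φ : ℝ → ℝ, ContDiff ℝ 2 φ ∧
      (∀ ξ : ℝ, (c - φ ξ) * deriv (deriv φ) ξ
          = (c - 2 * k) * φ ξ - 2 * (φ ξ) ^ 2 + (deriv φ ξ) ^ 2) ∧
      (∀ ξ : ℝ, φ (-ξ) = φ ξ) ∧
      (∀ ξ : ℝ, 0 < φ ξ ∧ φ ξ < c) ∧
      StrictMonoOn φ (Set.Iic 0) ∧
      Tendsto φ atTop (nhds 0) ∧ Tendsto φ atBot (nhds 0) ∧
      (∀ ξ : ℝ, φ ξ ≤ φ 0) ∧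
      φ 0 = c - (2 / 3) * k - Real.sqrt ((2 / 9) * k * (3 * c + 2 * k)) := by
  have hc : 0 < c := by linarith
  set r := Real.sqrt ((2 / 9) * k * (3 * c + 2 * k)) with hr
  have hr0 : 0 < r := Real.sqrt_pos.2 (by positivity)
  have hr2 : r ^ 2 = (2 / 9) * k * (3 * c + 2 * k) := Real.sq_sqrt (by positivity)
  obtain ⟨a, ha⟩ : ∃ a, a = c - (2 / 3) * k := ⟨_, rfl⟩
  have ha0 : 0 < a := by linarith
  set B := c * (c - 2 * k) with hB
  have hB0 : 0 < B := mul_pos hc (by linarith)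
  have hrB : r ^ 2 = a ^ 2 - B := by rw [hr2, ha, hB]; ring
  set b := Real.sqrt B with hb
  have hb0 : 0 < b := Real.sqrt_pos.2 hB0
  have hb2 : b ^ 2 = B := Real.sq_sqrt hB0.le
  clear_value r b
  set q : ℝ → ℝ := fun y => a + r * Real.cosh (b * y) with hq
  have hq0 : ∀ y, 0 < q y := fun y => by positivity
  have hqge : ∀ y, a + r ≤ q y := fun y => by
    have := mul_le_mul_of_nonneg_left (Real.one_le_cosh (b * y)) hr0.le
    simp only [hq]; linarith
  set F : ℝ → ℝ := fun y => B / q y with hF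
  set F' : ℝ → ℝ := fun y => -(B * (r * (b * Real.sinh (b * y)))) / q y ^ 2 with hF'
  have hby : ∀ y, HasDerivAt (fun y => b * y) b y := fun y => by
    simpa using (hasDerivAt_id y).const_mul b
  have hdq : ∀ y, HasDerivAt q (r * (b * Real.sinh (b * y))) y := fun y =>
    ((((hby y).cosh).const_mul r).const_add a).congr_deriv (by ring)
  have hdF : ∀ y, HasDerivAt F (F' y) y := fun y =>
    ((hasDerivAt_const y B).div (hdq y) (hq0 y).ne').congr_deriv (by simp [hF'])
  have hdF' : ∀ y, HasDerivAt F' ((c - F y) * ((c - 2 * k) * F y - 2 * F y ^ 2)) y := fun y => by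
    have hs := (((((hby y).sinh).const_mul b).const_mul r).const_mul B).neg
    refine (hs.div ((hdq y).pow 2) (pow_pos (hq0 y) 2).ne').congr_deriv ?_
    have hne := (hq0 y).ne'
    have hcs := Real.cosh_sq (b * y)
    have hqy : r * Real.cosh (b * y) = q y - a := by simp [hq]
    have hrs : r ^ 2 * Real.sinh (b * y) ^ 2 = (q y - a) ^ 2 - (a ^ 2 - B) := by
      rw [← hqy, ← hrB]; linear_combination -r ^ 2 * hcs
    have hr1 : (c - F y) * ((c - 2 * k) * F y - 2 * F y ^ 2)
        = B ^ 2 * (q y ^ 2 - 3 * a * q y + 2 * B) / q y ^ 3 := by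
      simp only [hF]
      field_simp
      rw [ha, hB]
      ring
    rw [hr1]
    simp only [Pi.pow_apply, Pi.neg_apply]
    generalize q y = Q at *
    generalize Real.cosh (b * y) = C at *
    generalize Real.sinh (b * y) = s at *
    clear_value B
    field_simp
    norm_num
    linear_combination (-r * C * Q ^ 2 + 2 * r ^ 2 * s ^ 2 * Q) * hb2 - B * Q ^ 2 * hqy
      + 2 * B * Q * hrs
  have hF0 : ∀ y, 0 < F y := fun y => div_pos hB0 (hq0 y)
  have hFzero : F 0 = a - r := by
    simp only [hF, hq, mul_zero, Real.cosh_zero, mul_one]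
    rw [div_eq_iff (by positivity)]
    clear_value B
    linear_combination hrB
  have hFle : ∀ y, F y ≤ F 0 := fun y => by
    simp only [hF]
    have : q 0 = a + r := by simp [hq]
    rw [this]
    exact div_le_div_of_nonneg_left hB0.le (by positivity) (hqge y)
  have hFeven : ∀ y, F (-y) = F y := fun y => by simp [hF, hq]
  have hlt : F 0 < c := by linarith
  have hFcont : Continuous F := continuous_iff_continuousAt.2 fun y => (hdF y).continuousAt
  have hF'cont : Continuous F' := continuous_iff_continuousAt.2 fun y => (hdF' y).continuousAt
  have hFmono : StrictMonoOn F (Set.Iic 0) := fun x hx y hy hxy => by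
    refine div_lt_div_of_pos_left hB0 (hq0 y) ?_
    have : Real.cosh (b * y) < Real.cosh (b * x) := by
      rw [Real.cosh_lt_cosh, abs_mul, abs_mul, abs_of_nonpos (Set.mem_Iic.1 hx),
        abs_of_nonpos (Set.mem_Iic.1 hy)]
      exact mul_lt_mul_of_pos_left (neg_lt_neg hxy) (abs_pos.2 hb0.ne')
    simp only [hq]
    gcongr
  have hqtop : Tendsto q atTop atTop := by
    refine tendsto_atTop_mono' _ ((eventually_ge_atTop 0).mono fun y hy => ?_)
      (tendsto_id.const_mul_atTop (mul_pos hr0 hb0))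
    have h1 : b * y ≤ Real.cosh (b * y) :=
      (Real.self_le_sinh_iff.2 (by positivity)).trans (Real.sinh_lt_cosh _).le
    have := mul_le_mul_of_nonneg_left h1 hr0.le
    simp only [hq, id]
    linarith
  have hFtop : Tendsto F atTop (nhds 0) := hqtop.const_div_atTop B
  have hFbot : Tendsto F atBot (nhds 0) := by
    have : F = F ∘ fun y => -y := funext fun y => (hFeven y).symm
    rw [this]
    exact hFtop.comp tendsto_neg_atBot_atTop
  obtain ⟨Y, hdY, hYodd, hYmono, hYtop, hYbot⟩ :=
    exists_odd_strictMono_hasDerivAt_inv (h := fun y => c - F y) (by fun_prop)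
      (sub_pos.2 hlt) (fun y => by linarith [hFle y]) (fun y => by rw [hFeven])
  have hG : ∀ y, 0 < c - F y := fun y => by linarith [hFle y]
  have hY0 : Y 0 = 0 := by
    have := hYodd 0
    rw [neg_zero] at this
    linarith
  have hYcont : Continuous Y := continuous_iff_continuousAt.2 fun x => (hdY x).continuousAt
  have hd1 : ∀ x, HasDerivAt (fun x => F (Y x)) (F' (Y x) / (c - F (Y x))) x := fun x =>
    ((hdF _).comp x (hdY x)).congr_deriv (by rw [div_eq_mul_inv])
  have hd2 : ∀ x, HasDerivAt (fun x => F' (Y x) / (c - F (Y x)))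
      (((c - 2 * k) * F (Y x) - 2 * F (Y x) ^ 2 + (F' (Y x) / (c - F (Y x))) ^ 2)
        / (c - F (Y x))) x := fun x => by
    refine (((hdF' _).comp x (hdY x)).div ((hd1 x).const_sub c) (hG _).ne').congr_deriv ?_
    have := (hG (Y x)).ne'
    simp only [Function.comp_apply]
    field_simp
    ring
  have e1 : deriv (fun x => F (Y x)) = fun x => F' (Y x) / (c - F (Y x)) :=
    funext fun x => (hd1 x).deriv
  refine ⟨fun x => F (Y x), contDiff_two_of_hasDerivAt hd1 hd2 ?_, fun x => ?_, fun x => ?_,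
    fun x => ⟨hF0 _, by linarith [hG (Y x)]⟩, fun x hx y hy hxy => ?_, hFtop.comp hYtop,
    hFbot.comp hYbot, fun x => ?_, ?_⟩
  · have h1 : Continuous fun x => F (Y x) := hFcont.comp hYcont
    have h2 : Continuous fun x => F' (Y x) := hF'cont.comp hYcont
    have h3 : Continuous fun x => c - F (Y x) := continuous_const.sub h1
    have hne : ∀ x, c - F (Y x) ≠ 0 := fun x => (hG _).ne'
    exact (((h1.const_mul _).sub ((h1.pow 2).const_mul 2)).add ((h2.div h3 hne).pow 2)).div h3 hne
  · rw [e1, (hd2 x).deriv]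
    exact mul_div_cancel₀ _ (hG (Y x)).ne'
  · simp only [hYodd, hFeven]
  · exact hFmono (by simpa [hY0] using hYmono.monotone hx)
      (by simpa [hY0] using hYmono.monotone hy) (hYmono hxy)
  · simpa only [hY0] using hFle (Y x)
  · simp only [hY0, hFzero, ha]
end

section
/- Let c, k be real constants with c > 2k > 0. Suppose φ₁, φ₂ : ℝ → ℝ are both of class C², both satisfy (c − φᵢ(ξ))·φᵢ''(ξ) = (c − 2k)·φᵢ(ξ) − 2·φᵢ(ξ)² + (φᵢ'(ξ))² on ℝ, both satisfy 0 < φᵢ(ξ) < c for all ξ, and both tend to 0 as ξ → ±∞. Then there exists x₀ ∈ ℝ such that φ₂(ξ) = φ₁(ξ + x₀) for all ξ ∈ ℝ; that is, the solitary wave with speed c is unique up to translation. -/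
open Filter

/-- Solutions of `f'' = H (f)` with values in a set where `H` is Lipschitz are determined by their
initial position and velocity. -/
theorem eq_of_deriv_deriv_eq_of_lipschitzOnWith {H : ℝ → ℝ} {K : NNReal} {s : Set ℝ}
    (hH : LipschitzOnWith K H s) {f g f' g' : ℝ → ℝ} {t₀ : ℝ}
    (hf : ∀ t, HasDerivAt f (f' t) t) (hf' : ∀ t, HasDerivAt f' (H (f t)) t) (hfs : ∀ t, f t ∈ s)
    (hg : ∀ t, HasDerivAt g (g' t) t) (hg' : ∀ t, HasDerivAt g' (H (g t)) t) (hgs : ∀ t, g t ∈ s)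
    (h₀ : f t₀ = g t₀) (h₀' : f' t₀ = g' t₀) : f = g := by
  have hv : LipschitzOnWith (max 1 (K * 1)) (fun y : ℝ × ℝ => (y.2, H y.1))
      (s ×ˢ (Set.univ : Set ℝ)) :=
    LipschitzWith.prod_snd.lipschitzOnWith.prodMk
      (hH.comp LipschitzWith.prod_fst.lipschitzOnWith fun y hy => hy.1)
  have h := ODE_solution_unique_univ (v := fun _ y => (y.2, H y.1)) (t₀ := t₀)
    (f := fun t => (f t, f' t)) (g := fun t => (g t, g' t)) (fun _ => hv)
    (fun t => ⟨(hf t).prodMk (hf' t), hfs t, trivial⟩)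
    (fun t => ⟨(hg t).prodMk (hg' t), hgs t, trivial⟩) (Prod.ext h₀ h₀')
  funext t
  exact congrArg Prod.fst (congrFun h t)

/-- A differentiable function converging at `+∞` has a sequence of points tending to `+∞` along
which its derivative tends to zero. -/
theorem exists_tendsto_deriv_zero_of_tendsto_atTop {f f' : ℝ → ℝ} {a : ℝ}
    (hf : ∀ t, HasDerivAt f (f' t) t) (h : Tendsto f atTop (nhds a)) :
    ∃ u : ℕ → ℝ, Tendsto u atTop atTop ∧ Tendsto (fun n => f' (u n)) atTop (nhds 0) := by
  have hmvt : ∀ n : ℕ, ∃ x : ℝ, (n : ℝ) < x ∧ f' x = f (n + 1) - f n := by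
    intro n
    obtain ⟨x, hx, hxs⟩ := exists_hasDerivAt_eq_slope f f' (lt_add_one (n : ℝ))
      (fun x _ => (hf x).continuousAt.continuousWithinAt) (fun x _ => hf x)
    exact ⟨x, hx.1, by simpa using hxs⟩
  choose u hu hslope using hmvt
  refine ⟨u, tendsto_atTop_mono (fun n => (hu n).le) tendsto_natCast_atTop_atTop, ?_⟩
  simp only [hslope]
  simpa using (h.comp (tendsto_atTop_add_const_right _ 1 tendsto_natCast_atTop_atTop)).sub
    (h.comp tendsto_natCast_atTop_atTop)

/-- The potential in the first integral of the Degasperis–Procesi profile equation. -/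
noncomputable def dpPotential (c k x : ℝ) : ℝ :=
  x ^ 2 / 6 * (3 * c * (c - 2 * k) - 2 * (3 * c - 2 * k) * x + 3 * x ^ 2)

/-- The first integral of the Degasperis–Procesi profile equation, evaluated on a wave vanishing
at `+∞`. -/
theorem dp_first_integral {c k : ℝ} {φ φ' φ'' : ℝ → ℝ}
    (hφ : ∀ t, HasDerivAt φ (φ' t) t) (hφ' : ∀ t, HasDerivAt φ' (φ'' t) t)
    (hode : ∀ t, (c - φ t) * φ'' t = (c - 2 * k) * φ t - 2 * φ t ^ 2 + φ' t ^ 2)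
    (htop : Tendsto φ atTop (nhds 0)) (t : ℝ) :
    (c - φ t) ^ 2 * φ' t ^ 2 = 2 * dpPotential c k (φ t) := by
  set E : ℝ → ℝ := fun t => (c - φ t) ^ 2 * φ' t ^ 2 - 2 * (φ t ^ 2 / 6 *
    (3 * c * (c - 2 * k) - 2 * (3 * c - 2 * k) * φ t + 3 * φ t ^ 2)) with hE
  have hder : ∀ t, HasDerivAt E 0 t := by
    intro t
    refine ((((hφ t).const_sub c).pow 2).mul ((hφ' t).pow 2) |>.sub
      (((((hφ t).pow 2).div_const 6).mul ((((hφ t).const_mul (2 * (3 * c - 2 * k))).const_sub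
        (3 * c * (c - 2 * k))).add (((hφ t).pow 2).const_mul 3))).const_mul 2)).congr_deriv ?_
    simp only [Pi.pow_apply]
    norm_num
    linear_combination 2 * (c - φ t) * φ' t * hode t
  obtain ⟨u, hu, hu'⟩ := exists_tendsto_deriv_zero_of_tendsto_atTop hφ htop
  have hlim : Tendsto (fun n => E (u n)) atTop (nhds 0) := by
    have hφu := htop.comp hu
    have := (((hφu.const_sub c).pow 2).mul (hu'.pow 2)).sub
      ((((hφu.pow 2).div_const 6).mul (((hφu.const_mul (2 * (3 * c - 2 * k))).const_sub
        (3 * c * (c - 2 * k))).add ((hφu.pow 2).const_mul 3))).const_mul 2)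
    simpa [hE] using this
  have hconst : ∀ x, E x = E t := fun x =>
    is_const_of_deriv_eq_zero (fun y => (hder y).differentiableAt) (fun y => (hder y).deriv) x t
  simp only [hconst] at hlim
  have h0 : E t = 0 := tendsto_nhds_unique tendsto_const_nhds hlim
  simp only [hE] at h0
  rw [dpPotential]
  linarith

/-- The force in the profile equation after eliminating the velocity by the first integral. -/
noncomputable def dpForce (c k x : ℝ) : ℝ :=
  ((c - 2 * k) * x - 2 * x ^ 2 + 2 * dpPotential c k x / (c - x) ^ 2) / (c - x)

theorem exists_lipschitzOnWith_dpForce {c k M : ℝ} (hM : M < c) :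
    ∃ K, LipschitzOnWith K (dpForce c k) (Set.Icc 0 M) := by
  have hne : ∀ x ∈ Set.Icc 0 M, c - x ≠ 0 := fun x hx => by linarith [hx.2]
  have hsmooth : ContDiffOn ℝ 1 (dpForce c k) (Set.Icc 0 M) := by
    unfold dpForce dpPotential
    refine ContDiffOn.div (ContDiffOn.add (by fun_prop) (ContDiffOn.div (by fun_prop) (by fun_prop)
      fun x hx => pow_ne_zero 2 (hne x hx))) (by fun_prop) hne
  exact hsmooth.exists_lipschitzOnWith one_ne_zero (convex_Icc 0 M) isCompact_Icc

theorem deriv_deriv_eq_dpForce {c k : ℝ} {φ φ' φ'' : ℝ → ℝ}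
    (hφ : ∀ t, HasDerivAt φ (φ' t) t) (hφ' : ∀ t, HasDerivAt φ' (φ'' t) t)
    (hode : ∀ t, (c - φ t) * φ'' t = (c - 2 * k) * φ t - 2 * φ t ^ 2 + φ' t ^ 2)
    (hlt : ∀ t, φ t < c) (htop : Tendsto φ atTop (nhds 0)) (t : ℝ) :
    φ'' t = dpForce c k (φ t) := by
  have hne : c - φ t ≠ 0 := by linarith [hlt t]
  rw [dpForce, ← dp_first_integral hφ hφ' hode htop t, eq_div_iff hne,
    mul_div_cancel_left₀ _ (pow_ne_zero 2 hne), ← hode t, mul_comm]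

/-- The potential has at most one zero strictly between `0` and `c`. -/
theorem eq_of_dpPotential_eq_zero {c k x y : ℝ} (hk : 0 < k) (hx : 0 < x) (hxc : x < c)
    (hy : 0 < y) (hyc : y < c) (hx0 : dpPotential c k x = 0) (hy0 : dpPotential c k y = 0) :
    x = y := by
  unfold dpPotential at hx0 hy0
  have hqx := (mul_eq_zero.mp hx0).resolve_left (by positivity)
  have hqy := (mul_eq_zero.mp hy0).resolve_left (by positivity)
  by_contra hne
  have hsum : 3 * (x + y) = 2 * (3 * c - 2 * k) :=
    mul_left_cancel₀ (sub_ne_zero.mpr hne) (by linear_combination hqx - hqy)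
  have hpos : 0 < (c - x) * (c - y) := mul_pos (sub_pos.mpr hxc) (sub_pos.mpr hyc)
  nlinarith [mul_pos hk (hx.trans hxc)]

/-- A positive continuous function vanishing at `±∞` attains its maximum. -/
theorem exists_forall_le_of_tendsto_zero {f : ℝ → ℝ} (hf : Continuous f) (hpos : ∀ t, 0 < f t)
    (htop : Tendsto f atTop (nhds 0)) (hbot : Tendsto f atBot (nhds 0)) :
    ∃ a, ∀ t, f t ≤ f a := by
  refine hf.exists_forall_ge' 0 ?_
  rw [cocompact_eq_atBot_atTop, eventually_sup]
  exact ⟨hbot.eventually_le_const (hpos 0), htop.eventually_le_const (hpos 0)⟩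

theorem hasDerivAt_deriv_of_contDiff_two {f : ℝ → ℝ} (hf : ContDiff ℝ 2 f) (t : ℝ) :
    HasDerivAt f (deriv f t) t ∧ HasDerivAt (deriv f) (deriv (deriv f) t) t := by
  have h : ContDiff ℝ (1 + 1) f := by simpa [one_add_one_eq_two] using hf
  exact ⟨(hf.differentiable two_ne_zero t).hasDerivAt,
    ((contDiff_succ_iff_deriv.mp h).2.2.differentiable one_ne_zero t).hasDerivAt⟩

/-- Uniqueness, up to translation, of smooth solitary waves for the
Degasperis–Procesi equation. -/
theorem DP_solitary_wave_uniqueness (c k : ℝ) (hk : 0 < k) (hck : 2 * k < c)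
    (φ₁ φ₂ : ℝ → ℝ) (hφ₁ : ContDiff ℝ 2 φ₁) (hφ₂ : ContDiff ℝ 2 φ₂)
    (hode₁ : ∀ ξ : ℝ, (c - φ₁ ξ) * deriv (deriv φ₁) ξ
        = (c - 2 * k) * φ₁ ξ - 2 * (φ₁ ξ) ^ 2 + (deriv φ₁ ξ) ^ 2)
    (hode₂ : ∀ ξ : ℝ, (c - φ₂ ξ) * deriv (deriv φ₂) ξ
        = (c - 2 * k) * φ₂ ξ - 2 * (φ₂ ξ) ^ 2 + (deriv φ₂ ξ) ^ 2)
    (hbd₁ : ∀ ξ : ℝ, 0 < φ₁ ξ ∧ φ₁ ξ < c)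
    (hbd₂ : ∀ ξ : ℝ, 0 < φ₂ ξ ∧ φ₂ ξ < c)
    (htop₁ : Tendsto φ₁ atTop (nhds 0)) (hbot₁ : Tendsto φ₁ atBot (nhds 0))
    (htop₂ : Tendsto φ₂ atTop (nhds 0)) (hbot₂ : Tendsto φ₂ atBot (nhds 0)) :
    ∃ x₀ : ℝ, ∀ ξ : ℝ, φ₂ ξ = φ₁ (ξ + x₀) := by
  obtain ⟨a, ha⟩ :=
    exists_forall_le_of_tendsto_zero hφ₁.continuous (fun t => (hbd₁ t).1) htop₁ hbot₁
  obtain ⟨b, hb⟩ :=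
    exists_forall_le_of_tendsto_zero hφ₂.continuous (fun t => (hbd₂ t).1) htop₂ hbot₂
  have hd₁ := fun t => (hasDerivAt_deriv_of_contDiff_two hφ₁ t).1
  have hd₂ := fun t => (hasDerivAt_deriv_of_contDiff_two hφ₂ t).1
  have hdd₁ := fun t => (hasDerivAt_deriv_of_contDiff_two hφ₁ t).2
  have hdd₂ := fun t => (hasDerivAt_deriv_of_contDiff_two hφ₂ t).2
  have ha' : deriv φ₁ a = 0 := IsLocalMax.deriv_eq_zero (Eventually.of_forall ha)
  have hb' : deriv φ₂ b = 0 := IsLocalMax.deriv_eq_zero (Eventually.of_forall hb)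
  have hGa := dp_first_integral hd₁ hdd₁ hode₁ htop₁ a
  have hGb := dp_first_integral hd₂ hdd₂ hode₂ htop₂ b
  rw [ha'] at hGa
  rw [hb'] at hGb
  have hmax : φ₁ a = φ₂ b := eq_of_dpPotential_eq_zero hk (hbd₁ a).1 (hbd₁ a).2 (hbd₂ b).1
    (hbd₂ b).2 (by linarith) (by linarith)
  obtain ⟨K, hK⟩ := exists_lipschitzOnWith_dpForce (k := k) (hbd₁ a).2
  have hforce₁ := deriv_deriv_eq_dpForce hd₁ hdd₁ hode₁ (fun t => (hbd₁ t).2) htop₁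
  have hforce₂ := deriv_deriv_eq_dpForce hd₂ hdd₂ hode₂ (fun t => (hbd₂ t).2) htop₂
  have heq : (fun t => φ₁ (t + a)) = fun t => φ₂ (t + b) := by
    refine eq_of_deriv_deriv_eq_of_lipschitzOnWith hK (t₀ := 0)
      (f' := fun t => deriv φ₁ (t + a)) (g' := fun t => deriv φ₂ (t + b))
      (fun t => (hd₁ (t + a)).comp_add_const t a) (fun t => ?_)
      (fun t => ⟨(hbd₁ _).1.le, ha _⟩)
      (fun t => (hd₂ (t + b)).comp_add_const t b) (fun t => ?_)
      (fun t => ⟨(hbd₂ _).1.le, hmax ▸ hb _⟩) (by simpa using hmax) (by simp [ha', hb'])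
    · rw [← hforce₁]
      exact (hdd₁ (t + a)).comp_add_const t a
    · rw [← hforce₂]
      exact (hdd₂ (t + b)).comp_add_const t b
  refine ⟨a - b, fun ξ => ?_⟩
  have h := congrFun heq (ξ - b)
  simp only [sub_add_cancel] at h
  rw [← h]
  congr 1
  ring
end

section
/- Let c, k be real constants with c > 2k > 0 and let φ : ℝ → ℝ be a C² function satisfying (c − φ(ξ))·φ''(ξ) = (c − 2k)·φ(ξ) − 2·φ(ξ)² + (φ'(ξ))² on ℝ, such that φ, φ' are bounded and φ(ξ) → 0, φ'(ξ) → 0 as ξ → ±∞, and φ is integrable on ℝ. Then for every ξ ∈ ℝ, c·φ(ξ) − (1/2)·φ(ξ)² = ((3c + 2k)/4)·∫_ℝ e^{−2|ξ−s|}·φ(s) ds; that is, φ satisfies the nonlocal traveling-wave equation c·φ − (1/2)φ² = (3c + 2k)·K*φ, where (K*f)(ξ) = (1/4)∫_ℝ e^{−2|ξ−s|} f(s) ds is the convolution operator realizing (4 − ∂_ξ²)^{−1}. -/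
open Filter MeasureTheory

/-- If `F` and its derivative vanish at infinity and `(4 - ∂²) F` is integrable, then `F` is
recovered from it by convolution with the Green's function of `4 - ∂²`. -/
theorem integral_exp_neg_two_abs_mul_eq {F F' g : ℝ → ℝ}
    (hF : ∀ x, HasDerivAt F (F' x) x) (hF' : ∀ x, HasDerivAt F' (4 * F x - g x) x)
    (hg : Integrable g)
    (htop : Tendsto F atTop (nhds 0)) (hbot : Tendsto F atBot (nhds 0))
    (htop' : Tendsto F' atTop (nhds 0)) (hbot' : Tendsto F' atBot (nhds 0)) (ξ : ℝ) :
    ∫ s : ℝ, Real.exp (-2 * |ξ - s|) * g s = 4 * F ξ := by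
  have hint : Integrable fun s => Real.exp (-2 * |ξ - s|) * g s := by
    refine hg.bdd_mul (c := 1) (by fun_prop) (Eventually.of_forall fun s => ?_)
    rw [Real.norm_eq_abs, Real.abs_exp]
    exact Real.exp_le_one_iff.mpr (by linarith [abs_nonneg (ξ - s)])
  have hleft_eq : Set.EqOn (fun s => Real.exp (-2 * |ξ - s|) * g s)
      (fun s => Real.exp (2 * (s - ξ)) * g s) (Set.Iic ξ) := by
    intro s hs
    simp only [Set.mem_Iic] at hs
    simp only [abs_of_nonneg (sub_nonneg.mpr hs)]
    ring_nf
  have hright_eq : Set.EqOn (fun s => Real.exp (-2 * |ξ - s|) * g s)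
      (fun s => Real.exp (-2 * (s - ξ)) * g s) (Set.Ioi ξ) := by
    intro s hs
    simp only [Set.mem_Ioi] at hs
    simp only [abs_of_nonpos (sub_nonpos.mpr hs.le), neg_sub]
  have hexp (a s : ℝ) : HasDerivAt (fun s => Real.exp (a * (s - ξ)))
      (Real.exp (a * (s - ξ)) * a) s := by
    simpa using (((hasDerivAt_id s).sub_const ξ).const_mul a).exp
  have hleft : ∫ s in Set.Iic ξ, Real.exp (2 * (s - ξ)) * g s = 2 * F ξ - F' ξ := by
    have hd (s : ℝ) : HasDerivAt (fun s => Real.exp (2 * (s - ξ)) * (2 * F s - F' s))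
        (Real.exp (2 * (s - ξ)) * g s) s := by
      refine ((hexp 2 s).mul (((hF s).const_mul 2).sub (hF' s))).congr_deriv ?_
      simp only [Pi.sub_apply]
      ring
    have hlim : Tendsto (fun s => Real.exp (2 * (s - ξ)) * (2 * F s - F' s)) atBot (nhds 0) := by
      have he : Tendsto (fun s => Real.exp (2 * (s - ξ))) atBot (nhds 0) :=
        Real.tendsto_exp_atBot.comp
          ((tendsto_atBot_add_const_right _ (-ξ) tendsto_id).const_mul_atBot two_pos)
      simpa using he.mul ((hbot.const_mul 2).sub hbot')
    have h := integral_Iic_of_hasDerivAt_of_tendsto' (a := ξ) (fun s _ => hd s)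
      ((integrableOn_congr_fun hleft_eq measurableSet_Iic).mp hint.integrableOn) hlim
    simpa using h
  have hright : ∫ s in Set.Ioi ξ, Real.exp (-2 * (s - ξ)) * g s = 2 * F ξ + F' ξ := by
    have hd (s : ℝ) : HasDerivAt (fun s => Real.exp (-2 * (s - ξ)) * (-2 * F s - F' s))
        (Real.exp (-2 * (s - ξ)) * g s) s := by
      refine ((hexp (-2) s).mul (((hF s).const_mul (-2)).sub (hF' s))).congr_deriv ?_
      simp only [Pi.sub_apply]
      ring
    have hlim : Tendsto (fun s => Real.exp (-2 * (s - ξ)) * (-2 * F s - F' s)) atTop (nhds 0) := by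
      have he : Tendsto (fun s => Real.exp (-2 * (s - ξ))) atTop (nhds 0) :=
        Real.tendsto_exp_atBot.comp
          ((tendsto_atTop_add_const_right _ (-ξ) tendsto_id).const_mul_atTop_of_neg (by norm_num))
      simpa using he.mul ((htop.const_mul (-2)).sub htop')
    have h := integral_Ioi_of_hasDerivAt_of_tendsto' (a := ξ) (fun s _ => hd s)
      ((integrableOn_congr_fun hright_eq measurableSet_Ioi).mp hint.integrableOn) hlim
    rw [h]
    simp
    ring
  rw [← intervalIntegral.integral_Iic_add_Ioi hint.integrableOn hint.integrableOn,
    setIntegral_congr_fun measurableSet_Iic hleft_eq,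
    setIntegral_congr_fun measurableSet_Ioi hright_eq, hleft, hright]
  ring

/-- A decaying solution of the DP traveling-wave ODE satisfies the nonlocal
traveling-wave equation `c·φ − (1/2)φ² = (3c + 2k)·K*φ`, where `K` is the
Green's function of `4 − ∂²`. -/
theorem DP_nonlocal_traveling_wave_equation (c k : ℝ) (hk : 0 < k) (hck : 2 * k < c)
    (φ : ℝ → ℝ) (hφ : ContDiff ℝ 2 φ)
    (hode : ∀ ξ : ℝ, (c - φ ξ) * deriv (deriv φ) ξ
        = (c - 2 * k) * φ ξ - 2 * (φ ξ) ^ 2 + (deriv φ ξ) ^ 2)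
    (hbdd : ∃ M : ℝ, ∀ ξ : ℝ, |φ ξ| ≤ M ∧ |deriv φ ξ| ≤ M)
    (htop : Tendsto φ atTop (nhds 0)) (hbot : Tendsto φ atBot (nhds 0))
    (htop' : Tendsto (deriv φ) atTop (nhds 0)) (hbot' : Tendsto (deriv φ) atBot (nhds 0))
    (hint : Integrable φ) :
    ∀ ξ : ℝ, c * φ ξ - (1 / 2) * (φ ξ) ^ 2
      = ((3 * c + 2 * k) / 4) * ∫ s : ℝ, Real.exp (-2 * |ξ - s|) * φ s := by
  intro ξ
  have hd (x : ℝ) : HasDerivAt φ (deriv φ x) x :=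
    (hφ.differentiable (by norm_num) x).hasDerivAt
  have hd' (x : ℝ) : HasDerivAt (deriv φ) (deriv (deriv φ) x) x :=
    ((hφ.deriv' (n := 1)).differentiable (by norm_num) x).hasDerivAt
  have hF (x : ℝ) : HasDerivAt (fun x => c * φ x - (1 / 2) * (φ x) ^ 2)
      ((c - φ x) * deriv φ x) x := by
    refine (((hd x).const_mul c).sub (((hd x).pow 2).const_mul (1 / 2))).congr_deriv ?_
    push_cast
    ring
  have hF' (x : ℝ) : HasDerivAt (fun x => (c - φ x) * deriv φ x)
      (4 * (c * φ x - (1 / 2) * (φ x) ^ 2) - (3 * c + 2 * k) * φ x) x := by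
    refine (((hd x).const_sub c).mul (hd' x)).congr_deriv ?_
    linear_combination hode x
  have hlim {l : Filter ℝ} (h : Tendsto φ l (nhds 0)) :
      Tendsto (fun x => c * φ x - (1 / 2) * (φ x) ^ 2) l (nhds 0) := by
    simpa [-one_div] using (h.const_mul c).sub ((h.pow 2).const_mul (1 / 2))
  have hlim' {l : Filter ℝ} (h : Tendsto φ l (nhds 0)) (h' : Tendsto (deriv φ) l (nhds 0)) :
      Tendsto (fun x => (c - φ x) * deriv φ x) l (nhds 0) := by
    simpa using (h.const_sub c).mul h'
  have key := integral_exp_neg_two_abs_mul_eq hF hF' (hint.const_mul (3 * c + 2 * k))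
    (hlim htop) (hlim hbot) (hlim' htop htop') (hlim' hbot hbot') ξ
  simp only [mul_left_comm _ (3 * c + 2 * k), integral_const_mul] at key
  linear_combination -key / 4
end

section
/- Let c, k be real constants with c > 2k > 0 and let φ : ℝ → ℝ be a solitary wave profile with speed c: a C² even function satisfying the ODE (c − φ)φ'' = (c − 2k)φ − 2φ² + (φ')² on ℝ, with 0 < φ < c, strictly increasing on (−∞, 0], and such that φ, φ' tend to 0 at ±∞ and are integrable. Then for every ξ ∈ ℝ, (c − φ(ξ))·φ'(ξ) = ((3c + 2k)/4)·∫_ℝ e^{−2|ξ−s|}·φ'(s) ds. In other words, φ' satisfies L_c φ' = 0, where L_c f = (c − φ)f − (3c + 2k)·K*f and (K*f)(ξ) = (1/4)∫_ℝ e^{−2|ξ−s|} f(s) ds, so that 0 is an eigenvalue of the linearized operator L_c with eigenfunction ∂_ξ φ. -/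
open Filter MeasureTheory

/-- If `4 w - w'' = f` with `f` integrable and `w`, `w'` vanishing at `±∞`, then `4 w` is the
convolution of `f` with the kernel `exp (-2 |x|)`. -/
theorem four_mul_eq_integral_exp_neg_two_abs_mul {w v f : ℝ → ℝ}
    (hw : ∀ x, HasDerivAt w (v x) x) (hv : ∀ x, HasDerivAt v (4 * w x - f x) x)
    (hf : Integrable f)
    (hwt : Tendsto w atTop (nhds 0)) (hwb : Tendsto w atBot (nhds 0))
    (hvt : Tendsto v atTop (nhds 0)) (hvb : Tendsto v atBot (nhds 0)) (ξ : ℝ) :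
    4 * w ξ = ∫ s : ℝ, Real.exp (-2 * |ξ - s|) * f s := by
  have hint : Integrable fun s : ℝ => Real.exp (-2 * |ξ - s|) * f s := by
    refine hf.bdd_mul (c := 1) (by fun_prop) (.of_forall fun s => ?_)
    rw [Real.norm_eq_abs, Real.abs_exp, Real.exp_le_one_iff]
    linarith [abs_nonneg (ξ - s)]
  have hleft : ∫ s in Set.Iic ξ, Real.exp (-2 * |ξ - s|) * f s = 2 * w ξ - v ξ := by
    have heq : Set.EqOn (fun s => Real.exp (-2 * |ξ - s|) * f s)
        (fun s => Real.exp (2 * (s - ξ)) * f s) (Set.Iic ξ) := fun s hs => by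
      simp only [abs_of_nonneg (sub_nonneg.2 (Set.mem_Iic.1 hs))]
      ring_nf
    rw [setIntegral_congr_fun measurableSet_Iic heq,
      integral_Iic_of_hasDerivAt_of_tendsto'
        (f := fun s => Real.exp (2 * (s - ξ)) * (2 * w s - v s)) (m := 0)
        ?_ (hint.integrableOn.congr_fun heq measurableSet_Iic) ?_]
    · simp
    · intro s _
      have hexp := (((hasDerivAt_id s).sub_const ξ).const_mul 2).exp
      refine (hexp.mul (((hw s).const_mul 2).sub (hv s))).congr_deriv ?_
      simp only [id, Pi.sub_apply]
      ring
    · have hexp : Tendsto (fun s : ℝ => Real.exp (2 * (s - ξ))) atBot (nhds 0) :=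
        Real.tendsto_exp_atBot.comp
          ((tendsto_atBot_add_const_right _ (-ξ) tendsto_id).const_mul_atBot two_pos)
      simpa using hexp.mul ((hwb.const_mul 2).sub hvb)
  have hright : ∫ s in Set.Ioi ξ, Real.exp (-2 * |ξ - s|) * f s = 2 * w ξ + v ξ := by
    have heq : Set.EqOn (fun s => Real.exp (-2 * |ξ - s|) * f s)
        (fun s => Real.exp (2 * (ξ - s)) * f s) (Set.Ioi ξ) := fun s hs => by
      simp only [abs_of_neg (sub_neg.2 (Set.mem_Ioi.1 hs))]
      ring_nf
    rw [setIntegral_congr_fun measurableSet_Ioi heq,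
      integral_Ioi_of_hasDerivAt_of_tendsto'
        (f := fun s => -(Real.exp (2 * (ξ - s)) * (2 * w s + v s))) (m := 0)
        ?_ (hint.integrableOn.congr_fun heq measurableSet_Ioi) ?_]
    · simp
    · intro s _
      have hexp := (((hasDerivAt_id s).const_sub ξ).const_mul 2).exp
      refine (hexp.mul (((hw s).const_mul 2).add (hv s))).neg.congr_deriv ?_
      simp only [id, Pi.add_apply]
      ring
    · have hexp : Tendsto (fun s : ℝ => Real.exp (2 * (ξ - s))) atTop (nhds 0) :=
        Real.tendsto_exp_atBot.comp
          ((tendsto_atBot_add_const_left _ ξ tendsto_neg_atTop_atBot).const_mul_atBot two_pos)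
      simpa using (hexp.mul ((hwt.const_mul 2).add hvt)).neg
  rw [← intervalIntegral.integral_Iic_add_Ioi hint.integrableOn hint.integrableOn, hleft, hright]
  ring

/-- The derivative `φ'` of a DP solitary wave profile is in the kernel of the
linearized operator `L_c f = (c − φ)f − (3c + 2k)·K*f`, i.e. `0` is an
eigenvalue of `L_c` with eigenfunction `∂_ξ φ`. -/
theorem DP_deriv_in_kernel (c k : ℝ) (hk : 0 < k) (hck : 2 * k < c)
    (φ : ℝ → ℝ) (hφ : ContDiff ℝ 2 φ)
    (hode : ∀ ξ : ℝ, (c - φ ξ) * deriv (deriv φ) ξ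
        = (c - 2 * k) * φ ξ - 2 * (φ ξ) ^ 2 + (deriv φ ξ) ^ 2)
    (heven : ∀ ξ : ℝ, φ (-ξ) = φ ξ)
    (hbd : ∀ ξ : ℝ, 0 < φ ξ ∧ φ ξ < c)
    (hmono : StrictMonoOn φ (Set.Iic 0))
    (htop : Tendsto φ atTop (nhds 0)) (hbot : Tendsto φ atBot (nhds 0))
    (htop' : Tendsto (deriv φ) atTop (nhds 0)) (hbot' : Tendsto (deriv φ) atBot (nhds 0))
    (hint : Integrable φ) (hint' : Integrable (deriv φ)) :
    ∀ ξ : ℝ, (c - φ ξ) * deriv φ ξ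
      = ((3 * c + 2 * k) / 4) * ∫ s : ℝ, Real.exp (-2 * |ξ - s|) * deriv φ s := by
  intro ξ
  have hd (x : ℝ) : HasDerivAt φ (deriv φ x) x :=
    (hφ.differentiable (by norm_num) x).hasDerivAt
  have hd' (x : ℝ) : HasDerivAt (deriv φ) (deriv (deriv φ) x) x :=
    ((hφ.iterate_deriv' 1 1).differentiable (by norm_num) x).hasDerivAt
  have hlim {l : Filter ℝ} (h : Tendsto φ l (nhds 0)) (h' : Tendsto (deriv φ) l (nhds 0)) :
      Tendsto (fun x => (c - φ x) * deriv φ x) l (nhds 0) ∧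
        Tendsto (fun x => (c - 2 * k) * φ x - 2 * φ x ^ 2) l (nhds 0) :=
    ⟨by simpa using (h.const_sub c).mul h',
      by simpa using (h.const_mul (c - 2 * k)).sub ((h.pow 2).const_mul 2)⟩
  have hconv := four_mul_eq_integral_exp_neg_two_abs_mul
    (w := fun x => (c - φ x) * deriv φ x) (v := fun x => (c - 2 * k) * φ x - 2 * φ x ^ 2)
    (f := fun x => (3 * c + 2 * k) * deriv φ x)
    (fun x => (((hd x).const_sub c).mul (hd' x)).congr_deriv (by linear_combination hode x))
    (fun x => (((hd x).const_mul (c - 2 * k)).sub (((hd x).pow 2).const_mul 2)).congr_deriv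
      (by push_cast; ring))
    (hint'.const_mul _) (hlim htop htop').1 (hlim hbot hbot').1
    (hlim htop htop').2 (hlim hbot hbot').2 ξ
  simp only [mul_left_comm _ (3 * c + 2 * k), integral_const_mul] at hconv
  linear_combination hconv / 4
end

section
/- Let c, k be real constants with c > 2k > 0, let φ be the solitary wave profile with speed c, and let T be the bounded self-adjoint operator on L²(ℝ, ℂ) given by (T f)(ξ) = (c − φ(ξ))·f(ξ) − ((3c + 2k)/4)·∫_ℝ e^{−2|ξ−s|}·f(s) ds. Then 0 is a simple isolated eigenvalue of T: the kernel of T is the one-dimensional subspace spanned by φ' = ∂_ξ φ, and there exists ε > 0 such that the spectrum of T intersected with the open disk of radius ε about 0 equals {0}. -/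
open Filter MeasureTheory

section Abstract

variable {H : Type*} [NormedAddCommGroup H] [InnerProductSpace ℂ H] [CompleteSpace H]

/-- A bounded operator that is bounded below on the orthogonal complement of a finite-dimensional
subspace is bounded below on the orthogonal complement of its kernel. -/
theorem exists_bounded_below_on_ker_orthogonal (T : H →L[ℂ] H) (V : Submodule ℂ H)
    [FiniteDimensional ℂ V] {δ : ℝ} (hδ : 0 < δ) (hV : ∀ w ∈ Vᗮ, δ * ‖w‖ ≤ ‖T w‖) :
    ∃ ε : ℝ, 0 < ε ∧ ∀ f : H, (∀ g, T g = 0 → inner ℂ g f = 0) → ε * ‖f‖ ≤ ‖T f‖ := by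
  by_contra! hcon
  have hseq : ∀ n : ℕ, ∃ f : H, (∀ g, T g = 0 → inner ℂ g f = 0) ∧ ‖f‖ = 1 ∧
      ‖T f‖ ≤ 1 / ((n : ℝ) + 1) := by
    intro n
    obtain ⟨f, hf, hlt⟩ := hcon (1 / ((n : ℝ) + 1)) (by positivity)
    have hf0 : f ≠ 0 := by
      rintro rfl
      simp at hlt
    have hpos : 0 < ‖f‖ := norm_pos_iff.mpr hf0
    refine ⟨((‖f‖⁻¹ : ℝ) : ℂ) • f, fun g hg => by rw [inner_smul_right, hf g hg, mul_zero], ?_, ?_⟩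
    · rw [norm_smul, Complex.norm_real, norm_inv, norm_norm, inv_mul_cancel₀ hpos.ne']
    · rw [map_smul, norm_smul, Complex.norm_real, norm_inv, norm_norm, inv_mul_le_iff₀ hpos,
        mul_comm]
      exact hlt.le
  choose f hker hone hsmall using hseq
  have hTf : Tendsto (fun n => T (f n)) atTop (nhds 0) :=
    squeeze_zero_norm hsmall tendsto_one_div_add_atTop_nhds_zero_nat
  set v : ℕ → V := fun n => V.orthogonalProjectionOnto (f n) with hv
  have hvb : ∀ n, v n ∈ Metric.closedBall (0 : V) 1 := fun n => by
    rw [mem_closedBall_zero_iff, ← hone n]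
    exact V.norm_orthogonalProjectionOnto_apply_le (f n)
  have : ProperSpace V := FiniteDimensional.proper ℂ V
  obtain ⟨v₀, -, ι, hι, hlim⟩ := (isCompact_closedBall (0 : V) 1).tendsto_subseq hvb
  have hvlim : Tendsto (fun n => (v (ι n) : H)) atTop (nhds (v₀ : H)) :=
    (continuous_subtype_val.tendsto v₀).comp hlim
  set w : ℕ → H := fun n => f (ι n) - v (ι n) with hw
  have hwV : ∀ n, w n ∈ Vᗮ := fun n => V.sub_starProjection_mem_orthogonal (f (ι n))
  have hTw : Tendsto (fun n => T (w n)) atTop (nhds (0 - T v₀)) := by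
    simp only [hw, map_sub]
    exact (hTf.comp hι.tendsto_atTop).sub ((T.continuous.tendsto _).comp hvlim)
  have hwc : CauchySeq w := by
    have hTc := hTw.cauchySeq
    rw [Metric.cauchySeq_iff'] at hTc ⊢
    intro η hη
    obtain ⟨N, hN⟩ := hTc (δ * η) (by positivity)
    refine ⟨N, fun n hn => ?_⟩
    have h1 := hN n hn
    have h2 := hV _ (Vᗮ.sub_mem (hwV n) (hwV N))
    rw [map_sub] at h2
    rw [dist_eq_norm] at h1 ⊢
    exact lt_of_mul_lt_mul_left (h2.trans_lt h1) hδ.le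
  obtain ⟨w₀, hw₀⟩ := cauchySeq_tendsto_of_complete hwc
  have hf₀ : Tendsto (fun n => f (ι n)) atTop (nhds (w₀ + v₀)) := by
    refine (hw₀.add hvlim).congr fun n => ?_
    simp [hw]
  set f₀ : H := w₀ + v₀
  have hT0 : T f₀ = 0 :=
    tendsto_nhds_unique ((T.continuous.tendsto _).comp hf₀) (hTf.comp hι.tendsto_atTop)
  have hn : ‖f₀‖ = 1 := tendsto_nhds_unique hf₀.norm (by simp [hone])
  have hin : inner ℂ f₀ f₀ = 0 :=
    tendsto_nhds_unique (tendsto_const_nhds.inner hf₀)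
      (tendsto_const_nhds.congr fun n => (hker (ι n) f₀ hT0).symm)
  rw [inner_self_eq_zero] at hin
  simp [hin] at hn

/-- A self-adjoint operator with nontrivial kernel which is bounded below on the orthogonal
complement of a finite-dimensional subspace has `0` as an isolated point of its spectrum. -/
theorem exists_spectrum_inter_ball_eq_singleton (T : H →L[ℂ] H) (hT : IsSelfAdjoint T)
    (V : Submodule ℂ H) [FiniteDimensional ℂ V] {δ : ℝ} (hδ : 0 < δ)
    (hV : ∀ w ∈ Vᗮ, δ * ‖w‖ ≤ ‖T w‖) {g : H} (hg : g ≠ 0) (hTg : T g = 0) :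
    ∃ ε : ℝ, 0 < ε ∧ spectrum ℂ T ∩ Metric.ball (0 : ℂ) ε = {0} := by
  obtain ⟨ε, hε, hbelow⟩ := exists_bounded_below_on_ker_orthogonal T V hδ hV
  have hsymm : ∀ x y, inner ℂ (T x) y = inner ℂ x (T y) := fun x y => hT.isSymmetric x y
  have hzero : (0 : ℂ) ∈ spectrum ℂ T := by
    rw [spectrum.zero_mem_iff, ContinuousLinearMap.isUnit_iff_bijective]
    exact fun h => hg (h.1 (by rw [hTg, map_zero]))
  let K : Submodule ℂ H := LinearMap.ker (T : H →ₗ[ℂ] H)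
  have : CompleteSpace K := (T.isClosed_ker).completeSpace_coe
  have hlow : ∀ z : ℂ, z ≠ 0 → ‖z‖ < ε → ∃ C : ℝ, 0 < C ∧ ∀ f, C * ‖f‖ ≤ ‖z • f - T f‖ := by
    intro z hz hze
    refine ⟨min ‖z‖ (ε - ‖z‖), lt_min (norm_pos_iff.mpr hz) (by linarith), fun f => ?_⟩
    set C := min ‖z‖ (ε - ‖z‖) with hC
    have hC0 : 0 < C := lt_min (norm_pos_iff.mpr hz) (by linarith)
    obtain ⟨a, ha, b, hb, rfl⟩ := K.exists_add_mem_mem_orthogonal f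
    have hTa : T a = 0 := ha
    have hab : inner ℂ a b = 0 := hb a ha
    have hort : inner ℂ (z • a) (z • b - T b) = 0 := by
      rw [inner_sub_right, ← hsymm (z • a) b, map_smul, hTa, inner_smul_left, inner_smul_right, hab]
      simp
    have hbb : C * ‖b‖ ≤ ‖z • b - T b‖ := by
      have h1 := hbelow b (fun g' hg' => hb g' hg')
      have h2 : ‖T b‖ - ‖z • b‖ ≤ ‖z • b - T b‖ := by
        rw [norm_sub_rev]; exact norm_sub_norm_le _ _
      rw [norm_smul] at h2
      have h3 : C * ‖b‖ ≤ (ε - ‖z‖) * ‖b‖ :=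
        mul_le_mul_of_nonneg_right (min_le_right _ _) (norm_nonneg _)
      linarith
    have haa : C * ‖a‖ ≤ ‖z • a‖ := by
      rw [norm_smul]
      exact mul_le_mul_of_nonneg_right (min_le_left _ _) (norm_nonneg _)
    have hsum : z • (a + b) - T (a + b) = z • a + (z • b - T b) := by
      rw [map_add, hTa, smul_add]; abel
    rw [hsum]
    have e1 := norm_add_sq_eq_norm_sq_add_norm_sq_of_inner_eq_zero _ _ hort
    have e2 := norm_add_sq_eq_norm_sq_add_norm_sq_of_inner_eq_zero _ _ hab
    refine le_of_sq_le_sq ?_ (norm_nonneg _)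
    have p1 := mul_self_le_mul_self (by positivity) haa
    have p2 := mul_self_le_mul_self (by positivity) hbb
    rw [mul_pow, sq ‖a + b‖, e2, sq ‖_ + _‖, e1]
    linarith
  have hunit : ∀ z : ℂ, z ≠ 0 → ‖z‖ < ε → z ∉ spectrum ℂ T := by
    intro z hz hze
    rw [spectrum.notMem_iff, ContinuousLinearMap.isUnit_iff_bijective,
      ContinuousLinearMap.bijective_iff_dense_range_and_antilipschitz]
    have happ : ∀ f, (algebraMap ℂ (H →L[ℂ] H) z - T) f = z • f - T f := fun f => by
      simp [Algebra.algebraMap_eq_smul_one]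
    constructor
    · rw [Submodule.topologicalClosure_eq_top_iff, Submodule.eq_bot_iff]
      intro y hy
      obtain ⟨C, hC, hCb⟩ := hlow (starRingEnd ℂ z) (by simpa using hz) (by simpa using hze)
      have hy0 : (starRingEnd ℂ z) • y - T y = 0 := by
        refine ext_inner_left ℂ fun x => ?_
        have h := hy (z • x - T x) ⟨x, happ x⟩
        rw [inner_sub_left, inner_smul_left] at h
        rw [inner_sub_right, inner_smul_right, ← hsymm, h, inner_zero_right]
      have h := hCb y
      rw [hy0, norm_zero] at h
      exact norm_eq_zero.mp (le_antisymm (nonpos_of_mul_nonpos_right h hC) (norm_nonneg _))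
    · obtain ⟨C, hC, hCb⟩ := hlow z hz hze
      refine ⟨⟨C⁻¹, by positivity⟩, ContinuousLinearMap.antilipschitz_of_bound _ fun f => ?_⟩
      rw [happ]
      change ‖f‖ ≤ C⁻¹ * _
      rw [le_inv_mul_iff₀ hC]
      exact hCb f
  refine ⟨ε, hε, Set.eq_singleton_iff_unique_mem.mpr ⟨⟨hzero, by simpa using hε⟩, ?_⟩⟩
  rintro z ⟨hzs, hzb⟩
  by_contra hz
  exact hunit z hz (by simpa using hzb) hzs

end Abstract

section ExponentialKernel

theorem integral_exp_neg_two_mul_abs : ∫ x : ℝ, Real.exp (-2 * |x|) = 1 := by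
  rw [integral_comp_abs (f := fun x => Real.exp (-2 * x)),
    integral_exp_mul_Ioi (by norm_num : (-2 : ℝ) < 0)]
  norm_num

theorem integrable_exp_neg_two_mul_abs : Integrable fun x : ℝ => Real.exp (-2 * |x|) :=
  Integrable.of_integral_ne_zero (by rw [integral_exp_neg_two_mul_abs]; exact one_ne_zero)

theorem integrable_exp_neg_two_mul_abs_sub (x : ℝ) :
    Integrable fun s : ℝ => Real.exp (-2 * |x - s|) :=
  integrable_exp_neg_two_mul_abs.comp_sub_left x

theorem lintegral_exp_neg_two_mul_abs_sub (x : ℝ) :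
    ∫⁻ s : ℝ, ENNReal.ofReal (Real.exp (-2 * |x - s|)) = 1 := by
  rw [← ofReal_integral_eq_lintegral_ofReal (integrable_exp_neg_two_mul_abs_sub x)
    (ae_of_all _ fun _ => (Real.exp_pos _).le),
    integral_sub_left_eq_self (fun s => Real.exp (-2 * |s|)) volume x,
    integral_exp_neg_two_mul_abs, ENNReal.ofReal_one]

theorem lintegral_exp_kernel_mul_sq_le {F : ℝ → ENNReal} (hF : Measurable F) (x : ℝ) :
    (∫⁻ s, ENNReal.ofReal (Real.exp (-2 * |x - s|)) * F s) ^ 2 ≤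
      ∫⁻ s, ENNReal.ofReal (Real.exp (-2 * |x - s|)) * F s ^ 2 := by
  set e : ℝ → ENNReal := fun s => ENNReal.ofReal (Real.exp (-|x - s|)) with he
  have hem : Measurable e := by fun_prop
  have hee : ∀ s, ENNReal.ofReal (Real.exp (-2 * |x - s|)) = e s ^ 2 := fun s => by
    rw [he, ← ENNReal.ofReal_pow (Real.exp_pos _).le, ← Real.exp_nat_mul]
    congr 2
    push_cast
    ring
  have h := ENNReal.lintegral_mul_le_Lp_mul_Lq volume Real.HolderConjugate.two_two
    hem.aemeasurable (hem.mul hF).aemeasurable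
  have h1 : ∫⁻ s, e s ^ (2 : ℝ) = 1 := by
    rw [← lintegral_exp_neg_two_mul_abs_sub x]
    simp only [hee, ENNReal.rpow_two]
  rw [h1, ENNReal.one_rpow, one_mul] at h
  simp only [hee]
  calc (∫⁻ s, e s ^ 2 * F s) ^ 2 = (∫⁻ s, (e * (e * F)) s) ^ 2 := by
        congr 2; ext s; simp only [Pi.mul_apply]; ring
    _ ≤ ((∫⁻ s, (e * F) s ^ (2 : ℝ)) ^ (1 / 2 : ℝ)) ^ 2 := by gcongr
    _ = ∫⁻ s, (e * F) s ^ (2 : ℝ) := by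
        rw [← ENNReal.rpow_two, ← ENNReal.rpow_mul]; norm_num
    _ = ∫⁻ s, e s ^ 2 * F s ^ 2 := by
        simp only [Pi.mul_apply, ENNReal.rpow_two, mul_pow]

/-- Schur's test for the kernel `exp (-2 |x - s|)`, which has mass one. -/
theorem lintegral_lintegral_exp_kernel_mul_sq_le {F : ℝ → ENNReal} (hF : Measurable F) :
    ∫⁻ x, (∫⁻ s, ENNReal.ofReal (Real.exp (-2 * |x - s|)) * F s) ^ 2 ≤ ∫⁻ s, F s ^ 2 := by
  calc ∫⁻ x, (∫⁻ s, ENNReal.ofReal (Real.exp (-2 * |x - s|)) * F s) ^ 2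
      ≤ ∫⁻ x, ∫⁻ s, ENNReal.ofReal (Real.exp (-2 * |x - s|)) * F s ^ 2 :=
        lintegral_mono fun x => lintegral_exp_kernel_mul_sq_le hF x
    _ = ∫⁻ s, ∫⁻ x, ENNReal.ofReal (Real.exp (-2 * |x - s|)) * F s ^ 2 :=
        lintegral_lintegral_swap (by fun_prop)
    _ = ∫⁻ s, F s ^ 2 := by
        refine lintegral_congr fun s => ?_
        rw [lintegral_mul_const _ (by fun_prop)]
        simp only [abs_sub_comm _ s]
        rw [lintegral_exp_neg_two_mul_abs_sub, one_mul]

theorem eLpNorm_integral_exp_kernel_le {p : ℝ → ℝ} (hp : Measurable p) :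
    eLpNorm (fun x => ∫ s, Real.exp (-2 * |x - s|) * p s) 2 ≤ eLpNorm p 2 := by
  rw [eLpNorm_eq_lintegral_rpow_enorm_toReal two_ne_zero ENNReal.ofNat_ne_top,
    eLpNorm_eq_lintegral_rpow_enorm_toReal two_ne_zero ENNReal.ofNat_ne_top]
  simp only [ENNReal.toReal_ofNat, ENNReal.rpow_two]
  refine ENNReal.rpow_le_rpow ?_ (by norm_num)
  refine le_trans (lintegral_mono fun x => ?_)
    (lintegral_lintegral_exp_kernel_mul_sq_le hp.enorm)
  refine pow_le_pow_left₀ zero_le ((enorm_integral_le_lintegral_enorm _).trans_eq ?_) 2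
  refine lintegral_congr fun s => ?_
  rw [enorm_mul, Real.enorm_of_nonneg (Real.exp_pos _).le]

variable {f : ℝ → ℂ}

theorem norm_exp_kernel_mul_le (x s : ℝ) :
    ‖((Real.exp (-2 * |x - s|) : ℝ) : ℂ) * f s‖ ≤ Real.exp (-2 * |x - s|) + ‖f s‖ ^ 2 := by
  rw [norm_mul, Complex.norm_real, Real.norm_of_nonneg (Real.exp_pos _).le]
  have h1 : Real.exp (-2 * |x - s|) ≤ 1 := Real.exp_le_one_iff.mpr (by simp)
  have h2 := Real.exp_pos (-2 * |x - s|)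
  nlinarith [sq_nonneg (Real.exp (-2 * |x - s|) - ‖f s‖), norm_nonneg (f s)]

theorem integrable_exp_kernel_mul (hf : MemLp f 2) (x : ℝ) :
    Integrable fun s => ((Real.exp (-2 * |x - s|) : ℝ) : ℂ) * f s :=
  ((integrable_exp_neg_two_mul_abs_sub x).add hf.norm.integrable_sq).mono'
    ((by fun_prop : Continuous fun s => ((Real.exp (-2 * |x - s|) : ℝ) : ℂ)).aestronglyMeasurable.mul
      hf.1)
    (ae_of_all _ fun s => norm_exp_kernel_mul_le x s)

theorem abs_exp_kernel_sub_le {h x s a : ℝ} (hs : |s - a| ≤ h) :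
    |Real.exp (-2 * |x - s|) - Real.exp (-2 * |x - a|)| ≤
      (Real.exp (2 * h) - 1) * Real.exp (-2 * |x - s|) := by
  have hA : |x - s| - |x - a| ≤ h := by
    refine (abs_sub_abs_le_abs_sub _ _).trans ?_
    rwa [show x - s - (x - a) = -(s - a) by ring, abs_neg]
  have hB : |x - a| - |x - s| ≤ h := by
    refine (abs_sub_abs_le_abs_sub _ _).trans ?_
    rwa [show x - a - (x - s) = s - a by ring]
  have he : Real.exp (-2 * |x - a|) =
      Real.exp (-2 * |x - s|) * Real.exp (2 * (|x - s| - |x - a|)) := by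
    rw [← Real.exp_add]; ring_nf
  have hpos := Real.exp_pos (-2 * |x - s|)
  have h1 : Real.exp (2 * (|x - s| - |x - a|)) ≤ Real.exp (2 * h) :=
    Real.exp_le_exp.mpr (by linarith)
  have h2 : Real.exp (-(2 * h)) ≤ Real.exp (2 * (|x - s| - |x - a|)) :=
    Real.exp_le_exp.mpr (by linarith)
  have h3 : 2 ≤ Real.exp (2 * h) + Real.exp (-(2 * h)) := by
    have := Real.one_le_cosh (2 * h)
    rw [Real.cosh_eq] at this
    linarith
  rw [he, abs_le]
  constructor <;> nlinarith

theorem norm_setIntegral_exp_kernel_mul_le (hf : MemLp f 2) {a b h : ℝ} (hab : b - a ≤ h)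
    (hmean : ∫ s in Set.Ico a b, f s = 0) (x : ℝ) :
    ‖∫ s in Set.Ico a b, ((Real.exp (-2 * |x - s|) : ℝ) : ℂ) * f s‖ ≤
      ∫ s in Set.Ico a b, (Real.exp (2 * h) - 1) * (Real.exp (-2 * |x - s|) * ‖f s‖) := by
  have hint := integrable_exp_kernel_mul hf x
  have hfi : IntegrableOn f (Set.Ico a b) :=
    (hf.restrict _).integrable one_le_two
  have hsub : ∫ s in Set.Ico a b, ((Real.exp (-2 * |x - s|) : ℝ) : ℂ) * f s =
      ∫ s in Set.Ico a b, (((Real.exp (-2 * |x - s|) : ℝ) : ℂ) * f s -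
        ((Real.exp (-2 * |x - a|) : ℝ) : ℂ) * f s) := by
    rw [integral_sub hint.integrableOn (hfi.const_mul _), integral_const_mul, hmean, mul_zero,
      sub_zero]
  have hnorm : Integrable fun s => Real.exp (-2 * |x - s|) * ‖f s‖ := by
    refine hint.norm.congr (ae_of_all _ fun s => ?_)
    simp only [norm_mul, Complex.norm_real, Real.norm_of_nonneg (Real.exp_pos _).le]
  rw [hsub]
  refine norm_integral_le_of_norm_le (hnorm.integrableOn.const_mul _) ?_
  filter_upwards [ae_restrict_mem measurableSet_Ico] with s hs
  rw [← sub_mul, ← Complex.ofReal_sub, norm_mul, Complex.norm_real, ← mul_assoc]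
  refine mul_le_mul_of_nonneg_right (abs_exp_kernel_sub_le ?_) (norm_nonneg _)
  rw [abs_le]
  constructor <;> linarith [hs.1, hs.2]

/-- If the convolution weight `ρ` is dominated by `μ` away from a compact set, and `f` has mean
zero on the cells of a fine partition of this compact set, then the convolution of `f` with
`ρ exp (-2 |x|)` is dominated by that of `μ ‖f‖` with `exp (-2 |x|)`. -/
theorem norm_integral_exp_kernel_mul_le (hf : MemLp f 2) {μ : ℝ → ℝ} {ρ R h M : ℝ} {n : ℕ}
    (hμc : Continuous μ) (hμM : ∀ s, |μ s| ≤ M) (hρ : 0 ≤ ρ) (hh : 0 < h) (hn : 2 * R ≤ n * h)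
    (hin : ∀ s, ρ * (Real.exp (2 * h) - 1) ≤ μ s) (hout : ∀ s, R ≤ |s| → ρ ≤ μ s)
    (hmean : ∀ j ∈ Finset.range n,
      ∫ s in Set.Ico (-R + (j : ℝ) * h) (-R + ((j + 1 : ℕ) : ℝ) * h), f s = 0) (x : ℝ) :
    ρ * ‖∫ s, ((Real.exp (-2 * |x - s|) : ℝ) : ℂ) * f s‖ ≤
      ∫ s, Real.exp (-2 * |x - s|) * (μ s * ‖f s‖) := by
  have hint := integrable_exp_kernel_mul hf x
  have hnorm : Integrable fun s => Real.exp (-2 * |x - s|) * ‖f s‖ := by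
    refine hint.norm.congr (ae_of_all _ fun s => ?_)
    simp only [norm_mul, Complex.norm_real, Real.norm_of_nonneg (Real.exp_pos _).le]
  have hmaj : Integrable fun s => Real.exp (-2 * |x - s|) * (μ s * ‖f s‖) := by
    refine (hnorm.bdd_mul (c := M) hμc.aestronglyMeasurable (ae_of_all _ hμM)).congr
      (ae_of_all _ fun s => ?_)
    simp only
    ring
  set S : ℕ → Set ℝ := fun j => Set.Ico (-R + (j : ℝ) * h) (-R + ((j + 1 : ℕ) : ℝ) * h) with hS
  have hSm : ∀ j ∈ Finset.range n, MeasurableSet (S j) := fun j _ => measurableSet_Ico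
  have hSd : (↑(Finset.range n) : Set ℕ).Pairwise (Function.onFun Disjoint S) := by
    have hmono : Monotone fun j : ℕ => -R + (j : ℝ) * h := fun i j hij => by
      have : (i : ℝ) ≤ j := by exact_mod_cast hij
      simp only
      gcongr
    exact (hmono.pairwise_disjoint_on_Ico_succ).set_pairwise _
  set U : Set ℝ := ⋃ j ∈ Finset.range n, S j with hU
  have hUm : MeasurableSet U := Finset.measurableSet_biUnion _ hSm
  have hUc : ∀ s ∈ Uᶜ, R ≤ |s| := by
    intro s hs
    by_contra! hlt
    refine hs (Set.mem_iUnion₂.mpr ⟨⌊(s + R) / h⌋₊, ?_, ?_⟩)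
    · have h1 := abs_lt.mp hlt
      rw [Finset.mem_range, Nat.floor_lt (div_nonneg (by linarith) hh.le), div_lt_iff₀ hh]
      linarith
    · have h1 := abs_lt.mp hlt
      have h2 := Nat.floor_le (div_nonneg (by linarith : 0 ≤ s + R) hh.le)
      have h3 := Nat.lt_floor_add_one ((s + R) / h)
      rw [le_div_iff₀ hh] at h2
      rw [div_lt_iff₀ hh] at h3
      constructor
      · linarith
      · push_cast; linarith
  have hUpart : ρ * ‖∫ s in U, ((Real.exp (-2 * |x - s|) : ℝ) : ℂ) * f s‖ ≤
      ∫ s in U, Real.exp (-2 * |x - s|) * (μ s * ‖f s‖) := by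
    rw [hU, integral_biUnion_finset _ hSm hSd fun _ _ => hint.integrableOn,
      integral_biUnion_finset _ hSm hSd fun _ _ => hmaj.integrableOn]
    refine (mul_le_mul_of_nonneg_left (norm_sum_le _ _) hρ).trans ?_
    rw [Finset.mul_sum]
    refine Finset.sum_le_sum fun j hj => ?_
    refine (mul_le_mul_of_nonneg_left (norm_setIntegral_exp_kernel_mul_le hf (h := h)
      (by push_cast; linarith) (hmean j hj) x) hρ).trans ?_
    rw [← integral_const_mul]
    refine setIntegral_mono ((hnorm.integrableOn.const_mul _).const_mul _) hmaj.integrableOn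
      fun s => ?_
    have h1 := mul_le_mul_of_nonneg_right (hin s)
      (mul_nonneg (Real.exp_pos (-2 * |x - s|)).le (norm_nonneg (f s)))
    simp only
    linarith
  have hUcpart : ρ * ‖∫ s in Uᶜ, ((Real.exp (-2 * |x - s|) : ℝ) : ℂ) * f s‖ ≤
      ∫ s in Uᶜ, Real.exp (-2 * |x - s|) * (μ s * ‖f s‖) := by
    refine (mul_le_mul_of_nonneg_left (norm_integral_le_integral_norm _) hρ).trans ?_
    rw [← integral_const_mul]
    refine setIntegral_mono_on (hint.norm.integrableOn.const_mul _) hmaj.integrableOn hUm.compl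
      fun s hs => ?_
    rw [norm_mul, Complex.norm_real, Real.norm_of_nonneg (Real.exp_pos _).le]
    have h1 := mul_le_mul_of_nonneg_right (hout s (hUc s hs))
      (mul_nonneg (Real.exp_pos (-2 * |x - s|)).le (norm_nonneg (f s)))
    linarith
  rw [← integral_add_compl hUm hint, ← integral_add_compl hUm hmaj]
  refine (mul_le_mul_of_nonneg_left (norm_add_le _ _) hρ).trans ?_
  linarith

end ExponentialKernel

section MultiplicationMinusConvolution

theorem mul_norm_le_norm_of_ae_eq_sub_convolution {a : ℝ → ℝ} {m M ρ q R h : ℝ} {n : ℕ}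
    (ha : Continuous a) (hm : 0 < m) (hma : ∀ x, m ≤ a x) (haM : ∀ x, a x ≤ M) (hρ : 0 ≤ ρ)
    (hq0 : 0 < q) (hq1 : q < 1) (hh : 0 < h) (hn : 2 * R ≤ n * h)
    (hin : ρ * (Real.exp (2 * h) - 1) ≤ q * m) (hout : ∀ s, R ≤ |s| → ρ ≤ q * a s)
    {w v : Lp ℂ 2 (volume : Measure ℝ)}
    (hmean : ∀ j ∈ Finset.range n,
      ∫ s in Set.Ico (-R + (j : ℝ) * h) (-R + ((j + 1 : ℕ) : ℝ) * h), w s = 0)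
    (hv : ∀ᵐ x : ℝ, v x = (a x : ℂ) * w x
      - (ρ : ℂ) * ∫ s : ℝ, ((Real.exp (-2 * |x - s|) : ℝ) : ℂ) * w s) :
    (1 - q) * m * ‖w‖ ≤ ‖v‖ := by
  have hwm := (Lp.stronglyMeasurable w).measurable
  set p : ℝ → ℝ := fun s => a s * ‖w s‖ with hp
  have hpm : Measurable p := ha.measurable.mul hwm.norm
  have hpL : MemLp p 2 := by
    refine (Lp.memLp w).norm.of_le_mul (c := M) hpm.aestronglyMeasurable (ae_of_all _ fun s => ?_)
    rw [hp, norm_mul, Real.norm_of_nonneg (hm.le.trans (hma s))]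
    exact mul_le_mul_of_nonneg_right (haM s) (norm_nonneg _)
  set G : ℝ → ℝ := fun x => ∫ s, Real.exp (-2 * |x - s|) * (q * p s) with hG
  have hGm : StronglyMeasurable G := by
    refine StronglyMeasurable.integral_prod_right (ν := volume)
      (f := fun x s => Real.exp (-2 * |x - s|) * (q * p s)) ?_
    refine Measurable.stronglyMeasurable ?_
    unfold Function.uncurry
    fun_prop
  have hGle : eLpNorm G 2 ≤ ENNReal.ofReal q * eLpNorm p 2 := by
    refine (eLpNorm_integral_exp_kernel_le (hpm.const_mul q)).trans_eq ?_
    rw [← Real.enorm_of_nonneg hq0.le]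
    exact eLpNorm_const_smul q p 2 volume
  have hpw : ∀ᵐ x, ‖p x‖ ≤ ‖‖v x‖ + G x‖ := by
    filter_upwards [hv] with x hx
    have hconv := norm_integral_exp_kernel_mul_le (Lp.memLp w) (μ := fun s => q * a s)
      (M := q * M) (ρ := ρ) (R := R) (h := h) (n := n) (by fun_prop)
      (fun s => by
        rw [abs_of_nonneg (mul_nonneg hq0.le (hm.le.trans (hma s)))]
        exact mul_le_mul_of_nonneg_left (haM s) hq0.le)
      hρ hh hn (fun s => hin.trans (mul_le_mul_of_nonneg_left (hma s) hq0.le)) hout hmean x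
    simp only [mul_assoc q] at hconv
    have hsum : (a x : ℂ) * w x = v x +
        (ρ : ℂ) * ∫ s : ℝ, ((Real.exp (-2 * |x - s|) : ℝ) : ℂ) * w s := by
      rw [hx]; ring
    have hnorm := congrArg norm hsum
    rw [norm_mul, Complex.norm_real, Real.norm_of_nonneg (hm.le.trans (hma x))] at hnorm
    have htri := norm_add_le (v x)
      ((ρ : ℂ) * ∫ s : ℝ, ((Real.exp (-2 * |x - s|) : ℝ) : ℂ) * w s)
    rw [norm_mul (ρ : ℂ), Complex.norm_real, Real.norm_of_nonneg hρ] at htri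
    rw [Real.norm_of_nonneg (mul_nonneg (hm.le.trans (hma x)) (norm_nonneg _))]
    refine le_trans ?_ (le_abs_self _)
    have hG' : ρ * ‖∫ s : ℝ, ((Real.exp (-2 * |x - s|) : ℝ) : ℂ) * w s‖ ≤ G x := hconv
    linarith
  have hadd : eLpNorm ((fun x => ‖v x‖) + G) 2 ≤ eLpNorm (fun x => ‖v x‖) 2 + eLpNorm G 2 :=
    eLpNorm_add_le (Lp.stronglyMeasurable v).norm.aestronglyMeasurable hGm.aestronglyMeasurable
      one_le_two
  rw [eLpNorm_norm] at hadd
  have hmain : eLpNorm p 2 ≤ eLpNorm v 2 + ENNReal.ofReal q * eLpNorm p 2 :=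
    ((eLpNorm_mono_ae hpw).trans hadd).trans (add_le_add_right hGle _)
  have hlow : ENNReal.ofReal m * eLpNorm w 2 ≤ eLpNorm p 2 := by
    rw [← Real.enorm_of_nonneg hm.le, ← eLpNorm_const_smul, ← eLpNorm_norm]
    refine eLpNorm_mono fun x => ?_
    simp only [Pi.smul_apply, norm_norm, norm_smul, hp, norm_mul]
    rw [Real.norm_of_nonneg hm.le, Real.norm_of_nonneg (hm.le.trans (hma x))]
    exact mul_le_mul_of_nonneg_right (hma x) (norm_nonneg _)
  have hfin := hpL.eLpNorm_ne_top
  have hvfin := (Lp.memLp v).eLpNorm_ne_top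
  have h1 := ENNReal.toReal_mono (by finiteness) hmain
  have h2 := ENNReal.toReal_mono hfin hlow
  rw [ENNReal.toReal_add hvfin (by finiteness), ENNReal.toReal_mul,
    ENNReal.toReal_ofReal hq0.le, ← Lp.norm_def] at h1
  rw [ENNReal.toReal_mul, ENNReal.toReal_ofReal hm.le, ← Lp.norm_def] at h2
  have h3 := mul_le_mul_of_nonneg_left h2 (by linarith : 0 ≤ 1 - q)
  linarith

/-- The operator `f ↦ a f - ρ exp (-2 |·|) ∗ f` is bounded below on a subspace of finite codimension
if `a` is bounded below by a positive constant and has limits larger than `ρ` at infinity. -/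
theorem exists_finiteDimensional_bounded_below_on_orthogonal {a : ℝ → ℝ} {c m M ρ : ℝ}
    (ha : Continuous a) (hm : 0 < m) (hma : ∀ x, m ≤ a x) (haM : ∀ x, a x ≤ M) (hρ : 0 ≤ ρ)
    (hρc : ρ < c) (htop : Tendsto a atTop (nhds c)) (hbot : Tendsto a atBot (nhds c))
    (T : Lp ℂ 2 (volume : Measure ℝ) →L[ℂ] Lp ℂ 2 (volume : Measure ℝ))
    (hT : ∀ f : Lp ℂ 2 (volume : Measure ℝ), ∀ᵐ x : ℝ, (T f : ℝ → ℂ) x = (a x : ℂ) * f x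
      - (ρ : ℂ) * ∫ s : ℝ, ((Real.exp (-2 * |x - s|) : ℝ) : ℂ) * f s) :
    ∃ V : Submodule ℂ (Lp ℂ 2 (volume : Measure ℝ)), FiniteDimensional ℂ V ∧
      ∃ δ : ℝ, 0 < δ ∧ ∀ w ∈ Vᗮ, δ * ‖w‖ ≤ ‖T w‖ := by
  have hc : 0 < c := hρ.trans_lt hρc
  obtain ⟨q, hq0, hq1, hqc⟩ : ∃ q : ℝ, 0 < q ∧ q < 1 ∧ ρ / q < c := by
    refine ⟨(c + ρ) / (2 * c), by positivity, ?_, ?_⟩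
    · rw [div_lt_one (by positivity)]; linarith
    · rw [div_div_eq_mul_div, div_lt_iff₀ (by positivity)]; nlinarith
  obtain ⟨R, hR⟩ : ∃ R : ℝ, ∀ s, R ≤ |s| → ρ ≤ q * a s := by
    obtain ⟨R₁, hR₁⟩ := eventually_atTop.mp (htop.eventually_const_lt hqc)
    obtain ⟨R₂, hR₂⟩ := eventually_atBot.mp (hbot.eventually_const_lt hqc)
    refine ⟨max R₁ (-R₂), fun s hs => ?_⟩
    have h : ρ / q < a s := by
      rcases le_abs.mp hs with h | h
      · exact hR₁ s ((le_max_left _ _).trans h)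
      · exact hR₂ s (by linarith [le_max_right R₁ (-R₂)])
    rw [div_lt_iff₀ hq0] at h
    linarith
  obtain ⟨h, hh, hhm⟩ : ∃ h : ℝ, 0 < h ∧ ρ * (Real.exp (2 * h) - 1) ≤ q * m := by
    have hlim : Tendsto (fun h : ℝ => ρ * (Real.exp (2 * h) - 1)) (nhdsWithin 0 (Set.Ioi 0))
        (nhds 0) := by
      have : Continuous fun h : ℝ => ρ * (Real.exp (2 * h) - 1) := by fun_prop
      exact (this.tendsto' 0 0 (by simp)).mono_left nhdsWithin_le_nhds
    obtain ⟨h, h1, h2⟩ := ((hlim.eventually_lt_const (mul_pos hq0 hm)).and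
      self_mem_nhdsWithin).exists
    exact ⟨h, h2, h1.le⟩
  obtain ⟨n, hn⟩ := exists_nat_ge (2 * R / h)
  rw [div_le_iff₀ hh] at hn
  let e : ℕ → Lp ℂ 2 (volume : Measure ℝ) := fun j =>
    indicatorConstLp 2 (s := Set.Ico (-R + (j : ℝ) * h) (-R + ((j + 1 : ℕ) : ℝ) * h))
      measurableSet_Ico measure_Ico_lt_top.ne (1 : ℂ)
  refine ⟨Submodule.span ℂ (e '' (Finset.range n : Set ℕ)),
    FiniteDimensional.span_of_finite ℂ ((Finset.range n).finite_toSet.image e),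
    (1 - q) * m, mul_pos (by linarith) hm, fun w hw => ?_⟩
  refine mul_norm_le_norm_of_ae_eq_sub_convolution ha hm hma haM hρ hq0 hq1 hh hn hhm hR
    (fun j hj => ?_) (hT w)
  have hej := hw (e j) (Submodule.subset_span ⟨j, hj, rfl⟩)
  rwa [L2.inner_indicatorConstLp_one] at hej

end MultiplicationMinusConvolution

section Ode

theorem eq_zero_of_second_order_linear_ode {Q y y' : ℝ → ℂ} {L : ℝ} (hL : ∀ t, ‖Q t‖ ≤ L)
    (hy : ∀ t, HasDerivAt y (y' t) t) (hy' : ∀ t, HasDerivAt y' (Q t * y t) t) {t₀ : ℝ}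
    (h₀ : y t₀ = 0) (h₀' : y' t₀ = 0) (t : ℝ) : y t = 0 := by
  have hL0 : 0 ≤ L := (norm_nonneg _).trans (hL 0)
  have hlip : ∀ t, LipschitzOnWith (max 1 L.toNNReal)
      (fun p : ℂ × ℂ => ((p.2, Q t * p.1) : ℂ × ℂ)) Set.univ := by
    intro t
    refine (LipschitzWith.of_dist_le_mul fun p r => ?_).lipschitzOnWith
    have h1 : dist p.2 r.2 ≤ dist p r := le_max_right _ _
    have h2 : dist p.1 r.1 ≤ dist p r := le_max_left _ _
    have hK1 : (1 : ℝ) ≤ (max 1 L.toNNReal : NNReal) := by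
      exact_mod_cast le_max_left (1 : NNReal) L.toNNReal
    have hK2 : L ≤ (max 1 L.toNNReal : NNReal) :=
      (Real.le_coe_toNNReal L).trans (by exact_mod_cast le_max_right (1 : NNReal) L.toNNReal)
    refine max_le ?_ ?_
    · exact h1.trans (le_mul_of_one_le_left dist_nonneg hK1)
    · simp only [dist_eq_norm] at h2 ⊢
      rw [← mul_sub, norm_mul]
      exact mul_le_mul ((hL t).trans hK2) h2 (norm_nonneg _) (hL0.trans hK2)
  have heq := ODE_solution_unique_univ (v := fun t (p : ℂ × ℂ) => (p.2, Q t * p.1))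
    (s := fun _ => Set.univ) (f := fun t => (y t, y' t)) (g := fun _ => 0) (t₀ := t₀) hlip
    (fun t => ⟨(hy t).prodMk (hy' t), trivial⟩)
    (fun t => ⟨(hasDerivAt_const t (0 : ℂ × ℂ)).congr_deriv (by simp [Prod.ext_iff]), trivial⟩)
    (by simp [h₀, h₀'])
  exact congrArg Prod.fst (congrFun heq t)

/-- Two solutions of `y'' = Q y` whose Wronskian vanishes at `-∞` are proportional. -/
theorem exists_eq_mul_of_tendsto_wronskian {Q y y' z z' : ℝ → ℂ} {L : ℝ} (hL : ∀ t, ‖Q t‖ ≤ L)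
    (hy : ∀ t, HasDerivAt y (y' t) t) (hy' : ∀ t, HasDerivAt y' (Q t * y t) t)
    (hz : ∀ t, HasDerivAt z (z' t) t) (hz' : ∀ t, HasDerivAt z' (Q t * z t) t)
    (hW : Tendsto (fun t => y t * z' t - y' t * z t) atBot (nhds 0)) {t₀ : ℝ} (h₀ : y t₀ ≠ 0) :
    ∃ a : ℂ, ∀ t, z t = a * y t := by
  have hWd : ∀ t, HasDerivAt (fun t => y t * z' t - y' t * z t) 0 t := fun t => by
    refine (((hy t).mul (hz' t)).sub ((hy' t).mul (hz t))).congr_deriv ?_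
    ring
  have hWc : ∀ t, y t * z' t - y' t * z t = y t₀ * z' t₀ - y' t₀ * z t₀ := fun t =>
    is_const_of_deriv_eq_zero (fun t => (hWd t).differentiableAt) (fun t => (hWd t).deriv) t t₀
  have hW0 : y t₀ * z' t₀ - y' t₀ * z t₀ = 0 :=
    tendsto_nhds_unique (tendsto_const_nhds.congr fun t => (hWc t).symm) hW
  refine ⟨z t₀ / y t₀, fun t => ?_⟩
  have key := eq_zero_of_second_order_linear_ode (y := fun t => z t - z t₀ / y t₀ * y t)
    (y' := fun t => z' t - z t₀ / y t₀ * y' t) (t₀ := t₀) hL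
    (fun t => (hz t).sub ((hy t).const_mul _))
    (fun t => ((hz' t).sub ((hy' t).const_mul _)).congr_deriv (by ring))
    (by field_simp; ring) (by field_simp; linear_combination hW0) t
  exact sub_eq_zero.mp key

end Ode

section Green

theorem hasDerivAt_exp_mul_sub (r x s : ℝ) :
    HasDerivAt (fun s => Real.exp (r * (s - x))) (r * Real.exp (r * (s - x))) s := by
  have h := (((hasDerivAt_id s).sub_const x).const_mul r).exp
  simpa [mul_comm] using h

/-- Convolution with `exp (-2 |x|)` inverts `(4 - ∂²) / 4` on functions with bounded derivatives. -/
theorem integral_exp_kernel_mul_four_mul_sub {P P' P'' : ℝ → ℝ} {C D : ℝ}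
    (hP : ∀ s, HasDerivAt P (P' s) s) (hP' : ∀ s, HasDerivAt P' (P'' s) s)
    (hPC : ∀ s, |P s| ≤ C) (hPC' : ∀ s, |P' s| ≤ C) (hc : Continuous P'')
    (hD : ∀ s, |P'' s| ≤ D) (x : ℝ) :
    ∫ s, Real.exp (-2 * |x - s|) * (4 * P s - P'' s) = 4 * P x := by
  have hPc : Continuous P := continuous_iff_continuousAt.mpr fun s => (hP s).continuousAt
  have hint : Integrable fun s => Real.exp (-2 * |x - s|) * (4 * P s - P'' s) := by
    refine ((integrable_exp_neg_two_mul_abs_sub x).bdd_mul (c := 4 * C + D)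
      (f := fun s => 4 * P s - P'' s) (by fun_prop) (ae_of_all _ fun s => ?_)).congr
      (ae_of_all _ fun s => mul_comm _ _)
    have h1 := abs_le.mp (hPC s)
    have h2 := abs_le.mp (hD s)
    rw [Real.norm_eq_abs, abs_le]
    constructor <;> linarith
  have hleq : ∀ s ∈ Set.Iic x, Real.exp (-2 * |x - s|) = Real.exp (2 * (s - x)) := fun s hs => by
    rw [abs_of_nonneg (sub_nonneg.mpr hs)]; ring_nf
  have hreq : ∀ s ∈ Set.Ioi x, Real.exp (-2 * |x - s|) = Real.exp (-2 * (s - x)) := fun s hs => by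
    rw [abs_of_neg (sub_neg.mpr hs)]; ring_nf
  have hleft : ∫ s in Set.Iic x, Real.exp (-2 * |x - s|) * (4 * P s - P'' s) =
      2 * P x - P' x := by
    have hcongr : Set.EqOn (fun s => Real.exp (-2 * |x - s|) * (4 * P s - P'' s))
        (fun s => Real.exp (2 * (s - x)) * (4 * P s - P'' s)) (Set.Iic x) := fun s hs => by
      simp only [hleq s hs]
    have hlim : Tendsto (fun s => Real.exp (2 * (s - x)) * (2 * P s - P' s)) atBot (nhds 0) := by
      have h0 : Tendsto (fun s : ℝ => Real.exp (2 * (s - x))) atBot (nhds 0) :=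
        Real.tendsto_exp_atBot.comp
          ((tendsto_atBot_add_const_right _ (-x) tendsto_id).const_mul_atBot two_pos)
      refine squeeze_zero_norm (a := fun s => Real.exp (2 * (s - x)) * (3 * C)) (fun s => ?_)
        (by simpa using h0.mul_const (3 * C))
      have h1 := abs_le.mp (hPC s)
      have h2 := abs_le.mp (hPC' s)
      rw [norm_mul, Real.norm_of_nonneg (Real.exp_pos _).le]
      refine mul_le_mul_of_nonneg_left ?_ (Real.exp_pos _).le
      rw [Real.norm_eq_abs, abs_le]
      constructor <;> linarith
    rw [setIntegral_congr_fun measurableSet_Iic hcongr,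
      integral_Iic_of_hasDerivAt_of_tendsto' (m := 0)
        (f := fun s => Real.exp (2 * (s - x)) * (2 * P s - P' s)) (fun s _ => ?_)
        (hint.integrableOn.congr_fun hcongr measurableSet_Iic) hlim]
    · simp
    · refine ((hasDerivAt_exp_mul_sub 2 x s).mul
        (((hP s).const_mul 2).sub (hP' s))).congr_deriv ?_
      simp only [Pi.sub_apply]
      ring
  have hright : ∫ s in Set.Ioi x, Real.exp (-2 * |x - s|) * (4 * P s - P'' s) =
      2 * P x + P' x := by
    have hcongr : Set.EqOn (fun s => Real.exp (-2 * |x - s|) * (4 * P s - P'' s))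
        (fun s => Real.exp (-2 * (s - x)) * (4 * P s - P'' s)) (Set.Ioi x) := fun s hs => by
      simp only [hreq s hs]
    have hlim : Tendsto (fun s => Real.exp (-2 * (s - x)) * (-(2 * P s) - P' s)) atTop
        (nhds 0) := by
      have h0 : Tendsto (fun s : ℝ => Real.exp (-2 * (s - x))) atTop (nhds 0) :=
        Real.tendsto_exp_atBot.comp
          ((tendsto_atTop_add_const_right _ (-x) tendsto_id).const_mul_atTop_of_neg (by norm_num))
      refine squeeze_zero_norm (a := fun s => Real.exp (-2 * (s - x)) * (3 * C)) (fun s => ?_)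
        (by simpa using h0.mul_const (3 * C))
      have h1 := abs_le.mp (hPC s)
      have h2 := abs_le.mp (hPC' s)
      rw [norm_mul, Real.norm_of_nonneg (Real.exp_pos _).le]
      refine mul_le_mul_of_nonneg_left ?_ (Real.exp_pos _).le
      rw [Real.norm_eq_abs, abs_le]
      constructor <;> linarith
    rw [setIntegral_congr_fun measurableSet_Ioi hcongr,
      integral_Ioi_of_hasDerivAt_of_tendsto' (m := 0)
        (f := fun s => Real.exp (-2 * (s - x)) * (-(2 * P s) - P' s)) (fun s _ => ?_)
        (hint.integrableOn.congr_fun hcongr measurableSet_Ioi) hlim]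
    · simp; ring
    · refine ((hasDerivAt_exp_mul_sub (-2) x s).mul
        (((hP s).const_mul 2).neg.sub (hP' s))).congr_deriv ?_
      simp only [Pi.sub_apply, Pi.neg_apply]
      ring
  rw [← integral_add_compl measurableSet_Iic hint, Set.compl_Iic, hleft, hright]
  ring

variable {f : ℝ → ℂ}

theorem setIntegral_Iic_eq_add_intervalIntegral (hf : ∀ x, IntegrableOn f (Set.Iic x)) (x : ℝ) :
    ∫ s in Set.Iic x, f s = (∫ s in Set.Iic 0, f s) + ∫ s in (0 : ℝ)..x, f s := by
  rw [← intervalIntegral.integral_Iic_sub_Iic (hf 0) (hf x)]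
  ring

theorem setIntegral_Ioi_eq_sub_intervalIntegral (hf : ∀ x, IntegrableOn f (Set.Ioi x)) (x : ℝ) :
    ∫ s in Set.Ioi x, f s = (∫ s in Set.Ioi 0, f s) - ∫ s in (0 : ℝ)..x, f s := by
  rw [← intervalIntegral.integral_Ioi_sub_Ioi' (hf 0) (hf x)]
  ring

theorem integrableOn_Iic_exp_mul (hf : MemLp f 2) (x : ℝ) :
    IntegrableOn (fun s => ((Real.exp (2 * s) : ℝ) : ℂ) * f s) (Set.Iic x) := by
  have h : IntegrableOn (fun s => ((Real.exp (2 * x) : ℝ) : ℂ) *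
      (((Real.exp (-2 * |x - s|) : ℝ) : ℂ) * f s)) (Set.Iic x) :=
    (integrable_exp_kernel_mul hf x).integrableOn.const_mul _
  refine h.congr_fun (fun s hs => ?_) measurableSet_Iic
  simp only
  rw [abs_of_nonneg (sub_nonneg.mpr hs), ← mul_assoc, ← Complex.ofReal_mul, ← Real.exp_add]
  ring_nf

theorem integrableOn_Ioi_exp_mul (hf : MemLp f 2) (x : ℝ) :
    IntegrableOn (fun s => ((Real.exp (-2 * s) : ℝ) : ℂ) * f s) (Set.Ioi x) := by
  have h : IntegrableOn (fun s => ((Real.exp (-2 * x) : ℝ) : ℂ) *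
      (((Real.exp (-2 * |x - s|) : ℝ) : ℂ) * f s)) (Set.Ioi x) :=
    (integrable_exp_kernel_mul hf x).integrableOn.const_mul _
  refine h.congr_fun (fun s hs => ?_) measurableSet_Ioi
  simp only
  rw [abs_of_neg (sub_neg.mpr hs), ← mul_assoc, ← Complex.ofReal_mul, ← Real.exp_add]
  ring_nf

theorem setIntegral_Iic_exp_kernel (f : ℝ → ℂ) (x : ℝ) :
    ∫ s in Set.Iic x, ((Real.exp (-2 * |x - s|) : ℝ) : ℂ) * f s =
      ((Real.exp (-2 * x) : ℝ) : ℂ) * ∫ s in Set.Iic x, ((Real.exp (2 * s) : ℝ) : ℂ) * f s := by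
  rw [← integral_const_mul]
  refine setIntegral_congr_fun measurableSet_Iic fun s hs => ?_
  rw [abs_of_nonneg (sub_nonneg.mpr hs), ← mul_assoc, ← Complex.ofReal_mul, ← Real.exp_add]
  ring_nf

theorem setIntegral_Ioi_exp_kernel (f : ℝ → ℂ) (x : ℝ) :
    ∫ s in Set.Ioi x, ((Real.exp (-2 * |x - s|) : ℝ) : ℂ) * f s =
      ((Real.exp (2 * x) : ℝ) : ℂ) * ∫ s in Set.Ioi x, ((Real.exp (-2 * s) : ℝ) : ℂ) * f s := by
  rw [← integral_const_mul]
  refine setIntegral_congr_fun measurableSet_Ioi fun s hs => ?_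
  rw [abs_of_neg (sub_neg.mpr hs), ← mul_assoc, ← Complex.ofReal_mul, ← Real.exp_add]
  ring_nf

theorem setIntegral_Iic_exp_kernel_eq (hf : MemLp f 2) (x : ℝ) :
    ∫ s in Set.Iic x, ((Real.exp (-2 * |x - s|) : ℝ) : ℂ) * f s =
      ((Real.exp (-2 * x) : ℝ) : ℂ) * ((∫ s in Set.Iic 0, ((Real.exp (2 * s) : ℝ) : ℂ) * f s) +
        ∫ s in (0 : ℝ)..x, ((Real.exp (2 * s) : ℝ) : ℂ) * f s) := by
  rw [setIntegral_Iic_exp_kernel,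
    setIntegral_Iic_eq_add_intervalIntegral (integrableOn_Iic_exp_mul hf)]

theorem setIntegral_Ioi_exp_kernel_eq (hf : MemLp f 2) (x : ℝ) :
    ∫ s in Set.Ioi x, ((Real.exp (-2 * |x - s|) : ℝ) : ℂ) * f s =
      ((Real.exp (2 * x) : ℝ) : ℂ) * ((∫ s in Set.Ioi 0, ((Real.exp (-2 * s) : ℝ) : ℂ) * f s) -
        ∫ s in (0 : ℝ)..x, ((Real.exp (-2 * s) : ℝ) : ℂ) * f s) := by
  rw [setIntegral_Ioi_exp_kernel,
    setIntegral_Ioi_eq_sub_intervalIntegral (integrableOn_Ioi_exp_mul hf)]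

theorem integral_exp_kernel_eq_add (hf : MemLp f 2) (x : ℝ) :
    ∫ s, ((Real.exp (-2 * |x - s|) : ℝ) : ℂ) * f s =
      (∫ s in Set.Iic x, ((Real.exp (-2 * |x - s|) : ℝ) : ℂ) * f s) +
        ∫ s in Set.Ioi x, ((Real.exp (-2 * |x - s|) : ℝ) : ℂ) * f s := by
  rw [← Set.compl_Iic, integral_add_compl measurableSet_Iic (integrable_exp_kernel_mul hf x)]

theorem norm_setIntegral_exp_kernel_le (hf : MemLp f 2) (S : Set ℝ) (x : ℝ) :
    ‖∫ s in S, ((Real.exp (-2 * |x - s|) : ℝ) : ℂ) * f s‖ ≤ 1 + ∫ s, ‖f s‖ ^ 2 := by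
  have hint := integrable_exp_kernel_mul hf x
  calc ‖∫ s in S, ((Real.exp (-2 * |x - s|) : ℝ) : ℂ) * f s‖
      ≤ ∫ s in S, ‖((Real.exp (-2 * |x - s|) : ℝ) : ℂ) * f s‖ := norm_integral_le_integral_norm _
    _ ≤ ∫ s, ‖((Real.exp (-2 * |x - s|) : ℝ) : ℂ) * f s‖ :=
        setIntegral_le_integral hint.norm (ae_of_all _ fun _ => norm_nonneg _)
    _ ≤ ∫ s, (Real.exp (-2 * |x - s|) + ‖f s‖ ^ 2) :=
        integral_mono hint.norm ((integrable_exp_neg_two_mul_abs_sub x).add hf.norm.integrable_sq)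
          fun s => norm_exp_kernel_mul_le x s
    _ = 1 + ∫ s, ‖f s‖ ^ 2 := by
        rw [integral_add (integrable_exp_neg_two_mul_abs_sub x) hf.norm.integrable_sq,
          integral_sub_left_eq_self (fun s => Real.exp (-2 * |s|)) volume x,
          integral_exp_neg_two_mul_abs]

theorem continuous_integral_exp_kernel (hf : MemLp f 2) :
    Continuous fun x => ∫ s, ((Real.exp (-2 * |x - s|) : ℝ) : ℂ) * f s := by
  have hii : ∀ g : ℝ → ℝ, Continuous g → ∀ a b : ℝ,
      IntervalIntegrable (fun s => ((g s : ℝ) : ℂ) * f s) volume a b := fun g hg a b =>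
    IntervalIntegrable.continuousOn_mul ⟨(hf.restrict _).integrable one_le_two,
      (hf.restrict _).integrable one_le_two⟩ (by fun_prop)
  rw [funext fun x => (integral_exp_kernel_eq_add hf x).trans (congrArg₂ (· + ·)
    (setIntegral_Iic_exp_kernel_eq hf x) (setIntegral_Ioi_exp_kernel_eq hf x))]
  have h1 := intervalIntegral.continuous_primitive (hii (fun s => Real.exp (2 * s)) (by fun_prop)) 0
  have h2 := intervalIntegral.continuous_primitive
    (hii (fun s => Real.exp (-2 * s)) (by fun_prop)) 0
  fun_prop

theorem hasDerivAt_ofReal_exp_mul (r x : ℝ) :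
    HasDerivAt (fun x : ℝ => ((Real.exp (r * x) : ℝ) : ℂ)) ((r : ℂ) * ((Real.exp (r * x) : ℝ) : ℂ))
      x := by
  have h := ((hasDerivAt_id x).const_mul r).exp.ofReal_comp
  simpa [mul_comm] using h

theorem hasDerivAt_setIntegral_Iic_exp_kernel (hf : MemLp f 2) (hc : Continuous f) (x : ℝ) :
    HasDerivAt (fun x => ∫ s in Set.Iic x, ((Real.exp (-2 * |x - s|) : ℝ) : ℂ) * f s)
      (-2 * (∫ s in Set.Iic x, ((Real.exp (-2 * |x - s|) : ℝ) : ℂ) * f s) + f x) x := by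
  rw [funext (setIntegral_Iic_exp_kernel_eq hf), setIntegral_Iic_exp_kernel_eq hf x]
  have hg : Continuous fun s : ℝ => ((Real.exp (2 * s) : ℝ) : ℂ) * f s := by fun_prop
  refine ((hasDerivAt_ofReal_exp_mul (-2) x).mul
    ((hg.integral_hasStrictDerivAt 0 x).hasDerivAt.const_add _)).congr_deriv ?_
  have he : ((Real.exp (-2 * x) : ℝ) : ℂ) * ((Real.exp (2 * x) : ℝ) : ℂ) = 1 := by
    rw [← Complex.ofReal_mul, ← Real.exp_add]; simp
  push_cast at he ⊢
  linear_combination (f x) * he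

theorem hasDerivAt_setIntegral_Ioi_exp_kernel (hf : MemLp f 2) (hc : Continuous f) (x : ℝ) :
    HasDerivAt (fun x => ∫ s in Set.Ioi x, ((Real.exp (-2 * |x - s|) : ℝ) : ℂ) * f s)
      (2 * (∫ s in Set.Ioi x, ((Real.exp (-2 * |x - s|) : ℝ) : ℂ) * f s) - f x) x := by
  rw [funext (setIntegral_Ioi_exp_kernel_eq hf), setIntegral_Ioi_exp_kernel_eq hf x]
  have hg : Continuous fun s : ℝ => ((Real.exp (-2 * s) : ℝ) : ℂ) * f s := by fun_prop
  refine ((hasDerivAt_ofReal_exp_mul 2 x).mul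
    ((hg.integral_hasStrictDerivAt 0 x).hasDerivAt.const_sub _)).congr_deriv ?_
  have he : ((Real.exp (2 * x) : ℝ) : ℂ) * ((Real.exp (-2 * x) : ℝ) : ℂ) = 1 := by
    rw [← Complex.ofReal_mul, ← Real.exp_add]; simp
  push_cast at he ⊢
  linear_combination (-f x) * he

/-- The convolution of a continuous square-integrable function `f` with `exp (-2 |x|)` is a bounded
solution `u` of `u'' = 4 u - 4 f`, with bounded derivative. -/
theorem exists_deriv_integral_exp_kernel (hf : MemLp f 2) (hc : Continuous f) {u : ℝ → ℂ}
    (hu : ∀ x, u x = ∫ s, ((Real.exp (-2 * |x - s|) : ℝ) : ℂ) * f s) :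
    ∃ v : ℝ → ℂ, (∀ x, HasDerivAt u (v x) x) ∧ (∀ x, HasDerivAt v (4 * u x - 4 * f x) x) ∧
      ∃ C : ℝ, ∀ x, ‖u x‖ ≤ C ∧ ‖v x‖ ≤ C := by
  set A : ℝ → ℂ := fun x => ∫ s in Set.Iic x, ((Real.exp (-2 * |x - s|) : ℝ) : ℂ) * f s with hA
  set B : ℝ → ℂ := fun x => ∫ s in Set.Ioi x, ((Real.exp (-2 * |x - s|) : ℝ) : ℂ) * f s with hB
  have hAd : ∀ x, HasDerivAt A (-2 * A x + f x) x := hasDerivAt_setIntegral_Iic_exp_kernel hf hc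
  have hBd : ∀ x, HasDerivAt B (2 * B x - f x) x := hasDerivAt_setIntegral_Ioi_exp_kernel hf hc
  have huAB : u = fun x => A x + B x := funext fun x =>
    (hu x).trans (integral_exp_kernel_eq_add hf x)
  subst huAB
  have hAn : ∀ x, ‖A x‖ ≤ 1 + ∫ s, ‖f s‖ ^ 2 := fun x =>
    norm_setIntegral_exp_kernel_le hf _ x
  have hBn : ∀ x, ‖B x‖ ≤ 1 + ∫ s, ‖f s‖ ^ 2 := fun x =>
    norm_setIntegral_exp_kernel_le hf _ x
  refine ⟨fun x => 2 * B x - 2 * A x, fun x => ((hAd x).add (hBd x)).congr_deriv (by ring),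
    fun x => (((hBd x).const_mul 2).sub ((hAd x).const_mul 2)).congr_deriv (by ring),
    4 * (1 + ∫ s, ‖f s‖ ^ 2), fun x => ⟨?_, ?_⟩⟩
  · have := norm_add_le (A x) (B x)
    linarith [hAn x, hBn x, norm_nonneg (A x)]
  · have := norm_sub_le (2 * B x) (2 * A x)
    rw [norm_mul, norm_mul, Complex.norm_ofNat] at this
    linarith [hAn x, hBn x]

end Green

section Profile

theorem hasDerivAt_sub_mul_deriv {c k : ℝ} {φ : ℝ → ℝ} (hφ : ContDiff ℝ 2 φ)
    (hode : ∀ ξ : ℝ, (c - φ ξ) * deriv (deriv φ) ξ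
        = (c - 2 * k) * φ ξ - 2 * (φ ξ) ^ 2 + (deriv φ ξ) ^ 2) (ξ : ℝ) :
    HasDerivAt (fun ξ => (c - φ ξ) * deriv φ ξ) ((c - 2 * k) * φ ξ - 2 * (φ ξ) ^ 2) ξ := by
  have h1 : HasDerivAt φ (deriv φ ξ) ξ := (hφ.differentiable two_ne_zero ξ).hasDerivAt
  have h2 : HasDerivAt (deriv φ) (deriv (deriv φ) ξ) ξ :=
    ((hφ.deriv' (n := 1)).differentiable one_ne_zero ξ).hasDerivAt
  refine ((h1.const_sub c).mul h2).congr_deriv ?_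
  linear_combination hode ξ

/-- The energy identity for solitary wave profiles. -/
theorem exists_sq_sub_mul_deriv_eq {c k : ℝ} {φ : ℝ → ℝ} (hφ : ContDiff ℝ 2 φ)
    (hode : ∀ ξ : ℝ, (c - φ ξ) * deriv (deriv φ) ξ
        = (c - 2 * k) * φ ξ - 2 * (φ ξ) ^ 2 + (deriv φ ξ) ^ 2) :
    ∃ E : ℝ, ∀ ξ, ((c - φ ξ) * deriv φ ξ) ^ 2 =
      E + c * (c - 2 * k) * φ ξ ^ 2 - 2 * (3 * c - 2 * k) / 3 * φ ξ ^ 3 + φ ξ ^ 4 := by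
  have hd : ∀ ξ, HasDerivAt (fun ξ => ((c - φ ξ) * deriv φ ξ) ^ 2 -
      (c * (c - 2 * k) * φ ξ ^ 2 - 2 * (3 * c - 2 * k) / 3 * φ ξ ^ 3 + φ ξ ^ 4)) 0 ξ := fun ξ => by
    have h1 : HasDerivAt φ (deriv φ ξ) ξ := (hφ.differentiable two_ne_zero ξ).hasDerivAt
    refine (((hasDerivAt_sub_mul_deriv hφ hode ξ).pow 2).sub
      ((((h1.pow 2).const_mul _).sub ((h1.pow 3).const_mul _)).add (h1.pow 4))).congr_deriv ?_
    push_cast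
    ring
  refine ⟨((c - φ 0) * deriv φ 0) ^ 2 -
    (c * (c - 2 * k) * φ 0 ^ 2 - 2 * (3 * c - 2 * k) / 3 * φ 0 ^ 3 + φ 0 ^ 4), fun ξ => ?_⟩
  have h := is_const_of_deriv_eq_zero (fun t => (hd t).differentiableAt) (fun t => (hd t).deriv) ξ 0
  linear_combination h

theorem deriv_neg_of_even {φ : ℝ → ℝ} (heven : ∀ ξ : ℝ, φ (-ξ) = φ ξ) (ξ : ℝ) :
    deriv φ (-ξ) = -deriv φ ξ := by
  have h := deriv_comp_neg (f := φ) (-ξ)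
  rw [neg_neg, funext heven] at h
  exact h

theorem integrable_deriv_of_even_of_monotoneOn {φ : ℝ → ℝ} {L : ℝ} (hφ : Differentiable ℝ φ)
    (heven : ∀ ξ : ℝ, φ (-ξ) = φ ξ) (hmono : MonotoneOn φ (Set.Iic 0))
    (htop : Tendsto φ atTop (nhds L)) : Integrable (deriv φ) := by
  have hIoi : IntegrableOn (deriv φ) (Set.Ioi 0) := by
    refine integrableOn_Ioi_deriv_of_nonpos' (fun x _ => (hφ x).hasDerivAt) (fun x hx => ?_) htop
    have h : 0 ≤ deriv φ (-x) := by
      rw [← derivWithin_of_mem_nhds (Iic_mem_nhds (neg_lt_zero.mpr hx))]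
      exact hmono.derivWithin_nonneg
    rw [deriv_neg_of_even heven] at h
    linarith
  have hIio : IntegrableOn (deriv φ) (Set.Iio 0) := by
    have h : IntegrableOn (fun x => deriv φ (-x)) (Set.Iio 0) :=
      IntegrableOn.comp_neg_Iio (by rwa [neg_zero])
    refine h.neg.congr_fun (fun x _ => ?_) measurableSet_Iio
    simp [deriv_neg_of_even heven]
  rw [← integrableOn_univ, ← Set.Iio_union_Ici (a := (0 : ℝ))]
  exact hIio.union ((integrableOn_Ici_iff_integrableOn_Ioi).mpr hIoi)

/-- The basic properties of a solitary wave profile: its derivative is bounded, square-integrable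
and does not vanish identically, and `(c - φ) φ'` vanishes at `-∞`. -/
theorem solitary_wave_deriv {c k : ℝ} {φ : ℝ → ℝ}
    (hφ : ContDiff ℝ 2 φ)
    (hode : ∀ ξ : ℝ, (c - φ ξ) * deriv (deriv φ) ξ
        = (c - 2 * k) * φ ξ - 2 * (φ ξ) ^ 2 + (deriv φ ξ) ^ 2)
    (heven : ∀ ξ : ℝ, φ (-ξ) = φ ξ) (hbd : ∀ ξ : ℝ, 0 < φ ξ ∧ φ ξ < c)
    (hmono : StrictMonoOn φ (Set.Iic 0)) (htop : Tendsto φ atTop (nhds 0))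
    (hbot : Tendsto φ atBot (nhds 0))
    {m : ℝ} (hm : 0 < m) (hma : ∀ ξ, m ≤ c - φ ξ) :
    (∃ B, ∀ ξ, |deriv φ ξ| ≤ B ∧ |(c - φ ξ) * deriv φ ξ| ≤ B) ∧ MemLp (deriv φ) 2 ∧
      Tendsto (fun ξ => (c - φ ξ) * deriv φ ξ) atBot (nhds 0) ∧ ∃ ξ, deriv φ ξ ≠ 0 := by
  obtain ⟨E, hE⟩ := exists_sq_sub_mul_deriv_eq hφ hode
  have hφd : Differentiable ℝ φ := hφ.differentiable two_ne_zero
  have hφc : Continuous φ := hφ.continuous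
  have hdc : Continuous (deriv φ) := (hφ.deriv' (n := 1)).continuous
  have hint : Integrable (deriv φ) :=
    integrable_deriv_of_even_of_monotoneOn hφd heven hmono.monotoneOn htop
  have hP : ∃ B, ∀ ξ, |(c - φ ξ) * deriv φ ξ| ≤ B := by
    have hcpos : 0 < c := (hbd 0).1.trans (hbd 0).2
    refine ⟨1 + (|E| + |c * (c - 2 * k)| * c ^ 2 + |2 * (3 * c - 2 * k) / 3| * c ^ 3 + c ^ 4),
      fun ξ => ?_⟩
    have hx := hbd ξ
    have e2 : φ ξ ^ 2 ≤ c ^ 2 := pow_le_pow_left₀ hx.1.le hx.2.le 2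
    have e3 : φ ξ ^ 3 ≤ c ^ 3 := pow_le_pow_left₀ hx.1.le hx.2.le 3
    have e4 : φ ξ ^ 4 ≤ c ^ 4 := pow_le_pow_left₀ hx.1.le hx.2.le 4
    have f2 : c * (c - 2 * k) * φ ξ ^ 2 ≤ |c * (c - 2 * k)| * c ^ 2 :=
      mul_le_mul (le_abs_self _) e2 (by positivity) (abs_nonneg _)
    have f3 : -(2 * (3 * c - 2 * k) / 3) * φ ξ ^ 3 ≤ |2 * (3 * c - 2 * k) / 3| * c ^ 3 :=
      mul_le_mul (neg_le_abs _) e3 (pow_nonneg hx.1.le 3) (abs_nonneg _)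
    have hsq := hE ξ
    rw [← sq_abs] at hsq
    nlinarith [sq_nonneg (|(c - φ ξ) * deriv φ ξ| - 1), le_abs_self E,
      abs_nonneg ((c - φ ξ) * deriv φ ξ)]
  obtain ⟨B, hB⟩ := hP
  have hdB : ∀ ξ, |deriv φ ξ| ≤ B / m := fun ξ => by
    rw [le_div_iff₀ hm]
    refine le_trans ?_ (hB ξ)
    rw [abs_mul, abs_of_pos (hm.trans_le (hma ξ)), mul_comm]
    exact mul_le_mul_of_nonneg_right (hma ξ) (abs_nonneg _)
  have hsqint : Integrable fun ξ => deriv φ ξ ^ 2 := by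
    simp only [sq]
    exact hint.bdd_mul hdc.aestronglyMeasurable (ae_of_all _ hdB)
  have hPsq : Integrable fun ξ => ((c - φ ξ) * deriv φ ξ) ^ 2 := by
    simp only [mul_pow]
    refine hsqint.bdd_mul (c := c ^ 2) (by fun_prop) (ae_of_all _ fun ξ => ?_)
    rw [norm_pow, Real.norm_of_nonneg (sub_nonneg.mpr (hbd ξ).2.le)]
    exact pow_le_pow_left₀ (sub_nonneg.mpr (hbd ξ).2.le) (by linarith [(hbd ξ).1]) 2
  have hlim : Tendsto (fun ξ => ((c - φ ξ) * deriv φ ξ) ^ 2) atBot (nhds E) := by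
    rw [funext hE]
    have h := (((hbot.pow 2).const_mul (c * (c - 2 * k))).const_add E).sub
      ((hbot.pow 3).const_mul (2 * (3 * c - 2 * k) / 3)) |>.add (hbot.pow 4)
    simpa using h
  have hE0 : E = 0 := by
    refine (hPsq.integrableAtFilter atBot).eq_zero_of_tendsto (fun s hs => ?_) hlim
    obtain ⟨b, hb⟩ := mem_atBot_sets.mp hs
    exact measure_mono_top (fun x hx => hb x hx) (Real.volume_Iic (a := b))
  refine ⟨⟨max (B / m) B, fun ξ =>
      ⟨(hdB ξ).trans (le_max_left _ _), (hB ξ).trans (le_max_right _ _)⟩⟩,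
    (memLp_two_iff_integrable_sq hdc.aestronglyMeasurable).mpr hsqint, ?_, ?_⟩
  · rw [hE0] at hlim
    have h := hlim.sqrt
    simp only [Real.sqrt_sq_eq_abs, Real.sqrt_zero] at h
    exact (tendsto_zero_iff_abs_tendsto_zero _).mpr h
  · by_contra! h
    have h1 := is_const_of_deriv_eq_zero hφd h (-1) 0
    exact (hmono (by simp) (by simp) (by norm_num : (-1 : ℝ) < 0)).ne h1

end Profile

section Kernel

theorem norm_four_sub_div_le {c k m : ℝ} {φ : ℝ → ℝ} (hm : 0 < m) (hma : ∀ ξ, m ≤ c - φ ξ) (ξ : ℝ) :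
    ‖((4 - (3 * c + 2 * k) / (c - φ ξ) : ℝ) : ℂ)‖ ≤ 4 + |3 * c + 2 * k| / m := by
  rw [Complex.norm_real]
  refine (norm_sub_le _ _).trans ?_
  rw [Real.norm_eq_abs, Real.norm_eq_abs, abs_div, abs_of_pos (hm.trans_le (hma ξ)),
    abs_of_pos (four_pos : (0 : ℝ) < 4)]
  gcongr
  exact hma ξ

/-- Every square-integrable solution of `(c - φ) f = (3 c + 2 k) / 4 * ∫ exp (-2 |· - s|) f s` is a
multiple of the derivative of the solitary wave profile `φ`. -/
theorem exists_ae_eq_mul_deriv {c k : ℝ} {φ : ℝ → ℝ} (hφ : ContDiff ℝ 2 φ)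
    (hode : ∀ ξ : ℝ, (c - φ ξ) * deriv (deriv φ) ξ
        = (c - 2 * k) * φ ξ - 2 * (φ ξ) ^ 2 + (deriv φ ξ) ^ 2)
    (hbot : Tendsto φ atBot (nhds 0)) {m : ℝ} (hm : 0 < m) (hma : ∀ ξ, m ≤ c - φ ξ)
    (hP : Tendsto (fun ξ => (c - φ ξ) * deriv φ ξ) atBot (nhds 0)) {ξ₀ : ℝ} (hξ₀ : deriv φ ξ₀ ≠ 0)
    {f : ℝ → ℂ} (hf : MemLp f 2)
    (hfe : ∀ᵐ ξ : ℝ, ((c - φ ξ : ℝ) : ℂ) * f ξ =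
      (((3 * c + 2 * k) / 4 : ℝ) : ℂ) * ∫ s : ℝ, ((Real.exp (-2 * |ξ - s|) : ℝ) : ℂ) * f s) :
    ∃ a : ℂ, ∀ᵐ ξ : ℝ, f ξ = a * ((deriv φ ξ : ℝ) : ℂ) := by
  have hφc : Continuous φ := hφ.continuous
  have hpos : ∀ ξ, 0 < c - φ ξ := fun ξ => hm.trans_le (hma ξ)
  have hne : ∀ ξ, ((c - φ ξ : ℝ) : ℂ) ≠ 0 := fun ξ => Complex.ofReal_ne_zero.mpr (hpos ξ).ne'
  set ρ : ℂ := (((3 * c + 2 * k) / 4 : ℝ) : ℂ) with hρ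
  set u : ℝ → ℂ := fun ξ => ∫ s : ℝ, ((Real.exp (-2 * |ξ - s|) : ℝ) : ℂ) * f s with hu
  have huc : Continuous u := continuous_integral_exp_kernel hf
  set F : ℝ → ℂ := fun ξ => ρ * u ξ / ((c - φ ξ : ℝ) : ℂ) with hF
  have hFc : Continuous F := (huc.const_mul ρ).div (by fun_prop) hne
  have hfF : f =ᵐ[volume] F := by
    filter_upwards [hfe] with ξ hξ
    rw [hF, eq_div_iff (hne ξ), mul_comm, hξ]
  have huF : ∀ x, u x = ∫ s : ℝ, ((Real.exp (-2 * |x - s|) : ℝ) : ℂ) * F s := fun x => by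
    refine integral_congr_ae ?_
    filter_upwards [hfF] with s hs
    rw [hs]
  obtain ⟨v, hv, hv', C, hC⟩ := exists_deriv_integral_exp_kernel (hf.ae_eq hfF) hFc huF
  have hφd : ∀ ξ, HasDerivAt φ (deriv φ ξ) ξ := fun ξ =>
    (hφ.differentiable two_ne_zero ξ).hasDerivAt
  have hP'lim : Tendsto (fun ξ => (c - 2 * k) * φ ξ - 2 * (φ ξ) ^ 2) atBot (nhds 0) := by
    simpa using (hbot.const_mul (c - 2 * k)).sub ((hbot.pow 2).const_mul 2)
  have hW : Tendsto (fun ξ => (((c - φ ξ) * deriv φ ξ : ℝ) : ℂ) * v ξ -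
      (((c - 2 * k) * φ ξ - 2 * (φ ξ) ^ 2 : ℝ) : ℂ) * u ξ) atBot (nhds 0) := by
    have h1 := (hP.norm.add hP'lim.norm).mul_const C
    simp only [norm_zero, add_zero, zero_mul] at h1
    refine squeeze_zero_norm (fun ξ => ?_) h1
    refine (norm_sub_le _ _).trans ?_
    rw [norm_mul, norm_mul, Complex.norm_real, Complex.norm_real, add_mul]
    have := hC ξ
    gcongr
    · exact this.2
    · exact this.1
  obtain ⟨α, hα⟩ := exists_eq_mul_of_tendsto_wronskian
    (Q := fun ξ => ((4 - (3 * c + 2 * k) / (c - φ ξ) : ℝ) : ℂ))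
    (norm_four_sub_div_le (k := k) hm hma)
    (fun ξ => (hasDerivAt_sub_mul_deriv hφ hode ξ).ofReal_comp)
    (fun ξ => by
      refine (((hφd ξ).const_mul (c - 2 * k)).sub
        (((hφd ξ).pow 2).const_mul 2)).ofReal_comp.congr_deriv ?_
      rw [← Complex.ofReal_mul]
      congr 1
      have := (hpos ξ).ne'
      field_simp
      push_cast
      ring)
    hv (fun ξ => (hv' ξ).congr_deriv (by
      have h := hne ξ
      rw [hF, hρ]
      push_cast at h ⊢
      field_simp)) hW (t₀ := ξ₀)
    (Complex.ofReal_ne_zero.mpr (mul_ne_zero (hpos ξ₀).ne' hξ₀))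
  refine ⟨ρ * α, ?_⟩
  filter_upwards [hfF] with ξ hξ
  rw [hξ, hF]
  simp only
  rw [hα ξ, div_eq_iff (hne ξ)]
  push_cast
  ring

/-- The derivative of a solitary wave profile is annihilated by the linearized operator. -/
theorem sub_mul_deriv_eq_integral_exp_kernel {c k : ℝ} {φ : ℝ → ℝ} (hφ : ContDiff ℝ 2 φ)
    (hode : ∀ ξ : ℝ, (c - φ ξ) * deriv (deriv φ) ξ
        = (c - 2 * k) * φ ξ - 2 * (φ ξ) ^ 2 + (deriv φ ξ) ^ 2)
    (hbd : ∀ ξ : ℝ, 0 < φ ξ ∧ φ ξ < c) {B : ℝ}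
    (hB : ∀ ξ, |deriv φ ξ| ≤ B ∧ |(c - φ ξ) * deriv φ ξ| ≤ B) (ξ : ℝ) :
    ((c - φ ξ : ℝ) : ℂ) * ((deriv φ ξ : ℝ) : ℂ) = (((3 * c + 2 * k) / 4 : ℝ) : ℂ) *
      ∫ s : ℝ, ((Real.exp (-2 * |ξ - s|) : ℝ) : ℂ) * ((deriv φ s : ℝ) : ℂ) := by
  have hφc : Continuous φ := hφ.continuous
  have hdc : Continuous (deriv φ) := (hφ.deriv' (n := 1)).continuous
  have hφd : ∀ ξ, HasDerivAt φ (deriv φ ξ) ξ := fun ξ =>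
    (hφ.differentiable two_ne_zero ξ).hasDerivAt
  have hφabs : ∀ s, |φ s| ≤ c := fun s => by
    rw [abs_of_pos (hbd s).1]
    exact (hbd s).2.le
  have hc : 0 ≤ c := (abs_nonneg _).trans (hφabs 0)
  have key := integral_exp_kernel_mul_four_mul_sub
    (P'' := fun s => ((c - 2 * k) - 4 * φ s) * deriv φ s)
    (C := max B (|c - 2 * k| * c + 2 * c ^ 2)) (D := (|c - 2 * k| + 4 * c) * B)
    (hasDerivAt_sub_mul_deriv hφ hode)
    (fun s => (((hφd s).const_mul (c - 2 * k)).sub (((hφd s).pow 2).const_mul 2)).congr_deriv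
      (by push_cast; ring))
    (fun s => (hB s).2.trans (le_max_left _ _))
    (fun s => by
      refine ((abs_sub _ _).trans ?_).trans (le_max_right _ _)
      rw [abs_mul, abs_mul, abs_pow, abs_two]
      gcongr <;> exact hφabs s)
    (by fun_prop)
    (fun s => by
      rw [abs_mul]
      refine mul_le_mul ((abs_sub _ _).trans ?_) (hB s).1 (abs_nonneg _) (by positivity)
      rw [abs_mul, abs_of_pos (four_pos : (0 : ℝ) < 4)]
      gcongr
      exact hφabs s) ξ
  have hrew : ∀ s, Real.exp (-2 * |ξ - s|) * (4 * ((c - φ s) * deriv φ s) -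
      ((c - 2 * k) - 4 * φ s) * deriv φ s) =
        (3 * c + 2 * k) * (Real.exp (-2 * |ξ - s|) * deriv φ s) := fun s => by ring
  simp only [hrew, integral_const_mul] at key
  have hcast : ∫ s : ℝ, ((Real.exp (-2 * |ξ - s|) : ℝ) : ℂ) * ((deriv φ s : ℝ) : ℂ) =
      ((∫ s : ℝ, Real.exp (-2 * |ξ - s|) * deriv φ s : ℝ) : ℂ) := by
    rw [← integral_complex_ofReal]
    simp only [Complex.ofReal_mul]
  rw [hcast, ← Complex.ofReal_mul, ← Complex.ofReal_mul]
  congr 1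
  linarith

end Kernel

/-- For the bounded self-adjoint realization `T` of the linearized DP operator
`L_c` at a solitary wave profile `φ`, the value `0` is a simple isolated
eigenvalue with eigenfunction `φ' = ∂_ξ φ`. -/
theorem DP_zero_simple_isolated_eigenvalue (c k : ℝ) (hk : 0 < k) (hck : 2 * k < c)
    (φ : ℝ → ℝ) (hφ : ContDiff ℝ 2 φ)
    (hode : ∀ ξ : ℝ, (c - φ ξ) * deriv (deriv φ) ξ
        = (c - 2 * k) * φ ξ - 2 * (φ ξ) ^ 2 + (deriv φ ξ) ^ 2)
    (heven : ∀ ξ : ℝ, φ (-ξ) = φ ξ)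
    (hbd : ∀ ξ : ℝ, 0 < φ ξ ∧ φ ξ < c)
    (hmono : StrictMonoOn φ (Set.Iic 0))
    (htop : Tendsto φ atTop (nhds 0)) (hbot : Tendsto φ atBot (nhds 0))
    (T : Lp ℂ 2 (volume : Measure ℝ) →L[ℂ] Lp ℂ 2 (volume : Measure ℝ))
    (hsa : IsSelfAdjoint T)
    (hT : ∀ f : Lp ℂ 2 (volume : Measure ℝ), ∀ᵐ ξ : ℝ,
      (T f : ℝ → ℂ) ξ = ((c - φ ξ : ℝ) : ℂ) * f ξ
        - (((3 * c + 2 * k) / 4 : ℝ) : ℂ) * ∫ s : ℝ, ((Real.exp (-2 * |ξ - s|) : ℝ) : ℂ) * f s) :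
    (∃ g : Lp ℂ 2 (volume : Measure ℝ), g ≠ 0 ∧
        (g : ℝ → ℂ) =ᵐ[volume] (fun ξ : ℝ => ((deriv φ ξ : ℝ) : ℂ)) ∧
        ∀ f : Lp ℂ 2 (volume : Measure ℝ), T f = 0 ↔ ∃ a : ℂ, f = a • g) ∧
      ∃ ε : ℝ, 0 < ε ∧ spectrum ℂ T ∩ Metric.ball (0 : ℂ) ε = {0} := by
  have hm : 0 < c - φ 0 := sub_pos.mpr (hbd 0).2
  have hma : ∀ ξ, c - φ 0 ≤ c - φ ξ := fun ξ => by
    rcases le_total ξ 0 with h | h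
    · exact sub_le_sub_left (hmono.monotoneOn h Set.self_mem_Iic h) c
    · rw [← heven ξ]
      exact sub_le_sub_left
        (hmono.monotoneOn (neg_nonpos.mpr h) Set.self_mem_Iic (neg_nonpos.mpr h)) c
  obtain ⟨⟨B, hB⟩, hL2, hPlim, ξ₀, hξ₀⟩ :=
    solitary_wave_deriv hφ hode heven hbd hmono htop hbot hm hma
  have hL2c : MemLp (fun ξ : ℝ => ((deriv φ ξ : ℝ) : ℂ)) 2 := hL2.ofReal
  have hker := sub_mul_deriv_eq_integral_exp_kernel hφ hode hbd hB
  set g : Lp ℂ 2 (volume : Measure ℝ) := hL2c.toLp _ with hg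
  have hgae : (g : ℝ → ℂ) =ᵐ[volume] fun ξ : ℝ => ((deriv φ ξ : ℝ) : ℂ) := hL2c.coeFn_toLp
  have hdc : Continuous (deriv φ) := (hφ.deriv' (n := 1)).continuous
  have hg0 : g ≠ 0 := fun h => by
    have h1 : (fun ξ : ℝ => ((deriv φ ξ : ℝ) : ℂ)) =ᵐ[volume] fun _ => 0 :=
      hgae.symm.trans (by rw [h]; exact Lp.coeFn_zero _ _ _)
    have h2 := congrFun ((Continuous.ae_eq_iff_eq volume (by fun_prop) continuous_const).mp h1) ξ₀
    exact hξ₀ (Complex.ofReal_eq_zero.mp h2)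
  have hTg : T g = 0 := by
    refine Lp.ext ?_
    filter_upwards [hT g, hgae, Lp.coeFn_zero ℂ 2 (volume : Measure ℝ)] with ξ h1 h2 h3
    have h4 : ∫ s : ℝ, ((Real.exp (-2 * |ξ - s|) : ℝ) : ℂ) * g s =
        ∫ s : ℝ, ((Real.exp (-2 * |ξ - s|) : ℝ) : ℂ) * ((deriv φ s : ℝ) : ℂ) := by
      refine integral_congr_ae ?_
      filter_upwards [hgae] with s hs
      rw [hs]
    rw [h1, h3, h2, h4, hker ξ, sub_self, Pi.zero_apply]
  refine ⟨⟨g, hg0, hgae, fun f => ⟨fun hf => ?_, ?_⟩⟩, ?_⟩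
  · obtain ⟨a, ha⟩ := exists_ae_eq_mul_deriv hφ hode hbot hm hma hPlim hξ₀ (Lp.memLp f) (by
      filter_upwards [hT f, Lp.coeFn_zero ℂ 2 (volume : Measure ℝ)] with ξ h1 h2
      rw [hf, h2, Pi.zero_apply] at h1
      exact sub_eq_zero.mp h1.symm)
    refine ⟨a, Lp.ext ?_⟩
    filter_upwards [ha, hgae, Lp.coeFn_smul a g] with ξ h1 h2 h3
    rw [h3, Pi.smul_apply, h2, h1, smul_eq_mul]
  · rintro ⟨a, rfl⟩
    rw [map_smul, hTg, smul_zero]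
  · obtain ⟨V, hV, δ, hδ, hVδ⟩ := exists_finiteDimensional_bounded_below_on_orthogonal
      (a := fun ξ => c - φ ξ) (c := c) (M := c) (ρ := (3 * c + 2 * k) / 4)
      (continuous_const.sub hφ.continuous) hm hma (fun ξ => by linarith [(hbd ξ).1])
      (by linarith) (by linarith) (by simpa using htop.const_sub c)
      (by simpa using hbot.const_sub c) T hT
    exact exists_spectrum_inter_ball_eq_singleton T hsa V hδ hVδ hg0 hTg
end

section
/- Let c, k be real constants with c > 2k > 0, let φ be the solitary wave profile with speed c, and let T be the bounded self-adjoint operator on L²(ℝ, ℂ) given by (T f)(ξ) = (c − φ(ξ))·f(ξ) − ((3c + 2k)/4)·∫_ℝ e^{−2|ξ−s|}·f(s) ds. Then the intersection of the spectrum of T with the open half-line (−∞, 0) is a single point {λ_*}, and λ_* is an eigenvalue of T whose eigenspace is one-dimensional. -/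
open Filter MeasureTheory

/-- If a bounded self-adjoint operator is nonnegative on the orthogonal complement of a vector and
its quadratic form takes a negative value, then its spectrum on the negative half-line is a single
simple eigenvalue. -/
theorem spectrum_neg_of_nonneg_on_orthogonal {H : Type*} [NormedAddCommGroup H]
    [InnerProductSpace ℂ H] [CompleteSpace H] (T : H →L[ℂ] H) (hT : IsSelfAdjoint T) (ψ h : H)
    (hψ : ∀ f : H, inner ℂ ψ f = 0 → 0 ≤ (inner ℂ f (T f)).re)
    (hh : (inner ℂ h (T h)).re < 0) :
    ∃ lam : ℝ, lam < 0 ∧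
      spectrum ℂ T ∩ {z : ℂ | z.im = 0 ∧ z.re < 0} = {(lam : ℂ)} ∧
      ∃ g : H, g ≠ 0 ∧ ∀ f : H, T f = (lam : ℂ) • f ↔ ∃ a : ℂ, f = a • g := by
  set n : ℝ → ℝ := fun x => max (-x) 0 with hn
  set p : ℝ → ℝ := fun x => max x 0 with hp
  set r : ℝ → ℝ := fun x => √(n x) with hr
  set s : ℝ → ℝ := fun x => √(p x) with hs
  have hnc : Continuous n := by fun_prop
  have hpc : Continuous p := by fun_prop
  have hrc : Continuous r := by fun_prop
  have hsc : Continuous s := by fun_prop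
  set N := cfc n T with hN
  set P := cfc p T with hP
  set R := cfc r T with hR
  set S := cfc s T with hS
  have hRR : R * R = N := by
    rw [hR, hN, ← cfc_mul r r T (by fun_prop) (by fun_prop)]
    congr 1; ext x; simp [r, n, Real.mul_self_sqrt]
  have hSS : S * S = P := by
    rw [hS, hP, ← cfc_mul s s T (by fun_prop) (by fun_prop)]
    congr 1; ext x; simp [s, p, Real.mul_self_sqrt]
  have hTPN : T = P - N := by
    rw [hP, hN, ← cfc_sub p n T (by fun_prop) (by fun_prop)]
    conv_lhs => rw [← cfc_id ℝ T]
    congr 1; ext x; simp only [p, n, id]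
    rcases le_total x 0 with hx | hx <;> simp [hx]
  have hPN : P * N = 0 := by
    rw [hP, hN, ← cfc_mul p n T (by fun_prop) (by fun_prop), ← cfc_zero ℝ T]
    congr 1; ext x; simp only [p, n, Pi.zero_apply]
    rcases le_total x 0 with hx | hx <;> simp [hx]
  have hsym : ∀ q : ℝ → ℝ, ∀ x y, inner ℂ (cfc q T x) y = inner ℂ x (cfc q T y) := fun q x y =>
    (ContinuousLinearMap.isSelfAdjoint_iff_isSymmetric.mp (cfc_predicate q T)) x y
  have hNin : ∀ x, inner ℂ x (N x) = ((‖R x‖ ^ 2 : ℝ) : ℂ) := fun x => by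
    rw [← hRR, mul_apply_eq_comp, ← hsym r x (R x), ← hR, inner_self_eq_norm_sq_to_K]
    simp
  have hPin : ∀ x, inner ℂ x (P x) = ((‖S x‖ ^ 2 : ℝ) : ℂ) := fun x => by
    rw [← hSS, mul_apply_eq_comp, ← hsym s x (S x), ← hS, inner_self_eq_norm_sq_to_K]
    simp
  have hker : ∀ x, R x = 0 → N x = 0 := fun x hx => by
    rw [← hRR, mul_apply_eq_comp, hx, map_zero]
  have hNN : ∀ x, N (N x) = 0 → N x = 0 := fun x hx => by
    have := hsym n x (N x)
    rw [← hN, hx, inner_zero_right] at this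
    exact inner_self_eq_zero.mp this
  have hTN : ∀ x, T (N x) = - N (N x) := fun x => by
    have := congrArg (fun A : H →L[ℂ] H => A x) hPN
    simp only [mul_apply_eq_comp, zero_apply] at this
    rw [hTPN, sub_apply, this, zero_sub]
  have hzero : ∀ x, inner ℂ ψ (N x) = 0 → N x = 0 := fun x hx => by
    have h1 := hψ _ hx
    rw [hTN, inner_neg_right, hNin] at h1
    rw [Complex.neg_re, Complex.ofReal_re] at h1
    have h2 : ‖R (N x)‖ = 0 := by
      have := sq_nonneg ‖R (N x)‖
      exact pow_eq_zero_iff two_ne_zero |>.mp (by linarith)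
    exact hNN x (hker _ (norm_eq_zero.mp h2))
  obtain ⟨g0, hg0⟩ : ∃ g0, N g0 ≠ 0 := by
    by_contra! hc
    have : T h = P h := by rw [hTPN, sub_apply, hc, sub_zero]
    rw [this, hPin, Complex.ofReal_re] at hh
    exact absurd hh (not_lt.mpr (sq_nonneg _))
  set v := N g0 with hv
  have hψv : inner ℂ ψ v ≠ 0 := fun h0 => hg0 (hzero g0 h0)
  have hspan : ∀ x, N x = (inner ℂ ψ (N x) / inner ℂ ψ v) • v := fun x => by
    have := hzero (x - (inner ℂ ψ (N x) / inner ℂ ψ v) • g0) (by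
      rw [map_sub, map_smul, inner_sub_right, inner_smul_right, div_mul_cancel₀ _ hψv, sub_self])
    rwa [map_sub, map_smul, sub_eq_zero] at this
  have hvv : 0 < ‖v‖ := norm_pos_iff.mpr hg0
  obtain ⟨μ, hμ, hNv⟩ : ∃ μ : ℝ, 0 < μ ∧ N v = (μ : ℂ) • v := by
    set m := inner ℂ ψ (N v) / inner ℂ ψ v with hm
    have h1 : N v = m • v := hspan v
    have h2 := hNin v
    rw [h1, inner_smul_right, inner_self_eq_norm_sq_to_K] at h2
    have h3 : m = ((‖R v‖ ^ 2 / ‖v‖ ^ 2 : ℝ) : ℂ) := by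
      push_cast at h2 ⊢
      rw [eq_div_iff (by exact_mod_cast (pow_pos hvv 2).ne')]
      simpa using h2
    refine ⟨‖R v‖ ^ 2 / ‖v‖ ^ 2, ?_, h3 ▸ h1⟩
    have : 0 < ‖R v‖ := norm_pos_iff.mpr fun h0 => hg0 (hNN g0 (hker _ h0))
    positivity
  have hTv : T v = ((-μ : ℝ) : ℂ) • v := by
    rw [hTN, ← hv, hNv]; simp
  have hquad : ∀ x ∈ spectrum ℝ T, n x * n x = μ * n x := by
    have h1 : cfc (fun x => n x * n x) T = cfc (fun x => μ * n x) T := by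
      rw [cfc_mul n n T (by fun_prop) (by fun_prop), cfc_const_mul μ n T (by fun_prop)]
      ext x
      rw [mul_apply_eq_comp, smul_apply, ← hN, hspan x, map_smul,
        hNv, smul_comm]
      simp
    exact (cfc_eq_cfc_iff_eqOn (R := ℝ) (a := T)).mp h1
  refine ⟨-μ, by linarith, ?_, v, hg0, fun f => ⟨fun hf => ?_, ?_⟩⟩
  · ext z
    simp only [Set.mem_inter_iff, Set.mem_ofPred_eq, Set.mem_singleton_iff]
    constructor
    · rintro ⟨hz, him, hre⟩
      have hzr : z = (z.re : ℂ) := by apply Complex.ext <;> simp [him]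
      have hz' : z.re ∈ spectrum ℝ T := by
        rw [hzr] at hz
        exact (spectrum.algebraMap_mem_iff ℂ).mp hz
      have h1 := hquad _ hz'
      have h2 : n z.re = - z.re := by simp [n, hre.le]
      rw [h2] at h1
      have h3 : -z.re = μ := mul_right_cancel₀ (by linarith) h1
      rw [hzr, ← h3]; simp
    · rintro rfl
      refine ⟨?_, by simp, by simpa using hμ⟩
      intro hu
      rw [spectrum.mem_resolventSet_iff] at hu
      obtain ⟨B, hB⟩ := hu.exists_left_inv
      have := congrArg (fun A : H →L[ℂ] H => A v) hB
      simp only [mul_apply_eq_comp, sub_apply, hTv] at this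
      rw [Algebra.algebraMap_eq_smul_one] at this
      simp at this
      exact hg0 this.symm
  · have h1 : P f = N f - (μ : ℂ) • f := by
      have : T f = P f - N f := by rw [hTPN]; rfl
      rw [sub_eq_iff_eq_add.mp this.symm, hf, Complex.ofReal_neg, neg_smul]; abel
    have h2 : P (P f) = -((μ : ℂ) • P f) := by
      conv_lhs => rw [h1]
      have := congrArg (fun A : H →L[ℂ] H => A f) hPN
      simp only [mul_apply_eq_comp, zero_apply] at this
      rw [map_sub, map_smul, this, zero_sub]
    have h3 := hsym p f (P f)
    rw [← hP, h2, inner_neg_right, inner_smul_right, hPin, inner_self_eq_norm_sq_to_K] at h3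
    have h4 : ‖P f‖ ^ 2 = -(μ * ‖S f‖ ^ 2) := by
      have := congrArg Complex.re h3
      norm_cast at this
    have h5 : P f = 0 := by
      have : 0 ≤ μ * ‖S f‖ ^ 2 := by positivity
      rw [← norm_eq_zero]
      exact pow_eq_zero_iff two_ne_zero |>.mp (le_antisymm (by linarith) (sq_nonneg _))
    rw [h5] at h1
    have h6 := (sub_eq_zero.mp h1.symm).symm
    have hμ' : (μ : ℂ) ≠ 0 := by exact_mod_cast hμ.ne'
    refine ⟨(μ : ℂ)⁻¹ * (inner ℂ ψ (N f) / inner ℂ ψ v), ?_⟩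
    rw [mul_smul, ← hspan, ← h6, smul_smul, inv_mul_cancel₀ hμ', one_smul]
  · rintro ⟨a, rfl⟩
    rw [map_smul, hTv, smul_comm]

theorem two_mul_mul_le_sq_mul_div_add {a b p q : ENNReal} (hp : p ≠ 0) (hp' : p ≠ ⊤) (hq : q ≠ 0)
    (hq' : q ≠ ⊤) : 2 * (a * b) ≤ a ^ 2 * (q / p) + b ^ 2 * (p / q) := by
  have h1 : q / p ≠ 0 := ENNReal.div_ne_zero.mpr ⟨hq, hp'⟩
  have h2 : p / q ≠ 0 := ENNReal.div_ne_zero.mpr ⟨hp, hq'⟩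
  by_cases ha : a = ⊤
  · simp [ha, ENNReal.top_mul h1]
  by_cases hb : b = ⊤
  · simp [hb, ENNReal.top_mul h2]
  lift a to NNReal using ha
  lift b to NNReal using hb
  lift p to NNReal using hp'
  lift q to NNReal using hq'
  have hp0 : p ≠ 0 := by exact_mod_cast hp
  have hq0 : q ≠ 0 := by exact_mod_cast hq
  rw [← ENNReal.coe_div hp0, ← ENNReal.coe_div hq0]
  norm_cast
  rw [← NNReal.coe_le_coe]
  push_cast
  have hp1 : (0 : ℝ) < p := by positivity
  have hq1 : (0 : ℝ) < q := by positivity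
  have : (a : ℝ) ^ 2 * (q / p) + b ^ 2 * (p / q) - 2 * (a * b) = (a * q - b * p) ^ 2 / (p * q) := by
    field_simp
    ring
  have h3 : (0 : ℝ) ≤ (a * q - b * p) ^ 2 / (p * q) := by positivity
  linarith

/-- Schur's test for a symmetric kernel with a positive function `h` satisfying `G h = b h`. -/
theorem lintegral_lintegral_mul_le_of_schur {α : Type*} [MeasurableSpace α] {μ : Measure α}
    [SFinite μ] {G : α → α → ENNReal} (hG : Measurable (Function.uncurry G))
    (hsymm : ∀ x y, G x y = G y x) {h b F : α → ENNReal} (hh : Measurable h) (hF : AEMeasurable F μ)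
    (h0 : ∀ᵐ x ∂μ, h x ≠ 0) (htop : ∀ x, h x ≠ ⊤)
    (hb : ∀ x, ∫⁻ y, G x y * h y ∂μ = b x * h x) :
    ∫⁻ x, ∫⁻ y, G x y * (F x * F y) ∂μ ∂μ ≤ ∫⁻ x, b x * F x ^ 2 ∂μ := by
  wlog hFm : Measurable F generalizing F
  · have h1 := this hF.measurable_mk.aemeasurable hF.measurable_mk
    have h2 : ∫⁻ x, b x * F x ^ 2 ∂μ = ∫⁻ x, b x * hF.mk F x ^ 2 ∂μ :=
      lintegral_congr_ae (by filter_upwards [hF.ae_eq_mk] with x hx using by rw [hx])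
    rw [h2]
    refine le_trans (le_of_eq (lintegral_congr_ae ?_)) h1
    filter_upwards [hF.ae_eq_mk] with x hx
    refine lintegral_congr_ae ?_
    filter_upwards [hF.ae_eq_mk] with y hy
    rw [hx, hy]
  set A : α → α → ENNReal := fun x y => G x y * (F x ^ 2 * (h y / h x)) with hA
  have hAm : Measurable (Function.uncurry A) :=
    hG.mul (((hFm.comp measurable_fst).pow_const 2).mul
      ((hh.comp measurable_snd).div (hh.comp measurable_fst)))
  have hrow : ∫⁻ x, ∫⁻ y, A x y ∂μ ∂μ = ∫⁻ x, b x * F x ^ 2 ∂μ := by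
    refine lintegral_congr_ae ?_
    filter_upwards [h0] with x hx
    have : ∀ y, A x y = (F x ^ 2 / h x) * (G x y * h y) := fun y => by
      simp only [hA, div_eq_mul_inv]; ring
    simp only [this]
    rw [lintegral_const_mul _ (hG.of_uncurry_left.fun_mul hh), hb, div_eq_mul_inv]
    calc F x ^ 2 * (h x)⁻¹ * (b x * h x) = b x * F x ^ 2 * ((h x)⁻¹ * h x) := by ring
      _ = _ := by rw [ENNReal.inv_mul_cancel hx (htop x), mul_one]
  have hcol : ∫⁻ x, ∫⁻ y, A y x ∂μ ∂μ = ∫⁻ x, b x * F x ^ 2 ∂μ := by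
    rw [← hrow, lintegral_lintegral_swap hAm.aemeasurable]
  have hle : ∫⁻ x, ∫⁻ y, 2 * (G x y * (F x * F y)) ∂μ ∂μ
      ≤ ∫⁻ x, ∫⁻ y, (A x y + A y x) ∂μ ∂μ := by
    refine lintegral_mono_ae ?_
    filter_upwards [h0] with x hx
    refine lintegral_mono_ae ?_
    filter_upwards [h0] with y hy
    simp only [hA, hsymm y x, ← mul_add]
    calc 2 * (G x y * (F x * F y)) = G x y * (2 * (F x * F y)) := by ring
      _ ≤ _ := by
        gcongr
        exact two_mul_mul_le_sq_mul_div_add hx (htop x) hy (htop y)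
  have hm : ∀ x, Measurable fun y => G x y * (F x * F y) := fun x =>
    hG.of_uncurry_left.mul (hFm.const_mul _)
  have hsum : ∫⁻ x, ∫⁻ y, (A x y + A y x) ∂μ ∂μ = 2 * ∫⁻ x, b x * F x ^ 2 ∂μ := by
    have : ∀ x, ∫⁻ y, (A x y + A y x) ∂μ = ∫⁻ y, A x y ∂μ + ∫⁻ y, A y x ∂μ := fun x =>
      lintegral_add_left hAm.of_uncurry_left _
    simp only [this]
    rw [lintegral_add_left (f := fun x => ∫⁻ y, A x y ∂μ) hAm.lintegral_prod_right', hrow, hcol, two_mul]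
  have hmm : Measurable fun x => ∫⁻ y, G x y * (F x * F y) ∂μ :=
    Measurable.lintegral_prod_right' (f := fun z : α × α => G z.1 z.2 * (F z.1 * F z.2))
      (hG.mul ((hFm.comp measurable_fst).mul (hFm.comp measurable_snd)))
  simp only [lintegral_const_mul 2 (hm _)] at hle
  rw [lintegral_const_mul 2 hmm, hsum] at hle
  exact (ENNReal.mul_le_mul_iff_right two_ne_zero ENNReal.ofNat_ne_top).mp hle

theorem exp_two_abs_sub_le (x s : ℝ) :
    Real.exp (-2 * |x|) * Real.exp (-2 * |s|) ≤ Real.exp (-2 * |x - s|) := by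
  rw [← Real.exp_add, Real.exp_le_exp]
  linarith [abs_sub x s]

theorem integral_exp_two_abs_sub_mul {g : ℝ → ℝ} (hg : Integrable g) (x : ℝ) :
    ∫ s, Real.exp (-2 * |x - s|) * g s
      = Real.exp (-2 * x) * (∫ s in Set.Iic x, Real.exp (2 * s) * g s)
        + Real.exp (2 * x) * (∫ s in Set.Ioi x, Real.exp (-2 * s) * g s) := by
  have h_int : Integrable fun s => Real.exp (-2 * |x - s|) * g s := by
    refine hg.bdd_mul (c := 1) (by fun_prop) (ae_of_all _ fun s => ?_)
    rw [Real.norm_of_nonneg (Real.exp_pos _).le, Real.exp_le_one_iff]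
    linarith [abs_nonneg (x - s)]
  rw [← integral_add_compl (measurableSet_Iic (a := x)) h_int, Set.compl_Iic,
    ← integral_const_mul, ← integral_const_mul]
  congr 1
  · refine setIntegral_congr_fun measurableSet_Iic fun s hs => ?_
    have : 0 ≤ x - s := sub_nonneg.mpr hs
    simp only [abs_of_nonneg this]
    rw [← mul_assoc, ← Real.exp_add]; ring_nf
  · refine setIntegral_congr_fun measurableSet_Ioi fun s hs => ?_
    have : x - s ≤ 0 := sub_nonpos.mpr (le_of_lt hs)
    simp only [abs_of_nonpos this]
    rw [← mul_assoc, ← Real.exp_add]; ring_nf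

/-- `(4 - ∂²)⁻¹ g = U` when `4 U - U'' = g`, with `U` and `U'` bounded. -/
theorem integral_exp_two_abs_sub_mul_eq {g U Q Q' : ℝ → ℝ} {C D : ℝ} (hg : Integrable g)
    (hU : ∀ x, HasDerivAt U (Q x) x) (hQ : ∀ x, HasDerivAt Q (Q' x) x)
    (hgU : ∀ x, 4 * U x - Q' x = g x) (hUb : ∀ x, |U x| ≤ C) (hQb : ∀ x, |Q x| ≤ D) (x : ℝ) :
    ∫ s, Real.exp (-2 * |x - s|) * g s = 4 * U x := by
  have hbd : ∀ σ : ℝ, IsBoundedUnder (· ≤ ·) (⊤ : Filter ℝ) (norm ∘ fun s => 2 * U s + σ * Q s) :=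
    fun σ => isBoundedUnder_of ⟨2 * C + |σ| * D, fun s => by
      simp only [Function.comp, Real.norm_eq_abs]
      refine (abs_add_le _ _).trans ?_
      rw [abs_mul, abs_mul, abs_two]
      gcongr
      exacts [hUb s, hQb s]⟩
  have hL : ∫ s in Set.Iic x, Real.exp (2 * s) * g s = Real.exp (2 * x) * (2 * U x - Q x) := by
    have hd : ∀ s ∈ Set.Iic x, HasDerivAt (fun s => Real.exp (2 * s) * (2 * U s + (-1) * Q s))
        (Real.exp (2 * s) * g s) s := fun s _ => by
      have h1 := (((hasDerivAt_id s).const_mul 2).exp).mul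
        (((hU s).const_mul 2).fun_add ((hQ s).const_mul (-1)))
      refine h1.congr_deriv ?_
      simp only [id, ← hgU]; ring
    have ht : Tendsto (fun s => Real.exp (2 * s) * (2 * U s + (-1) * Q s)) atBot (nhds 0) :=
      Tendsto.zero_mul_isBoundedUnder_le
        (Real.tendsto_exp_atBot.comp (tendsto_id.const_mul_atBot two_pos)) ((hbd (-1)).mono le_top)
    rw [integral_Iic_of_hasDerivAt_of_tendsto' hd ?_ ht]
    · ring
    · refine hg.integrableOn.bdd_mul (c := Real.exp (2 * x)) (by fun_prop) ?_
      filter_upwards [ae_restrict_mem measurableSet_Iic] with s hs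
      rw [Real.norm_of_nonneg (Real.exp_pos _).le, Real.exp_le_exp]
      linarith [Set.mem_Iic.mp hs]
  have hR : ∫ s in Set.Ioi x, Real.exp (-2 * s) * g s = Real.exp (-2 * x) * (2 * U x + Q x) := by
    have hd : ∀ s ∈ Set.Ici x, HasDerivAt (fun s => -(Real.exp (-2 * s) * (2 * U s + 1 * Q s)))
        (Real.exp (-2 * s) * g s) s := fun s _ => by
      have h1 := ((((hasDerivAt_id s).const_mul (-2)).exp).mul
        (((hU s).const_mul 2).fun_add ((hQ s).const_mul 1))).neg
      refine h1.congr_deriv ?_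
      simp only [id, ← hgU]; ring
    have ht : Tendsto (fun s => -(Real.exp (-2 * s) * (2 * U s + 1 * Q s))) atTop (nhds 0) := by
      rw [← neg_zero]
      refine (Tendsto.zero_mul_isBoundedUnder_le
        (Real.tendsto_exp_atBot.comp (tendsto_id.const_mul_atTop_of_neg (by norm_num)))
        ((hbd 1).mono le_top)).neg
    rw [integral_Ioi_of_hasDerivAt_of_tendsto' hd ?_ ht]
    · ring
    · refine hg.integrableOn.bdd_mul (c := Real.exp (-2 * x)) (by fun_prop) ?_
      filter_upwards [ae_restrict_mem measurableSet_Ioi] with s hs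
      rw [Real.norm_of_nonneg (Real.exp_pos _).le, Real.exp_le_exp]
      linarith [Set.mem_Ioi.mp hs]
  rw [integral_exp_two_abs_sub_mul hg, hL, hR, ← mul_assoc, ← mul_assoc, ← Real.exp_add,
    ← Real.exp_add]
  ring_nf
  simp

/-- Facts about `|φ'|` for a solitary wave profile `φ`: it spans the kernel of the Dirichlet
version of the linearized operator. -/
theorem abs_deriv_profile {c k : ℝ} (hk : 0 < k) (hck : 2 * k < c)
    {φ : ℝ → ℝ} (hφ : ContDiff ℝ 2 φ)
    (hode : ∀ ξ : ℝ, (c - φ ξ) * deriv (deriv φ) ξ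
        = (c - 2 * k) * φ ξ - 2 * (φ ξ) ^ 2 + (deriv φ ξ) ^ 2)
    (heven : ∀ ξ : ℝ, φ (-ξ) = φ ξ)
    (hbd : ∀ ξ : ℝ, 0 < φ ξ ∧ φ ξ < c)
    (hmono : StrictMonoOn φ (Set.Iic 0))
    (htop : Tendsto φ atTop (nhds 0)) :
    Integrable (fun ξ => |deriv φ ξ|) ∧ (∃ C, ∀ ξ, |deriv φ ξ| ≤ C) ∧ (∀ᵐ ξ, 0 < |deriv φ ξ|) ∧
    ∀ ξ, ∫ s, (Real.exp (-2 * |ξ - s|) - Real.exp (-2 * |ξ|) * Real.exp (-2 * |s|)) * |deriv φ s|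
      = 4 / (3 * c + 2 * k) * (c - φ ξ) * |deriv φ ξ| := by
  have hd : ∀ x, HasDerivAt φ (deriv φ x) x := fun x =>
    (hφ.differentiable (by norm_num) x).hasDerivAt
  have hd2 : ∀ x, HasDerivAt (deriv φ) (deriv (deriv φ) x) x := fun x => by
    have : ContDiff ℝ 1 (deriv φ) := ContDiff.deriv' (n := 1) hφ
    exact (this.differentiable (by norm_num) x).hasDerivAt
  set P : ℝ → ℝ := fun x => c * φ x - φ x ^ 2 / 2 with hP
  set U : ℝ → ℝ := fun x => (c - φ x) * deriv φ x with hU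
  set Q : ℝ → ℝ := fun x => (c - 2 * k) * φ x - 2 * φ x ^ 2 with hQ
  set Q' : ℝ → ℝ := fun x => (c - 2 * k) * deriv φ x - 4 * φ x * deriv φ x with hQ'
  have hPd : ∀ x, HasDerivAt P (U x) x := fun x => by
    refine (((hd x).const_mul c).fun_sub (((hd x).fun_pow 2).div_const 2)).congr_deriv ?_
    simp only [hU]; push_cast; ring
  have hUd : ∀ x, HasDerivAt U (Q x) x := fun x => by
    refine (((hd x).const_sub c).fun_mul (hd2 x)).congr_deriv ?_
    rw [hode]; simp only [hQ]; ring
  have hQd : ∀ x, HasDerivAt Q (Q' x) x := fun x => by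
    refine (((hd x).const_mul (c - 2 * k)).fun_sub (((hd x).fun_pow 2).const_mul 2)).congr_deriv ?_
    simp only [hQ']; push_cast; ring
  have hodd : ∀ x, deriv φ (-x) = -deriv φ x := fun x => by
    have h1 := deriv_comp_neg φ x
    simp only [heven] at h1
    linarith
  have hpos : ∀ x ≤ 0, 0 ≤ deriv φ x := fun x hx => by
    rw [← (hd x).hasDerivWithinAt.derivWithin (uniqueDiffOn_Iic 0 x hx)]
    exact hmono.monotoneOn.derivWithin_nonneg
  have hneg : ∀ x, 0 ≤ x → deriv φ x ≤ 0 := fun x hx => by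
    have := hpos (-x) (by linarith)
    rw [hodd] at this; linarith
  have h_int : Integrable (deriv φ) := by
    rw [← integrableOn_univ, ← Set.Iic_union_Ioi (a := (0 : ℝ)), integrableOn_union]
    have h1 : IntegrableOn (deriv φ) (Set.Ioi 0) :=
      integrableOn_Ioi_deriv_of_nonpos' (fun x _ => hd x) (fun x hx => hneg x (le_of_lt hx)) htop
    refine ⟨?_, h1⟩
    rw [integrableOn_Iic_iff_integrableOn_Iio]
    have h2 := h1.comp_neg
    simp only [hodd, Set.neg_Ioi, neg_zero] at h2
    exact (integrable_neg_iff.mp h2)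
  have hφ0 : ∀ x, φ x ≤ φ 0 := fun x => by
    rcases le_total x 0 with hx | hx
    · exact hmono.monotoneOn hx Set.self_mem_Iic hx
    · rw [← heven x]
      exact hmono.monotoneOn (Set.mem_Iic.mpr (by linarith)) Set.self_mem_Iic (by linarith)
  have hQb : ∀ x, |Q x| ≤ 3 * c ^ 2 := fun x => by
    obtain ⟨h1, h2⟩ := hbd x
    rw [abs_le]; constructor <;> simp only [hQ] <;> nlinarith
  have hPb : ∀ x, 0 ≤ P x ∧ P x ≤ c ^ 2 := fun x => by
    obtain ⟨h1, h2⟩ := hbd x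
    constructor <;> simp only [hP] <;> nlinarith
  have hUb : ∀ x, |U x| ≤ 4 * c ^ 2 := fun x => by
    obtain ⟨t, ht, hte⟩ := exists_hasDerivAt_eq_slope P U (show x < x + 1 by linarith)
      (fun y _ => (hPd y).continuousAt.continuousWithinAt) (fun y _ => hPd y)
    obtain ⟨r, hr, hre⟩ := exists_hasDerivAt_eq_slope U Q ht.1
      (fun y _ => (hUd y).continuousAt.continuousWithinAt) (fun y _ => hUd y)
    have h1 := hPb x
    have h2 := hPb (x + 1)
    have h3 := abs_le.mp (hQb r)
    rw [eq_div_iff (by linarith [ht.1])] at hre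
    rw [add_sub_cancel_left, div_one] at hte
    have h4 : 0 < t - x := by linarith [ht.1]
    have h5 : t - x < 1 := by linarith [ht.2]
    rw [abs_le]; constructor <;> nlinarith
  have hγ : 0 < 3 * c + 2 * k := by linarith
  have hker : ∀ ξ, ∫ s, Real.exp (-2 * |ξ - s|) * deriv φ s = 4 / (3 * c + 2 * k) * U ξ := by
    intro ξ
    have h1 := integral_exp_two_abs_sub_mul_eq (h_int.const_mul (3 * c + 2 * k)) hUd hQd
      (fun x => by simp only [hU, hQ']; ring) hUb hQb ξ
    simp only [mul_left_comm _ (3 * c + 2 * k)] at h1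
    rw [integral_const_mul] at h1
    rw [div_mul_eq_mul_div, eq_div_iff hγ.ne', ← h1, mul_comm]
  refine ⟨h_int.abs, ⟨4 * c ^ 2 / (c - φ 0), fun x => ?_⟩, ?_, fun ξ => ?_⟩
  · have h0 : 0 < c - φ 0 := by linarith [(hbd 0).2]
    rw [le_div_iff₀ h0]
    refine le_trans ?_ (hUb x)
    simp only [hU]
    have h1 : 0 < c - φ x := by linarith [(hbd x).2]
    rw [abs_mul, abs_of_pos h1, mul_comm]
    exact mul_le_mul_of_nonneg_right (by linarith [hφ0 x]) (abs_nonneg _)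
  · have hcrit : ∀ x < 0, deriv φ x = 0 → φ x = (c - 2 * k) / 2 := fun x hx hx0 => by
      have hmin : IsLocalMin U x := by
        filter_upwards [Iio_mem_nhds hx] with y hy
        simp only [hU, hx0, mul_zero]
        exact mul_nonneg (by linarith [(hbd y).2]) (hpos y (le_of_lt hy))
      have h1 := hmin.hasDerivAt_eq_zero (hUd x)
      have h2 : φ x * ((c - 2 * k) - 2 * φ x) = 0 := by rw [← h1]; ring
      have := (mul_eq_zero.mp h2).resolve_left (hbd x).1.ne'
      linarith
    have hsub : {x | x < 0 ∧ deriv φ x = 0}.Subsingleton := fun x hx y hy =>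
      hmono.injOn (le_of_lt hx.1) (le_of_lt hy.1) (by rw [hcrit x hx.1 hx.2, hcrit y hy.1 hy.2])
    have hsub' : {x | x < 0 ∧ deriv φ x = 0}.Finite := hsub.finite
    have hfin : ({x | x < 0 ∧ deriv φ x = 0} ∪ {0} ∪
        (fun x => -x) '' {x | x < 0 ∧ deriv φ x = 0}).Finite :=
      (hsub'.union (Set.finite_singleton 0)).union (hsub'.image _)
    filter_upwards [measure_eq_zero_iff_ae_notMem.mp (hfin.measure_zero volume)] with x hx
    rw [abs_pos]
    intro hx0
    apply hx
    rcases lt_trichotomy x 0 with h | h | h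
    · exact Or.inl (Or.inl ⟨h, hx0⟩)
    · exact Or.inl (Or.inr h)
    · exact Or.inr ⟨-x, ⟨by linarith, by rw [hodd, hx0, neg_zero]⟩, neg_neg x⟩
  · have hU0 : U 0 = 0 := by
      have := hodd 0
      rw [neg_zero] at this
      have h0 : deriv φ 0 = 0 := by linarith
      simp [hU, h0]
    have hI : ∀ x, Integrable fun s => Real.exp (-2 * |x - s|) * deriv φ s := fun x => by
      refine h_int.bdd_mul (c := 1) (by fun_prop) (ae_of_all _ fun s => ?_)
      rw [Real.norm_of_nonneg (Real.exp_pos _).le, Real.exp_le_one_iff]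
      linarith [abs_nonneg (x - s)]
    have h0 : ∫ s, Real.exp (-2 * |s|) * deriv φ s = 0 := by
      have := hker 0
      simpa [hU0] using this
    have hI0 : Integrable fun s => Real.exp (-2 * |s|) * deriv φ s := by simpa using hI 0
    have hG : ∫ s, (Real.exp (-2 * |ξ - s|) - Real.exp (-2 * |ξ|) * Real.exp (-2 * |s|))
        * deriv φ s = 4 / (3 * c + 2 * k) * U ξ := by
      simp only [sub_mul, mul_assoc (Real.exp (-2 * |ξ|))]
      rw [integral_sub (hI ξ) (hI0.const_mul _), integral_const_mul, h0, hker]; ring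
    have hopp : ∀ x s : ℝ, x ≤ 0 → 0 ≤ s →
        Real.exp (-2 * |x - s|) - Real.exp (-2 * |x|) * Real.exp (-2 * |s|) = 0 := by
      intro x s hx hs
      rw [abs_of_nonpos (by linarith : x - s ≤ 0), abs_of_nonpos hx, abs_of_nonneg hs,
        ← Real.exp_add]
      ring_nf
    rcases le_total ξ 0 with hξ | hξ
    · rw [abs_of_nonneg (hpos ξ hξ), mul_assoc, ← hG]
      refine integral_congr_ae (ae_of_all _ fun s => ?_)
      rcases le_total s 0 with hs | hs
      · simp only [abs_of_nonneg (hpos s hs)]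
      · simp only [hopp ξ s hξ hs, zero_mul]
    · rw [abs_of_nonpos (hneg ξ hξ), mul_assoc, mul_neg, mul_neg, ← hG, ← integral_neg]
      refine integral_congr_ae (ae_of_all _ fun s => ?_)
      rcases le_total s 0 with hs | hs
      · have := hopp s ξ hs hξ
        rw [abs_sub_comm, mul_comm (Real.exp (-2 * |s|))] at this
        simp only [this, zero_mul, neg_zero]
      · simp only [abs_of_nonpos (hneg s hs), mul_neg]

theorem memLp_two_exp_neg_two_mul_abs_sub (x : ℝ) :
    MemLp (fun s : ℝ => ((Real.exp (-2 * |x - s|) : ℝ) : ℂ)) 2 := by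
  refine MemLp.ofReal (f := fun s : ℝ => Real.exp (-2 * |x - s|)) ?_
  rw [memLp_two_iff_integrable_sq (by fun_prop)]
  have h : Integrable fun s : ℝ => Real.exp (-4 * |s|) := by
    refine Integrable.of_integral_ne_zero ?_
    rw [integral_comp_abs (f := fun s => Real.exp (-4 * s)),
      integral_exp_mul_Ioi (by norm_num)]
    norm_num
  refine (h.comp_sub_left x).congr (ae_of_all _ fun s => ?_)
  simp only [← Real.exp_nat_mul]
  push_cast; ring_nf

/-- The form of `w - γ (4 - ∂²)⁻¹` is nonnegative on functions orthogonal to `e^{-2|s|}`, provided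
the Dirichlet Green kernel has a positive solution `h` of `γ G h = w h`. -/
theorem re_inner_nonneg_of_schur {w h : ℝ → ℝ} {γ M : ℝ} (hγ : 0 < γ) (hw : Measurable w)
    (hw0 : ∀ x, 0 ≤ w x) (hwM : ∀ x, w x ≤ M) (hh : Measurable h) (hh0 : ∀ x, 0 ≤ h x)
    (hhint : Integrable h) (hhpos : ∀ᵐ x, 0 < h x)
    (hGh : ∀ x, ∫ s, (Real.exp (-2 * |x - s|) - Real.exp (-2 * |x|) * Real.exp (-2 * |s|)) * h s
      = 4 / γ * w x * h x)
    (f Tf : Lp ℂ 2 (volume : Measure ℝ))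
    (hT : ∀ᵐ x : ℝ, Tf x = ((w x : ℝ) : ℂ) * f x
        - ((γ / 4 : ℝ) : ℂ) * ∫ s : ℝ, ((Real.exp (-2 * |x - s|) : ℝ) : ℂ) * f s)
    (hf : ∫ s : ℝ, ((Real.exp (-2 * |s|) : ℝ) : ℂ) * f s = 0) :
    0 ≤ (inner ℂ f Tf).re := by
  set g : ℝ → ℝ → ℝ := fun x s =>
    Real.exp (-2 * |x - s|) - Real.exp (-2 * |x|) * Real.exp (-2 * |s|) with hg
  have hg0 : ∀ x s, 0 ≤ g x s := fun x s => sub_nonneg.mpr (exp_two_abs_sub_le x s)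
  have hg1 : ∀ x s, g x s ≤ 1 := fun x s => by
    have h1 : Real.exp (-2 * |x - s|) ≤ 1 :=
      Real.exp_le_one_iff.mpr (by linarith [abs_nonneg (x - s)])
    have h2 : 0 < Real.exp (-2 * |x|) * Real.exp (-2 * |s|) := by positivity
    simp only [hg]; linarith
  have hgm : Measurable (Function.uncurry g) := by
    refine Continuous.measurable ?_
    simp only [hg, Function.uncurry_def]
    fun_prop
  set F : ℝ → ENNReal := fun x => ‖f x‖ₑ with hF
  have hFm : AEMeasurable F := (Lp.aestronglyMeasurable f).enorm
  have hschur : ∫⁻ x, ∫⁻ y, ENNReal.ofReal (g x y) * (F x * F y)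
      ≤ ∫⁻ x, ENNReal.ofReal (4 / γ * w x) * F x ^ 2 := by
    refine lintegral_lintegral_mul_le_of_schur (h := fun x => ENNReal.ofReal (h x))
      (hgm.ennreal_ofReal) (fun x y => ?_) hh.ennreal_ofReal hFm ?_ (fun _ => ENNReal.ofReal_ne_top)
      (fun x => ?_)
    · simp only [hg]; rw [abs_sub_comm, mul_comm (Real.exp (-2 * |x|))]
    · filter_upwards [hhpos] with x hx
      exact (ENNReal.ofReal_pos.mpr hx).ne'
    · have hγw : 0 ≤ 4 / γ * w x := mul_nonneg (by positivity) (hw0 x)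
      simp only [← ENNReal.ofReal_mul (hg0 x _)]
      rw [← ENNReal.ofReal_mul hγw, ← hGh x, ofReal_integral_eq_lintegral_ofReal]
      · refine hhint.bdd_mul (c := 1) hgm.of_uncurry_left.aestronglyMeasurable
          (ae_of_all _ fun s => ?_)
        rw [Real.norm_of_nonneg (hg0 x s)]; exact hg1 x s
      · exact ae_of_all _ fun s => mul_nonneg (hg0 x s) (hh0 s)
  have hfL : MemLp (fun x => f x) 2 := Lp.memLp f
  have hprod : ∀ x, Integrable fun s => ((Real.exp (-2 * |x - s|) : ℝ) : ℂ) * f s := fun x =>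
    (memLp_two_exp_neg_two_mul_abs_sub x).integrable_mul hfL
  have hprod0 : Integrable fun s => ((Real.exp (-2 * |s|) : ℝ) : ℂ) * f s := by
    simpa using hprod 0
  have hKG : ∀ x, ∫ s, ((Real.exp (-2 * |x - s|) : ℝ) : ℂ) * f s = ∫ s, ((g x s : ℝ) : ℂ) * f s :=
    fun x => by
      have : ∀ s, ((g x s : ℝ) : ℂ) * f s = ((Real.exp (-2 * |x - s|) : ℝ) : ℂ) * f s
          - ((Real.exp (-2 * |x|) : ℝ) : ℂ) * (((Real.exp (-2 * |s|) : ℝ) : ℂ) * f s) := fun s => by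
        simp only [hg]; push_cast; ring
      simp only [this]
      rw [integral_sub (hprod x) (hprod0.const_mul _), integral_const_mul, hf, mul_zero, sub_zero]
  have hin : Integrable fun x => inner ℂ (f x) (Tf x) := L2.integrable_inner f Tf
  have hsq : Integrable fun x => w x * ‖f x‖ ^ 2 :=
    (((memLp_two_iff_integrable_sq_norm hfL.1).mp hfL)).bdd_mul (c := M) hw.aestronglyMeasurable
      (ae_of_all _ fun x => by rw [Real.norm_of_nonneg (hw0 x)]; exact hwM x)
  have hsq0 : 0 ≤ ∫ x, w x * ‖f x‖ ^ 2 :=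
    integral_nonneg fun x => mul_nonneg (hw0 x) (sq_nonneg _)
  have hdiff : ∫ x, (((w x * ‖f x‖ ^ 2 : ℝ) : ℂ) - inner ℂ (f x) (Tf x))
      = ((∫ x, w x * ‖f x‖ ^ 2 : ℝ) : ℂ) - inner ℂ f Tf := by
    have hsqC : Integrable fun x => ((w x * ‖f x‖ ^ 2 : ℝ) : ℂ) := hsq.ofReal
    rw [integral_sub hsqC hin, integral_complex_ofReal, L2.inner_def]
  have hbound : ‖∫ x, (((w x * ‖f x‖ ^ 2 : ℝ) : ℂ) - inner ℂ (f x) (Tf x))‖ₑ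
      ≤ ENNReal.ofReal (∫ x, w x * ‖f x‖ ^ 2) := by
    refine (enorm_integral_le_lintegral_enorm _).trans ?_
    calc ∫⁻ x, ‖((w x * ‖f x‖ ^ 2 : ℝ) : ℂ) - inner ℂ (f x) (Tf x)‖ₑ
        ≤ ∫⁻ x, ENNReal.ofReal (γ / 4) * ∫⁻ y, ENNReal.ofReal (g x y) * (F x * F y) := by
          refine lintegral_mono_ae ?_
          filter_upwards [hT] with x hx
          have h1 : ((w x * ‖f x‖ ^ 2 : ℝ) : ℂ) - inner ℂ (f x) (Tf x)
              = ((γ / 4 : ℝ) : ℂ) * (∫ s, ((g x s : ℝ) : ℂ) * f s) * (starRingEnd ℂ) (f x) := by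
            rw [hx, hKG, RCLike.inner_apply]
            have : ((‖f x‖ ^ 2 : ℝ) : ℂ) = f x * (starRingEnd ℂ) (f x) := by
              rw [Complex.mul_conj, Complex.normSq_eq_norm_sq]
            rw [Complex.ofReal_mul, this]; ring
          have h2 : ‖∫ s, ((g x s : ℝ) : ℂ) * f s‖ₑ ≤ ∫⁻ s, ENNReal.ofReal (g x s) * F s := by
            refine (enorm_integral_le_lintegral_enorm _).trans (le_of_eq ?_)
            refine lintegral_congr fun s => ?_
            rw [enorm_mul, ← ofReal_norm ((g x s : ℝ) : ℂ), Complex.norm_real,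
              Real.norm_of_nonneg (hg0 x s)]
          have h3 : ∀ y, ENNReal.ofReal (g x y) * (F x * F y)
              = F x * (ENNReal.ofReal (g x y) * F y) := fun y => by ring
          rw [h1, enorm_mul, enorm_mul, RCLike.enorm_conj, mul_assoc,
            ← ofReal_norm ((γ / 4 : ℝ) : ℂ), Complex.norm_real,
            Real.norm_of_nonneg (by positivity)]
          simp only [h3]
          rw [lintegral_const_mul' _ _ enorm_ne_top, mul_comm ‖∫ s, ((g x s : ℝ) : ℂ) * f s‖ₑ]
          gcongr
      _ = ENNReal.ofReal (γ / 4) * ∫⁻ x, ∫⁻ y, ENNReal.ofReal (g x y) * (F x * F y) :=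
          lintegral_const_mul' _ _ ENNReal.ofReal_ne_top
      _ ≤ ENNReal.ofReal (γ / 4) * ∫⁻ x, ENNReal.ofReal (4 / γ * w x) * F x ^ 2 := by gcongr
      _ = ∫⁻ x, ENNReal.ofReal (w x * ‖f x‖ ^ 2) := by
          rw [← lintegral_const_mul' _ _ ENNReal.ofReal_ne_top]
          refine lintegral_congr fun x => ?_
          simp only [hF]
          rw [← ofReal_norm, ← ENNReal.ofReal_pow (norm_nonneg _), ← mul_assoc,
            ← ENNReal.ofReal_mul (by positivity), ← ENNReal.ofReal_mul
              (mul_nonneg (by positivity) (mul_nonneg (by positivity) (hw0 x)))]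
          congr 1; field_simp
      _ = ENNReal.ofReal (∫ x, w x * ‖f x‖ ^ 2) :=
          (ofReal_integral_eq_lintegral_ofReal hsq
            (ae_of_all _ fun x => mul_nonneg (hw0 x) (sq_nonneg _))).symm
  rw [hdiff, ← ofReal_norm, ENNReal.ofReal_le_ofReal_iff hsq0] at hbound
  have := (Complex.re_le_norm _).trans hbound
  rw [Complex.sub_re, Complex.ofReal_re] at this
  linarith

/-- The form of `w - γ (4 - ∂²)⁻¹` is negative at a positive solution `h` of `γ G h = w h`, with `G`
the Dirichlet Green kernel. -/
theorem re_inner_neg_of_kernel {w h : ℝ → ℝ} {γ : ℝ} (hγ : 0 < γ)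
    (hhint : Integrable h) (hhpos : ∀ᵐ x, 0 < h x)
    (hGh : ∀ x, ∫ s, (Real.exp (-2 * |x - s|) - Real.exp (-2 * |x|) * Real.exp (-2 * |s|)) * h s
      = 4 / γ * w x * h x)
    (f Tf : Lp ℂ 2 (volume : Measure ℝ)) (hfh : ∀ᵐ x : ℝ, f x = ((h x : ℝ) : ℂ))
    (hT : ∀ᵐ x : ℝ, Tf x = ((w x : ℝ) : ℂ) * f x
        - ((γ / 4 : ℝ) : ℂ) * ∫ s : ℝ, ((Real.exp (-2 * |x - s|) : ℝ) : ℂ) * f s) :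
    (inner ℂ f Tf).re < 0 := by
  have hI : ∀ x, Integrable fun s => Real.exp (-2 * |x - s|) * h s := fun x => by
    refine hhint.bdd_mul (c := 1) (by fun_prop) (ae_of_all _ fun s => ?_)
    rw [Real.norm_of_nonneg (Real.exp_pos _).le, Real.exp_le_one_iff]
    linarith [abs_nonneg (x - s)]
  have hI0 : Integrable fun s => Real.exp (-2 * |s|) * h s := by simpa using hI 0
  set I := ∫ s, Real.exp (-2 * |s|) * h s with hIdef
  have hIpos : 0 < I := by
    have h0 : ∀ᵐ s, 0 < Real.exp (-2 * |s|) * h s := by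
      filter_upwards [hhpos] with s hs
      positivity
    refine lt_of_le_of_ne (integral_nonneg_of_ae (h0.mono fun s hs => hs.le)) fun h1 => ?_
    rw [hIdef, eq_comm, integral_eq_zero_iff_of_nonneg_ae (h0.mono fun s hs => hs.le) hI0] at h1
    obtain ⟨s, hs, hs'⟩ := (h0.and h1).exists
    exact hs.ne' hs'
  have hK : ∀ x, ∫ s, Real.exp (-2 * |x - s|) * h s
      = 4 / γ * w x * h x + Real.exp (-2 * |x|) * I := fun x => by
    rw [← hGh x]
    simp only [sub_mul, mul_assoc (Real.exp (-2 * |x|))]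
    rw [integral_sub (hI x) (hI0.const_mul _), integral_const_mul]; ring
  have hin : ∀ᵐ x : ℝ, inner ℂ (f x) (Tf x)
      = ((-(γ / 4) * I * (Real.exp (-2 * |x|) * h x) : ℝ) : ℂ) := by
    filter_upwards [hfh, hT] with x hx hTx
    have h1 : ∫ s : ℝ, ((Real.exp (-2 * |x - s|) : ℝ) : ℂ) * f s
        = ((4 / γ * w x * h x + Real.exp (-2 * |x|) * I : ℝ) : ℂ) := by
      rw [← hK, ← integral_complex_ofReal]
      refine integral_congr_ae ?_
      filter_upwards [hfh] with s hs
      rw [hs]; push_cast; rfl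
    rw [hTx, h1, hx, RCLike.inner_apply, Complex.conj_ofReal]
    norm_cast
    field_simp
    ring
  rw [L2.inner_def, integral_congr_ae hin, integral_complex_ofReal, Complex.ofReal_re,
    integral_const_mul]
  have : 0 < γ / 4 * I * I := by positivity
  linarith

/-- The spectrum of the bounded self-adjoint realization `T` of the linearized
DP operator `L_c` on the negative half-line consists of exactly one point
`λ_*`, which is an eigenvalue with one-dimensional eigenspace. -/
theorem DP_unique_negative_eigenvalue (c k : ℝ) (hk : 0 < k) (hck : 2 * k < c)
    (φ : ℝ → ℝ) (hφ : ContDiff ℝ 2 φ)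
    (hode : ∀ ξ : ℝ, (c - φ ξ) * deriv (deriv φ) ξ
        = (c - 2 * k) * φ ξ - 2 * (φ ξ) ^ 2 + (deriv φ ξ) ^ 2)
    (heven : ∀ ξ : ℝ, φ (-ξ) = φ ξ)
    (hbd : ∀ ξ : ℝ, 0 < φ ξ ∧ φ ξ < c)
    (hmono : StrictMonoOn φ (Set.Iic 0))
    (htop : Tendsto φ atTop (nhds 0)) (hbot : Tendsto φ atBot (nhds 0))
    (T : Lp ℂ 2 (volume : Measure ℝ) →L[ℂ] Lp ℂ 2 (volume : Measure ℝ))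
    (hsa : IsSelfAdjoint T)
    (hT : ∀ f : Lp ℂ 2 (volume : Measure ℝ), ∀ᵐ ξ : ℝ,
      (T f : ℝ → ℂ) ξ = ((c - φ ξ : ℝ) : ℂ) * f ξ
        - (((3 * c + 2 * k) / 4 : ℝ) : ℂ) * ∫ s : ℝ, ((Real.exp (-2 * |ξ - s|) : ℝ) : ℂ) * f s) :
    ∃ lam : ℝ, lam < 0 ∧
      spectrum ℂ T ∩ {z : ℂ | z.im = 0 ∧ z.re < 0} = {(lam : ℂ)} ∧
      ∃ g : Lp ℂ 2 (volume : Measure ℝ), g ≠ 0 ∧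
        ∀ f : Lp ℂ 2 (volume : Measure ℝ), T f = (lam : ℂ) • f ↔ ∃ a : ℂ, f = a • g := by
  obtain ⟨h_int, ⟨C, hC⟩, hpos, hG⟩ := abs_deriv_profile hk hck hφ hode heven hbd hmono htop
  have hγ : 0 < 3 * c + 2 * k := by linarith
  have hcont : Continuous fun ξ => |deriv φ ξ| := (hφ.continuous_deriv (by norm_num)).abs
  have hψ : MemLp (fun s : ℝ => ((Real.exp (-2 * |s|) : ℝ) : ℂ)) 2 := by
    simpa using memLp_two_exp_neg_two_mul_abs_sub 0
  have hh : MemLp (fun ξ => ((|deriv φ ξ| : ℝ) : ℂ)) 2 := by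
    refine MemLp.ofReal (f := fun ξ => |deriv φ ξ|) ?_
    rw [memLp_two_iff_integrable_sq hcont.aestronglyMeasurable]
    simp only [sq]
    refine h_int.bdd_mul (c := C) hcont.aestronglyMeasurable (ae_of_all _ fun ξ => ?_)
    rw [Real.norm_eq_abs, abs_abs]
    exact hC ξ
  refine spectrum_neg_of_nonneg_on_orthogonal T hsa hψ.toLp hh.toLp (fun f hf => ?_) ?_
  · refine re_inner_nonneg_of_schur (w := fun ξ => c - φ ξ) (M := c) hγ
      (continuous_const.sub hφ.continuous).measurable (fun ξ => by linarith [(hbd ξ).2])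
      (fun ξ => by linarith [(hbd ξ).1]) hcont.measurable (fun ξ => abs_nonneg _) h_int hpos hG
      f (T f) (hT f) ?_
    rw [← hf, L2.inner_def]
    refine integral_congr_ae ?_
    filter_upwards [hψ.coeFn_toLp] with s hs
    rw [hs, RCLike.inner_apply, Complex.conj_ofReal, mul_comm]
  · exact re_inner_neg_of_kernel (w := fun ξ => c - φ ξ) hγ h_int hpos hG _ _ hh.coeFn_toLp (hT _)
end

section
/- Let c, k be real constants with c > 2k > 0, and set φ₋ = c − (2/3)k − √((2/9)k(3c+2k)) and φ₊ = c − (2/3)k + √((2/9)k(3c+2k)). Then (1/(2(3c + 2k)))·∫_{0}^{φ₋} ((3t + 4k)·t·(c − t))/√((t − φ₊)(t − φ₋)) dt = ((c² − ck − (2/3)k²)·√(c² − 2ck))/(2(3c + 2k)) − (k²/9)·log((c − (2/3)k + √(c² − 2ck))/√((2/3)kc + (4/9)k²)). -/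
/-- On `t < a`, the function `-log (a - t + √((t - a) ^ 2 - d))` is an antiderivative of
`1 / √((t - a) ^ 2 - d)`. -/
theorem hasDerivAt_neg_log_sub_add_sqrt {a d t : ℝ} (hta : t < a) (hQ : 0 < (t - a) ^ 2 - d) :
    HasDerivAt (fun t => -Real.log (a - t + √((t - a) ^ 2 - d))) (1 / √((t - a) ^ 2 - d)) t := by
  have hs : 0 < √((t - a) ^ 2 - d) := Real.sqrt_pos.mpr hQ
  have hpos : 0 < a - t + √((t - a) ^ 2 - d) := by linarith
  have h1 : HasDerivAt (fun t => (t - a) ^ 2 - d) (2 * (t - a)) t := by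
    simpa using (((hasDerivAt_id t).sub_const a).pow 2).sub_const d
  have h2 := ((((hasDerivAt_id t).const_sub a).add (h1.sqrt hQ.ne')).log hpos.ne').neg
  refine h2.congr_deriv ?_
  simp only [Pi.add_apply, id]
  field_simp
  ring

/-- The derivative of a quadratic polynomial times the square root of a quadratic polynomial. -/
theorem hasDerivAt_quadratic_mul_sqrt {a d p q r t : ℝ} (hQ : 0 < (t - a) ^ 2 - d) :
    HasDerivAt (fun t => (p * t ^ 2 + q * t + r) * √((t - a) ^ 2 - d))
      (((2 * p * t + q) * ((t - a) ^ 2 - d) + (p * t ^ 2 + q * t + r) * (t - a))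
        / √((t - a) ^ 2 - d)) t := by
  have hs : 0 < √((t - a) ^ 2 - d) := Real.sqrt_pos.mpr hQ
  have hsq := Real.sq_sqrt hQ.le
  have h1 : HasDerivAt (fun t => (t - a) ^ 2 - d) (2 * (t - a)) t := by
    simpa using (((hasDerivAt_id t).sub_const a).pow 2).sub_const d
  have h3 : HasDerivAt (fun t => p * t ^ 2 + q * t + r) (p * (2 * t) + q) t := by
    simpa using ((((hasDerivAt_id t).pow 2).const_mul p).add
      ((hasDerivAt_id t).const_mul q)).add_const r
  refine (h3.mul (h1.sqrt hQ.ne')).congr_deriv ?_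
  set s := √((t - a) ^ 2 - d)
  rw [← hsq]
  field_simp

/-- Explicit evaluation of the integral giving the conserved quantity `S` at
the DP solitary wave of speed `c`. -/
theorem DP_S_explicit_value (c k : ℝ) (hk : 0 < k) (hck : 2 * k < c) :
    let φm : ℝ := c - (2 / 3) * k - Real.sqrt ((2 / 9) * k * (3 * c + 2 * k))
    let φp : ℝ := c - (2 / 3) * k + Real.sqrt ((2 / 9) * k * (3 * c + 2 * k))
    (1 / (2 * (3 * c + 2 * k)))
        * ∫ t in (0 : ℝ)..φm, ((3 * t + 4 * k) * t * (c - t)) / Real.sqrt ((t - φp) * (t - φm))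
      = ((c ^ 2 - c * k - (2 / 3) * k ^ 2) * Real.sqrt (c ^ 2 - 2 * c * k))
          / (2 * (3 * c + 2 * k))
        - (k ^ 2 / 9) * Real.log ((c - (2 / 3) * k + Real.sqrt (c ^ 2 - 2 * c * k))
            / Real.sqrt ((2 / 3) * k * c + (4 / 9) * k ^ 2)) := by
  intro φm φp
  have hc : 0 < c := by linarith
  obtain ⟨d, hd⟩ : ∃ d, d = (2 / 9) * k * (3 * c + 2 * k) := ⟨_, rfl⟩
  obtain ⟨a, ha⟩ : ∃ a, a = c - (2 / 3) * k := ⟨_, rfl⟩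
  have hd0 : 0 < d := by rw [hd]; positivity
  have ha0 : 0 < a := by linarith
  have hb : a ^ 2 - d = c ^ 2 - 2 * c * k := by rw [ha, hd]; ring
  have hb0 : 0 < a ^ 2 - d := by rw [hb]; nlinarith
  have hsd : 0 < √d := Real.sqrt_pos.mpr hd0
  have hsd2 : √d ^ 2 = d := Real.sq_sqrt hd0.le
  have hm : φm = a - √d := by simp only [φm, ha, hd]
  have hp : φp = a + √d := by simp only [φp, ha, hd]
  have hQ : ∀ t, (t - φp) * (t - φm) = (t - a) ^ 2 - d := by
    intro t; rw [hm, hp]; linear_combination -hsd2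
  have hm0 : 0 < φm := by
    rw [hm, sub_pos, Real.sqrt_lt' ha0]; linarith
  have hd' : (2 / 3) * k * c + (4 / 9) * k ^ 2 = d := by rw [hd]; ring
  simp only [hQ]
  rw [hd', ← hb, ← ha]
  set L : ℝ := -(2 * k ^ 2 / 9) * (3 * c + 2 * k) with hL
  set F : ℝ → ℝ := fun t =>
    ((-1) * t ^ 2 + (-c - k / 3) * t + (-c ^ 2 + c * k + 2 / 3 * k ^ 2)) * √((t - a) ^ 2 - d)
      + L * -Real.log (a - t + √((t - a) ^ 2 - d)) with hF
  have hcont : ContinuousOn F (Set.Icc 0 φm) := by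
    refine ContinuousOn.add (by fun_prop) (continuousOn_const.mul (ContinuousOn.neg ?_))
    refine ContinuousOn.log (by fun_prop) fun t ht => ?_
    have := Real.sqrt_nonneg ((t - a) ^ 2 - d)
    have := ht.2
    linarith
  have hderiv : ∀ t ∈ Set.Ioo 0 φm, HasDerivAt F
      (((3 * t + 4 * k) * t * (c - t)) / √((t - a) ^ 2 - d)) t := by
    intro t ht
    have hta : t < a := by linarith [ht.2]
    have hpos : 0 < (t - a) ^ 2 - d := by
      rw [← hQ]
      exact mul_pos_of_neg_of_neg (by linarith [ht.2]) (by linarith [ht.2])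
    refine ((hasDerivAt_quadratic_mul_sqrt hpos).add
      ((hasDerivAt_neg_log_sub_add_sqrt hta hpos).const_mul L)).congr_deriv ?_
    rw [mul_one_div, ← add_div]
    congr 1
    rw [hL, ha, hd]
    ring
  have hint : IntervalIntegrable
      (fun t => ((3 * t + 4 * k) * t * (c - t)) / √((t - a) ^ 2 - d))
      MeasureTheory.volume 0 φm := by
    refine intervalIntegral.intervalIntegrable_deriv_of_nonneg (g := F) ?_ ?_ ?_
    · rwa [Set.uIcc_of_le hm0.le]
    · simpa [hm0.le] using hderiv
    · rw [min_eq_left hm0.le, max_eq_right hm0.le]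
      intro t ht
      have h0 := ht.1
      have h1 : 0 < c - t := by linarith [ht.2]
      positivity
  rw [intervalIntegral.integral_eq_sub_of_hasDerivAt_of_le hm0.le hcont hderiv hint]
  have hFm : F φm = L * -Real.log √d := by
    have h0 : (φm - a) ^ 2 - d = 0 := by rw [← hQ]; ring
    have h1 : a - φm = √d := by rw [hm]; ring
    simp [hF, h0, h1]
  have hF0 : F 0 = (-c ^ 2 + c * k + 2 / 3 * k ^ 2) * √(a ^ 2 - d)
      + L * -Real.log (a + √(a ^ 2 - d)) := by
    simp [hF]
  have hab : 0 < a + √(a ^ 2 - d) := by positivity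
  rw [hFm, hF0, Real.log_div hab.ne' hsd.ne', hL]
  have h3 : 3 * c + 2 * k ≠ 0 := by positivity
  field_simp
  ring
end

section
/- Fix a real constant k > 0 and define, for c > 2k, F(c) = ((c² − ck − (2/3)k²)·√(c² − 2ck))/(2(3c + 2k)) − (k²/9)·log((c − (2/3)k + √(c² − 2ck))/√((2/3)kc + (4/9)k²)). Then F is differentiable on (2k, ∞) and for every c > 2k, F'(c) = (3c²(c + k)/(3c + 2k)²)·√((c − 2k)/c) > 0; in particular F is strictly increasing on (2k, ∞). -/
theorem hasDerivAt_sqrt_sq_sub {k c : ℝ} (hs : 0 < c ^ 2 - 2 * c * k) :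
    HasDerivAt (fun x : ℝ => Real.sqrt (x ^ 2 - 2 * x * k))
      ((c - k) / Real.sqrt (c ^ 2 - 2 * c * k)) c := by
  have h : HasDerivAt (fun x : ℝ => x ^ 2 - 2 * x * k) (2 * (c - k)) c := by
    refine (((hasDerivAt_id c).pow 2).sub
      (((hasDerivAt_id c).const_mul 2).mul_const k)).congr_deriv ?_
    simp
    ring
  refine (h.sqrt hs.ne').congr_deriv ?_
  rw [mul_div_mul_left _ _ two_ne_zero]

theorem hasDerivAt_log_div_sqrt {k c : ℝ} (hk : 0 < k) (hc : 2 * k < c) :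
    HasDerivAt (fun x : ℝ => Real.log ((x - (2 / 3) * k + Real.sqrt (x ^ 2 - 2 * x * k))
        / Real.sqrt ((2 / 3) * k * x + (4 / 9) * k ^ 2)))
      (3 * (c + 2 * k) / (2 * (3 * c + 2 * k) * Real.sqrt (c ^ 2 - 2 * c * k))) c := by
  have hc0 : 0 < c := by linarith
  have hq : 0 < c ^ 2 - 2 * c * k := by nlinarith
  have hB : 0 < (2 / 3) * k * c + (4 / 9) * k ^ 2 := by positivity
  have hs := hasDerivAt_sqrt_sq_sub hq
  have hA := ((hasDerivAt_id c).sub_const ((2 / 3) * k)).add hs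
  have hsB := (((hasDerivAt_id c).const_mul ((2 / 3) * k)).add_const
    ((4 / 9) * k ^ 2)).sqrt hB.ne'
  have hspos := Real.sqrt_pos.2 hq
  have hsq := Real.sq_sqrt hq.le
  have hBpos := Real.sqrt_pos.2 hB
  have hBsq := Real.sq_sqrt hB.le
  have hApos : 0 < c - (2 / 3) * k + Real.sqrt (c ^ 2 - 2 * c * k) := by linarith
  refine ((hA.div hsB hBpos.ne').log (div_pos hApos hBpos).ne').congr_deriv ?_
  simp only [id, Pi.add_apply, Pi.div_apply, mul_one]
  set s := Real.sqrt (c ^ 2 - 2 * c * k)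
  set b := Real.sqrt ((2 / 3) * k * c + (4 / 9) * k ^ 2)
  have hlog : ((1 + (c - k) / s) * b - (c - 2 / 3 * k + s) * (2 / 3 * k / (2 * b))) / b ^ 2
      / ((c - 2 / 3 * k + s) / b)
      = (s + c - k) / (s * (c - 2 / 3 * k + s)) - (2 / 3 * k) / (2 * b ^ 2) := by
    generalize c - 2 / 3 * k + s = A at hApos
    field_simp
    ring
  have hD : 0 < 3 * c + 2 * k := by positivity
  have hA' : (s + c - k) / (s * (c - 2 / 3 * k + s))
      = 3 * (c + 2 * k + s) / (2 * (3 * c + 2 * k) * s) := by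
    rw [div_eq_div_iff (by positivity) (by positivity)]
    linear_combination (-3 * s) * hsq
  rw [hlog, hA', hBsq]
  have hB' : (2 / 3 * k) / (2 * (2 / 3 * k * c + 4 / 9 * k ^ 2)) = 3 / (2 * (3 * c + 2 * k)) := by
    rw [div_eq_div_iff (by positivity) (by positivity)]
    ring
  rw [hB']
  field_simp
  ring


/-- The closed-form value `F(c)` of the conserved quantity `S` along the family
of DP solitary waves is differentiable in the speed `c`, with explicit positive
derivative; in particular `F` is strictly increasing on `(2k, ∞)`. -/
theorem DP_dSdc_positive (k : ℝ) (hk : 0 < k) :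
    let F : ℝ → ℝ := fun c =>
      ((c ^ 2 - c * k - (2 / 3) * k ^ 2) * Real.sqrt (c ^ 2 - 2 * c * k))
          / (2 * (3 * c + 2 * k))
        - (k ^ 2 / 9) * Real.log ((c - (2 / 3) * k + Real.sqrt (c ^ 2 - 2 * c * k))
            / Real.sqrt ((2 / 3) * k * c + (4 / 9) * k ^ 2))
    (∀ c ∈ Set.Ioi (2 * k),
      HasDerivAt F ((3 * c ^ 2 * (c + k) / (3 * c + 2 * k) ^ 2) * Real.sqrt ((c - 2 * k) / c)) c
        ∧ 0 < (3 * c ^ 2 * (c + k) / (3 * c + 2 * k) ^ 2) * Real.sqrt ((c - 2 * k) / c)) ∧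
    StrictMonoOn F (Set.Ioi (2 * k)) := by
  intro F
  have hpos : ∀ c ∈ Set.Ioi (2 * k),
      0 < (3 * c ^ 2 * (c + k) / (3 * c + 2 * k) ^ 2) * Real.sqrt ((c - 2 * k) / c) := by
    intro c (hc : 2 * k < c)
    have hc0 : 0 < c := by linarith
    have := Real.sqrt_pos.2 (div_pos (sub_pos.2 hc) hc0)
    positivity
  have hderiv : ∀ c ∈ Set.Ioi (2 * k),
      HasDerivAt F ((3 * c ^ 2 * (c + k) / (3 * c + 2 * k) ^ 2)
        * Real.sqrt ((c - 2 * k) / c)) c := by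
    intro c (hc : 2 * k < c)
    have hc0 : 0 < c := by linarith
    have hq : 0 < c ^ 2 - 2 * c * k := by nlinarith
    have hD : 0 < 3 * c + 2 * k := by positivity
    have hspos := Real.sqrt_pos.2 hq
    have hsq := Real.sq_sqrt hq.le
    have hP := ((((hasDerivAt_id c).pow 2).sub ((hasDerivAt_id c).mul_const k)).sub_const
      ((2 / 3) * k ^ 2)).mul (hasDerivAt_sqrt_sq_sub hq)
    have hQ := (((hasDerivAt_id c).const_mul 3).add_const (2 * k)).const_mul 2
    have hroot : Real.sqrt ((c - 2 * k) / c) = Real.sqrt (c ^ 2 - 2 * c * k) / c := by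
      rw [show (c - 2 * k) / c = (c ^ 2 - 2 * c * k) / c ^ 2 by field_simp,
        Real.sqrt_div hq.le, Real.sqrt_sq hc0.le]
    refine ((hP.div hQ (mul_pos two_pos hD).ne').sub
      ((hasDerivAt_log_div_sqrt hk hc).const_mul (k ^ 2 / 9))).congr_deriv ?_
    rw [hroot]
    simp only [id, Pi.pow_apply, Pi.sub_apply, Pi.mul_apply, mul_one, one_mul]
    set s := Real.sqrt (c ^ 2 - 2 * c * k)
    field_simp
    norm_num
    rw [hsq]
    ring
  refine ⟨fun c hc => ⟨hderiv c hc, hpos c hc⟩, ?_⟩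
  refine strictMonoOn_of_hasDerivWithinAt_pos (convex_Ioi _)
    (fun c hc => (hderiv c hc).continuousAt.continuousWithinAt)
    (fun c hc => (hderiv c (interior_subset hc)).hasDerivWithinAt)
    (fun c hc => hpos c (interior_subset hc))
end
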